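/- Let X₀ be a smooth, embedded, closed plane curve, star-shaped and centrosymmetric with respect to the origin O, and suppose Gage's area-preserving flow with initial curve X₀ has a smooth solution on [0, T*) for some finite T* > 0. Then the curvature of the evolving curve X(·,t) is bounded on [0, T*] uniformly: there exists a constant C, depending only on X₀ and T*, such that |κ(·,t)| ≤ C for all t ∈ [0, T*]. -/

import Mathlib

open Real Set MeasureTheory Filter

noncomputable section

/-- Euclidean norm of a plane vector. -/
def vnorm (v : ℝ × ℝ) : ℝ := Real.sqrt (v.1 ^ 2 + v.2 ^ 2)

/-- Determinant of the 2×2 matrix whose rows are the plane vectors `a`, `b`. -/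
def vdet (a b : ℝ × ℝ) : ℝ := a.1 * b.2 - a.2 * b.1

/-- Unit tangent vector of a plane curve. -/
def unitTangent (X : ℝ → ℝ × ℝ) (φ : ℝ) : ℝ × ℝ :=
  (vnorm (deriv X φ))⁻¹ • deriv X φ

/-- Inward unit normal: the rotation of the unit tangent by +π/2. -/
def innerNormal (X : ℝ → ℝ × ℝ) (φ : ℝ) : ℝ × ℝ :=
  (-(unitTangent X φ).2, (unitTangent X φ).1)

/-- Curvature of a plane curve. -/
def curv (X : ℝ → ℝ × ℝ) (φ : ℝ) : ℝ :=
  vdet (deriv X φ) (deriv (deriv X) φ) / vnorm (deriv X φ) ^ 3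

/-- Length of a closed plane curve parametrized on `[0, 2π]`. -/
def clen (X : ℝ → ℝ × ℝ) : ℝ := ∫ φ in (0:ℝ)..(2 * π), vnorm (deriv X φ)

/-- Enclosed area of a closed plane curve. -/
def carea (X : ℝ → ℝ × ℝ) : ℝ :=
  (1 / 2) * ∫ φ in (0:ℝ)..(2 * π), vdet (X φ) (deriv X φ)

/-- A smooth closed plane curve: a smooth `2π`-periodic map `ℝ → ℝ²` with
nonvanishing derivative. -/
structure IsSmoothClosedCurve (X : ℝ → ℝ × ℝ) : Prop where
  smooth : ContDiff ℝ (⊤ : ℕ∞) X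
  periodic : Function.Periodic X (2 * π)
  regular : ∀ φ, deriv X φ ≠ 0

/-- An embedded closed curve: injective over one period. -/
def IsEmbeddedCurve (X : ℝ → ℝ × ℝ) : Prop := Set.InjOn X (Set.Ico 0 (2 * π))

/-- Star-shapedness with respect to a point `O`: `det(X − O, T) > 0` everywhere. -/
def StarShapedWrt (X : ℝ → ℝ × ℝ) (O : ℝ × ℝ) : Prop :=
  ∀ φ, 0 < vdet (X φ - O) (unitTangent X φ)

/-- Centrosymmetry with respect to a point `O`: the image of the curve is invariant
under the point reflection `Z ↦ 2O − Z`. -/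
def CentroSymmetricWrt (X : ℝ → ℝ × ℝ) (O : ℝ × ℝ) : Prop :=
  (fun Z => (2 : ℝ) • O - Z) '' Set.range X = Set.range X

/-- `X` is a smooth solution of Gage's area-preserving flow on the time set `I`
with initial curve `X₀`: `∂X/∂t = α T + (κ − 2π/L) N`. -/
structure IsGAPFSolutionOn (X : ℝ → ℝ → ℝ × ℝ) (X₀ : ℝ → ℝ × ℝ) (I : Set ℝ) : Prop where
  init : ∀ φ, X 0 φ = X₀ φ
  curve : ∀ t ∈ I, IsSmoothClosedCurve (X t)
  smooth : ContDiffOn ℝ (⊤ : ℕ∞) (fun p : ℝ × ℝ => X p.1 p.2) (I ×ˢ Set.univ)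
  flow : ∃ α : ℝ → ℝ → ℝ,
    ∀ t ∈ I, ∀ φ,
      HasDerivWithinAt (fun τ => X τ φ)
        (α t φ • unitTangent (X t) φ +
          (curv (X t) φ - 2 * π / clen (X t)) • innerNormal (X t) φ) I t

open scoped Topology

/-! ### Smooth functions on an open space-time strip -/

/-- `f` is smooth on the open strip `(0,T) × ℝ`. -/
def Sm (T : ℝ) (f : ℝ → ℝ → ℝ) : Prop :=
  ContDiffOn ℝ (⊤ : ℕ∞) (fun q : ℝ × ℝ => f q.1 q.2) (Set.Ioo 0 T ×ˢ Set.univ)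

/-- Space derivative. -/
def Dx (f : ℝ → ℝ → ℝ) : ℝ → ℝ → ℝ := fun t x => deriv (f t) x

/-- Time derivative. -/
def Dt (f : ℝ → ℝ → ℝ) : ℝ → ℝ → ℝ := fun t x => deriv (fun s => f s x) t

theorem strip_open (T : ℝ) : IsOpen (Set.Ioo 0 T ×ˢ (Set.univ : Set ℝ)) :=
  isOpen_Ioo.prod isOpen_univ

theorem Sm.contDiffAt {T : ℝ} {f : ℝ → ℝ → ℝ} (h : Sm T f) {t : ℝ} (ht : t ∈ Set.Ioo 0 T) (x : ℝ) :
    ContDiffAt ℝ (⊤ : ℕ∞) (fun q : ℝ × ℝ => f q.1 q.2) (t, x) :=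
  ContDiffOn.contDiffAt h ((strip_open T).mem_nhds ⟨ht, mem_univ _⟩)

theorem Sm.hasFDerivAt {T : ℝ} {f : ℝ → ℝ → ℝ} (h : Sm T f) {t : ℝ} (ht : t ∈ Set.Ioo 0 T) (x : ℝ) :
    HasFDerivAt (fun q : ℝ × ℝ => f q.1 q.2) (fderiv ℝ (fun q : ℝ × ℝ => f q.1 q.2) (t, x)) (t, x) :=
  ((h.contDiffAt ht x).differentiableAt (by simp)).hasFDerivAt

theorem Sm.hasDx' {T : ℝ} {f : ℝ → ℝ → ℝ} (h : Sm T f) {t : ℝ} (ht : t ∈ Set.Ioo 0 T) (x : ℝ) :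
    HasDerivAt (f t) (fderiv ℝ (fun q : ℝ × ℝ => f q.1 q.2) (t, x) (0, 1)) x := by
  have h1 : HasDerivAt (fun y : ℝ => (t, y)) ((0 : ℝ), (1 : ℝ)) x :=
    (hasDerivAt_const x t).prodMk (hasDerivAt_id x)
  exact (h.hasFDerivAt ht x).comp_hasDerivAt x h1

theorem Sm.hasDt' {T : ℝ} {f : ℝ → ℝ → ℝ} (h : Sm T f) {t : ℝ} (ht : t ∈ Set.Ioo 0 T) (x : ℝ) :
    HasDerivAt (fun s => f s x) (fderiv ℝ (fun q : ℝ × ℝ => f q.1 q.2) (t, x) (1, 0)) t := by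
  have h1 : HasDerivAt (fun y : ℝ => (y, x)) ((1 : ℝ), (0 : ℝ)) t :=
    (hasDerivAt_id t).prodMk (hasDerivAt_const t x)
  exact (h.hasFDerivAt ht x).comp_hasDerivAt t h1

theorem Sm.hasDx {T : ℝ} {f : ℝ → ℝ → ℝ} (h : Sm T f) {t : ℝ} (ht : t ∈ Set.Ioo 0 T) (x : ℝ) :
    HasDerivAt (f t) (Dx f t x) x :=
  (h.hasDx' ht x).differentiableAt.hasDerivAt

theorem Sm.hasDt {T : ℝ} {f : ℝ → ℝ → ℝ} (h : Sm T f) {t : ℝ} (ht : t ∈ Set.Ioo 0 T) (x : ℝ) :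
    HasDerivAt (fun s => f s x) (Dt f t x) t :=
  (h.hasDt' ht x).differentiableAt.hasDerivAt

theorem Sm.dx {T : ℝ} {f : ℝ → ℝ → ℝ} (h : Sm T f) : Sm T (Dx f) := by
  have h1 : ContDiffOn ℝ (⊤ : ℕ∞) (fun q => fderiv ℝ (fun q : ℝ × ℝ => f q.1 q.2) q (0, 1))
      (Set.Ioo 0 T ×ˢ Set.univ) :=
    (ContDiffOn.fderiv_of_isOpen h (strip_open T) (by simp)).clm_apply contDiffOn_const
  refine h1.congr ?_
  rintro ⟨t, x⟩ ⟨ht, -⟩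
  exact (h.hasDx' ht x).deriv

theorem Sm.dt {T : ℝ} {f : ℝ → ℝ → ℝ} (h : Sm T f) : Sm T (Dt f) := by
  have h1 : ContDiffOn ℝ (⊤ : ℕ∞) (fun q => fderiv ℝ (fun q : ℝ × ℝ => f q.1 q.2) q (1, 0))
      (Set.Ioo 0 T ×ˢ Set.univ) :=
    (ContDiffOn.fderiv_of_isOpen h (strip_open T) (by simp)).clm_apply contDiffOn_const
  refine h1.congr ?_
  rintro ⟨t, x⟩ ⟨ht, -⟩
  exact (h.hasDt' ht x).deriv

theorem mixed_partials {g : ℝ × ℝ → ℝ} {t x : ℝ} (h : ContDiffAt ℝ (⊤ : ℕ∞) g (t, x)) :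
    ∃ d : ℝ, HasDerivAt (fun s => fderiv ℝ g (s, x) (0, 1)) d t ∧
      HasDerivAt (fun y => fderiv ℝ g (t, y) (1, 0)) d x := by
  have h2 : (2 : WithTop ℕ∞) ≤ ((⊤ : ℕ∞) : WithTop ℕ∞) :=
    WithTop.coe_le_coe.2 (le_top : (2 : ℕ∞) ≤ ⊤)
  have hsym : IsSymmSndFDerivAt ℝ g (t, x) := h.isSymmSndFDerivAt (by simpa using h2)
  have hd : HasFDerivAt (fderiv ℝ g) (fderiv ℝ (fderiv ℝ g) (t, x)) (t, x) := by
    have : ContDiffAt ℝ (⊤ : ℕ∞) (fderiv ℝ g) (t, x) := h.fderiv_right (by simp)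
    exact (this.differentiableAt (by simp)).hasFDerivAt
  have hx : HasDerivAt (fun y : ℝ => (t, y)) ((0 : ℝ), (1 : ℝ)) x :=
    (hasDerivAt_const x t).prodMk (hasDerivAt_id x)
  have htt : HasDerivAt (fun y : ℝ => (y, x)) ((1 : ℝ), (0 : ℝ)) t :=
    (hasDerivAt_id t).prodMk (hasDerivAt_const t x)
  have a1 : HasDerivAt (fun s => fderiv ℝ g (s, x)) (fderiv ℝ (fderiv ℝ g) (t, x) (1, 0)) t :=
    hd.comp_hasDerivAt t htt
  have a2 : HasDerivAt (fun y => fderiv ℝ g (t, y)) (fderiv ℝ (fderiv ℝ g) (t, x) (0, 1)) x :=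
    hd.comp_hasDerivAt x hx
  refine ⟨fderiv ℝ (fderiv ℝ g) (t, x) (1, 0) (0, 1), ?_, ?_⟩
  · have := a1.clm_apply (hasDerivAt_const t ((0 : ℝ), (1 : ℝ)))
    simpa using this
  · have := a2.clm_apply (hasDerivAt_const x ((1 : ℝ), (0 : ℝ)))
    rw [hsym (1, 0) (0, 1)]
    simpa using this

theorem Sm.comm {T : ℝ} {f : ℝ → ℝ → ℝ} (h : Sm T f) {t : ℝ} (ht : t ∈ Set.Ioo 0 T) (x : ℝ) :
    Dt (Dx f) t x = Dx (Dt f) t x := by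
  obtain ⟨d, e1, e2⟩ := mixed_partials (h.contDiffAt ht x)
  have f1 : (fun s => Dx f s x) =ᶠ[𝓝 t]
      fun s => fderiv ℝ (fun q : ℝ × ℝ => f q.1 q.2) (s, x) (0, 1) := by
    filter_upwards [isOpen_Ioo.mem_nhds ht] with s hs
    exact (h.hasDx' hs x).deriv
  have f2 : (fun y => Dt f t y) =ᶠ[𝓝 x]
      fun y => fderiv ℝ (fun q : ℝ × ℝ => f q.1 q.2) (t, y) (1, 0) := by
    filter_upwards with y
    exact (h.hasDt' ht y).deriv
  have g1 := (e1.congr_of_eventuallyEq f1).deriv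
  have g2 := (e2.congr_of_eventuallyEq f2).deriv
  exact g1.trans g2.symm

theorem Sm.continuousOn {T : ℝ} {f : ℝ → ℝ → ℝ} (h : Sm T f) :
    ContinuousOn (fun q : ℝ × ℝ => f q.1 q.2) (Set.Ioo 0 T ×ˢ Set.univ) := ContDiffOn.continuousOn h

theorem Sm.continuous_slice {T : ℝ} {f : ℝ → ℝ → ℝ} (h : Sm T f) {t : ℝ} (ht : t ∈ Set.Ioo 0 T) :
    Continuous (f t) :=
  continuous_iff_continuousAt.2 fun x => (h.hasDx ht x).continuousAt

theorem Dx_periodic {f : ℝ → ℝ → ℝ} {t c : ℝ} (h : ∀ x, f t (x + c) = f t x) (x : ℝ) :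
    Dx f t (x + c) = Dx f t x := by
  have : (fun y => f t (y + c)) = f t := funext h
  unfold Dx
  rw [← deriv_comp_add_const, this]

/-! ### Second derivative test -/

theorem second_deriv_test {g g1 : ℝ → ℝ} {g2 x : ℝ} (hmin : IsLocalMin g x)
    (h1 : ∀ y, HasDerivAt g (g1 y) y) (h2 : HasDerivAt g1 g2 x) : g1 x = 0 ∧ 0 ≤ g2 := by
  have hz : g1 x = 0 := hmin.hasDerivAt_eq_zero (h1 x)
  refine ⟨hz, ?_⟩
  by_contra! hneg
  have hd : deriv g = g1 := funext fun y => (h1 y).deriv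
  have hmax : IsLocalMax g x := by
    apply isLocalMax_of_deriv_deriv_neg
    · rw [hd, h2.deriv]; exact hneg
    · rw [hd]; exact hz
    · exact (h1 x).continuousAt
  have hconst : g =ᶠ[𝓝 x] fun _ => g x := by
    filter_upwards [hmin, hmax] with y a b using le_antisymm b a
  have : deriv g =ᶠ[𝓝 x] fun _ => 0 := by
    have := hconst.deriv
    simpa using this
  rw [hd] at this
  have h3 : HasDerivAt g1 0 x := (hasDerivAt_const x (0 : ℝ)).congr_of_eventuallyEq this
  have := h2.unique h3
  linarith

/-! ### Maximum principle -/

theorem max_principle {f : ℝ → ℝ → ℝ} {t0 t1 a b : ℝ}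
    (hc : ContinuousOn (fun q : ℝ × ℝ => f q.1 q.2) (Set.Icc t0 t1 ×ˢ Set.Icc a b))
    (hstart : ∀ x ∈ Set.Icc a b, 0 < f t0 x)
    (hstep : ∀ t ∈ Set.Ioc t0 t1, ∀ x ∈ Set.Icc a b, f t x = 0 →
      (∀ y ∈ Set.Icc a b, 0 ≤ f t y) → ∃ d > 0, HasDerivAt (fun s => f s x) d t) :
    ∀ t ∈ Set.Icc t0 t1, ∀ x ∈ Set.Icc a b, 0 < f t x := by
  by_contra! hcon
  obtain ⟨t', ht', x', hx', hf'⟩ := hcon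
  set K : Set (ℝ × ℝ) := Set.Icc t0 t1 ×ˢ Set.Icc a b with hK
  have hKc : IsCompact K := isCompact_Icc.prod isCompact_Icc
  set S : Set (ℝ × ℝ) := {q ∈ K | f q.1 q.2 ≤ 0} with hS
  have hSc : IsCompact S := by
    refine hKc.of_isClosed_subset ?_ (fun q hq => hq.1)
    have := hc.preimage_isClosed_of_isClosed hKc.isClosed (isClosed_Iic (a := (0 : ℝ)))
    exact this
  have hSne : S.Nonempty := ⟨(t', x'), ⟨ht', hx'⟩, hf'⟩
  obtain ⟨⟨t, x⟩, ⟨⟨ht, hx⟩, hf⟩, hmin⟩ := hSc.exists_isMinOn hSne continuous_fst.continuousOn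
  simp only at ht hx hf
  have hpos : ∀ s ∈ Set.Icc t0 t1, s < t → ∀ y ∈ Set.Icc a b, 0 < f s y := by
    intro s hs hst y hy
    by_contra! hle
    have : t ≤ s := hmin (show (s, y) ∈ S from ⟨⟨hs, hy⟩, hle⟩)
    linarith
  have htt : t0 < t := by
    rcases ht.1.eq_or_lt with h | h
    · rw [← h] at hf
      exact absurd (hstart x hx) (not_lt.2 hf)
    · exact h
  have hnn : ∀ y ∈ Set.Icc a b, 0 ≤ f t y := by
    intro y hy
    have hcs : ContinuousWithinAt (fun s => f s y) (Set.Icc t0 t1) t := by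
      have h1 : ContinuousOn (fun s => f s y) (Set.Icc t0 t1) :=
        hc.comp (f := fun s : ℝ => (s, y)) (by fun_prop) (fun s hs => ⟨hs, hy⟩)
      exact h1 t ht
    have hcs' : Tendsto (fun s => f s y) (𝓝[<] t) (𝓝 (f t y)) := by
      refine (hcs.mono_left ?_)
      rw [nhdsWithin_le_iff]
      filter_upwards [Ioo_mem_nhdsLT htt] with s hs
      exact ⟨hs.1.le, hs.2.le.trans ht.2⟩
    refine ge_of_tendsto hcs' ?_
    filter_upwards [Ioo_mem_nhdsLT htt] with s hs
    exact (hpos s ⟨hs.1.le, hs.2.le.trans ht.2⟩ hs.2 y hy).le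
  have hz : f t x = 0 := le_antisymm hf (hnn x hx)
  obtain ⟨d, hd, hder⟩ := hstep t ⟨htt, ht.2⟩ x hx hz hnn
  have hsl := hasDerivAt_iff_tendsto_slope.1 hder
  have hsl' : Tendsto (slope (fun s => f s x) t) (𝓝[<] t) (𝓝 d) :=
    hsl.mono_left (nhdsWithin_mono _ (fun s (hs : s < t) => hs.ne))
  have h1 : ∀ᶠ s in 𝓝[<] t, 0 < slope (fun s => f s x) t s := hsl'.eventually (lt_mem_nhds hd)
  obtain ⟨s, hs1, hs2⟩ := (h1.and (Ioo_mem_nhdsLT htt)).exists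
  rw [slope_def_field, hz, sub_zero] at hs1
  have := hpos s ⟨hs2.1.le, hs2.2.le.trans ht.2⟩ hs2.2 x hx
  have h3 : f s x / (s - t) < 0 := div_neg_of_pos_of_neg this (by linarith [hs2.2])
  linarith

/-! ### Differentiation under the integral sign -/

theorem Sm.hasDerivAt_integral {T : ℝ} {f : ℝ → ℝ → ℝ} (h : Sm T f) {t : ℝ} (ht : t ∈ Set.Ioo 0 T)
    (a b : ℝ) :
    HasDerivAt (fun s => ∫ x in a..b, f s x) (∫ x in a..b, Dt f t x) t := by
  obtain ⟨l, u, hlu, hlu'⟩ : ∃ l u, t ∈ Set.Ioo l u ∧ Set.Icc l u ⊆ Set.Ioo 0 T := by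
    refine ⟨t / 2, (t + T) / 2, ⟨by linarith [ht.1], by linarith [ht.2]⟩, fun s hs => ⟨by linarith [hs.1, ht.1], by linarith [hs.2, ht.2]⟩⟩
  have hK : IsCompact (Set.Icc l u ×ˢ Set.uIcc a b) := isCompact_Icc.prod isCompact_uIcc
  obtain ⟨C, hC⟩ := hK.exists_bound_of_continuousOn
    (h.dt.continuousOn.mono (Set.prod_mono hlu' (Set.subset_univ _)))
  refine (intervalIntegral.hasDerivAt_integral_of_dominated_loc_of_deriv_le
    (F' := Dt f) (bound := fun _ => C)
    (isOpen_Ioo.mem_nhds hlu) ?_ ?_ ?_ ?_ ?_ ?_).2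
  · filter_upwards [isOpen_Ioo.mem_nhds ht] with s hs
    exact (h.continuous_slice hs).aestronglyMeasurable
  · exact (h.continuous_slice ht).intervalIntegrable _ _
  · exact (h.dt.continuous_slice ht).aestronglyMeasurable
  · refine Eventually.of_forall fun x hx s hs => hC (s, x) ⟨⟨hs.1.le, hs.2.le⟩, Set.uIoc_subset_uIcc hx⟩
  · exact _root_.intervalIntegrable_const
  · exact Eventually.of_forall fun x hx s hs => h.hasDt (hlu' ⟨hs.1.le, hs.2.le⟩) x


/-! ### The polar equation -/

theorem Sm.exp {T : ℝ} {f : ℝ → ℝ → ℝ} (h : Sm T f) : Sm T (fun t x => Real.exp (f t x)) :=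
  ContDiffOn.exp h

theorem Sm.mul {T : ℝ} {f g : ℝ → ℝ → ℝ} (h : Sm T f) (h' : Sm T g) : Sm T (fun t x => f t x * g t x) :=
  ContDiffOn.mul h h'

theorem Sm.add {T : ℝ} {f g : ℝ → ℝ → ℝ} (h : Sm T f) (h' : Sm T g) : Sm T (fun t x => f t x + g t x) :=
  ContDiffOn.add h h'

theorem Sm.sub {T : ℝ} {f g : ℝ → ℝ → ℝ} (h : Sm T f) (h' : Sm T g) : Sm T (fun t x => f t x - g t x) :=
  ContDiffOn.sub h h'

theorem Sm.const (T c : ℝ) : Sm T (fun _ _ => c) := contDiffOn_const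

theorem Sm.pow {T : ℝ} {f : ℝ → ℝ → ℝ} (h : Sm T f) (n : ℕ) : Sm T (fun t x => f t x ^ n) :=
  ContDiffOn.pow h n

theorem Sm.div {T : ℝ} {f g : ℝ → ℝ → ℝ} (h : Sm T f) (h' : Sm T g) (h0 : ∀ t x, g t x ≠ 0) :
    Sm T (fun t x => f t x / g t x) :=
  ContDiffOn.div h h' (fun q _ => h0 q.1 q.2)

/-- The factor `√(1+p²)`, `p = ∂ρ`. -/
def pw (ρ : ℝ → ℝ → ℝ) : ℝ → ℝ → ℝ := fun t x => Real.sqrt (1 + Dx ρ t x ^ 2)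

/-- Curvature in polar coordinates `r = exp ρ`. -/
def pk (ρ : ℝ → ℝ → ℝ) : ℝ → ℝ → ℝ := fun t x =>
  (1 + Dx ρ t x ^ 2 - Dx (Dx ρ) t x) / (Real.exp (ρ t x) * pw ρ t x ^ 3)

/-- Length in polar coordinates. -/
def plen (ρ : ℝ → ℝ → ℝ) (t : ℝ) : ℝ := ∫ x in (0:ℝ)..(2 * π), Real.exp (ρ t x) * pw ρ t x

theorem pw_pos (ρ : ℝ → ℝ → ℝ) (t x : ℝ) : 0 < pw ρ t x := Real.sqrt_pos.2 (by positivity)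

theorem pw_sq (ρ : ℝ → ℝ → ℝ) (t x : ℝ) : pw ρ t x ^ 2 = 1 + Dx ρ t x ^ 2 :=
  Real.sq_sqrt (by positivity)

theorem one_le_pw (ρ : ℝ → ℝ → ℝ) (t x : ℝ) : 1 ≤ pw ρ t x := by
  nlinarith [pw_pos ρ t x, pw_sq ρ t x, sq_nonneg (Dx ρ t x)]

theorem abs_le_pw (ρ : ℝ → ℝ → ℝ) (t x : ℝ) : |Dx ρ t x| ≤ pw ρ t x := by
  apply abs_le_of_sq_le_sq _ (pw_pos ρ t x).le
  rw [pw_sq]; linarith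

/-- `ρ` solves the polar form of the area preserving flow on `(0,T)`. -/
structure Pol (T : ℝ) (ρ : ℝ → ℝ → ℝ) (lam : ℝ → ℝ) : Prop where
  sm : Sm T ρ
  per : ∀ t ∈ Set.Ioo 0 T, ∀ x, ρ t (x + 2 * π) = ρ t x
  pde : ∀ t ∈ Set.Ioo 0 T, ∀ x, Dt ρ t x = -(pk ρ t x - lam t) * pw ρ t x / Real.exp (ρ t x)
  lam_eq : ∀ t ∈ Set.Ioo 0 T, lam t = 2 * π / plen ρ t

theorem Sm.pw {T : ℝ} {ρ : ℝ → ℝ → ℝ} (h : Sm T ρ) : Sm T (pw ρ) := by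
  have h1 : Sm T (fun t x => 1 + Dx ρ t x ^ 2) := (Sm.const T 1).add (h.dx.pow 2)
  exact ContDiffOn.sqrt h1 (fun q _ => by positivity)

theorem Sm.pk {T : ℝ} {ρ : ℝ → ℝ → ℝ} (h : Sm T ρ) : Sm T (pk ρ) := by
  refine Sm.div ((((Sm.const T 1).add (h.dx.pow 2))).sub h.dx.dx) (h.exp.mul (h.pw.pow 3)) ?_
  intro t x
  have := pw_pos ρ t x
  positivity

theorem hasDx_exp {T : ℝ} {ρ : ℝ → ℝ → ℝ} (h : Sm T ρ) {t : ℝ} (ht : t ∈ Set.Ioo 0 T) (x : ℝ) :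
    HasDerivAt (fun y => Real.exp (ρ t y)) (Real.exp (ρ t x) * Dx ρ t x) x :=
  (h.hasDx ht x).exp

theorem hasDt_exp {T : ℝ} {ρ : ℝ → ℝ → ℝ} (h : Sm T ρ) {t : ℝ} (ht : t ∈ Set.Ioo 0 T) (x : ℝ) :
    HasDerivAt (fun s => Real.exp (ρ s x)) (Real.exp (ρ t x) * Dt ρ t x) t :=
  (h.hasDt ht x).exp

theorem hasDx_pw {T : ℝ} {ρ : ℝ → ℝ → ℝ} (h : Sm T ρ) {t : ℝ} (ht : t ∈ Set.Ioo 0 T) (x : ℝ) :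
    HasDerivAt (pw ρ t) (Dx ρ t x * Dx (Dx ρ) t x / pw ρ t x) x := by
  have h1 := (((h.dx.hasDx ht x).pow 2).const_add 1).sqrt
    (ne_of_gt (by positivity : (0:ℝ) < 1 + Dx ρ t x ^ 2))
  refine h1.congr_deriv ?_
  have := (pw_pos ρ t x).ne'
  simp only [Nat.cast_ofNat, Nat.add_one_sub_one, pow_one]
  change 2 * Dx ρ t x * Dx (Dx ρ) t x / (2 * pw ρ t x) = _
  field_simp

theorem hasDt_pw {T : ℝ} {ρ : ℝ → ℝ → ℝ} (h : Sm T ρ) {t : ℝ} (ht : t ∈ Set.Ioo 0 T) (x : ℝ) :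
    HasDerivAt (fun s => pw ρ s x) (Dx ρ t x * Dx (Dt ρ) t x / pw ρ t x) t := by
  have h1 := (((h.dx.hasDt ht x).pow 2).const_add 1).sqrt
    (ne_of_gt (by positivity : (0:ℝ) < 1 + Dx ρ t x ^ 2))
  refine h1.congr_deriv ?_
  have := (pw_pos ρ t x).ne'
  rw [h.comm ht x]
  simp only [Nat.cast_ofNat, Nat.add_one_sub_one, pow_one]
  change 2 * Dx ρ t x * Dx (Dt ρ) t x / (2 * pw ρ t x) = _
  field_simp

section PolSec
variable {T : ℝ} {ρ : ℝ → ℝ → ℝ} {lam : ℝ → ℝ}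

theorem Pol.per1 (P : Pol T ρ lam) {t : ℝ} (ht : t ∈ Set.Ioo 0 T) (x : ℝ) :
    Dx ρ t (x + 2 * π) = Dx ρ t x := Dx_periodic (P.per t ht) x

theorem Pol.per2 (P : Pol T ρ lam) {t : ℝ} (ht : t ∈ Set.Ioo 0 T) (x : ℝ) :
    Dx (Dx ρ) t (x + 2 * π) = Dx (Dx ρ) t x := Dx_periodic (fun y => P.per1 ht y) x

theorem Pol.perw (P : Pol T ρ lam) {t : ℝ} (ht : t ∈ Set.Ioo 0 T) (x : ℝ) :
    pw ρ t (x + 2 * π) = pw ρ t x := by unfold pw; rw [P.per1 ht]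

theorem Pol.perk (P : Pol T ρ lam) {t : ℝ} (ht : t ∈ Set.Ioo 0 T) (x : ℝ) :
    pk ρ t (x + 2 * π) = pk ρ t x := by
  unfold pk; rw [P.per1 ht, P.per2 ht, P.perw ht, P.per t ht]

theorem Pol.plen_pos (P : Pol T ρ lam) {t : ℝ} (ht : t ∈ Set.Ioo 0 T) : 0 < plen ρ t := by
  apply intervalIntegral.intervalIntegral_pos_of_pos
  · exact ((P.sm.exp.mul P.sm.pw).continuous_slice ht).intervalIntegrable _ _
  · intro x; have := pw_pos ρ t x; positivity
  · positivity

theorem Pol.lam_pos (P : Pol T ρ lam) {t : ℝ} (ht : t ∈ Set.Ioo 0 T) : 0 < lam t := by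
  rw [P.lam_eq t ht]; have := P.plen_pos ht; positivity

theorem Pol.int_k (P : Pol T ρ lam) {t : ℝ} (ht : t ∈ Set.Ioo 0 T) :
    ∫ x in (0:ℝ)..(2 * π), pk ρ t x * (Real.exp (ρ t x) * pw ρ t x) = 2 * π := by
  have hd : ∀ x, HasDerivAt (fun y => y - Real.arctan (Dx ρ t y))
      (pk ρ t x * (Real.exp (ρ t x) * pw ρ t x)) x := by
    intro x
    refine ((hasDerivAt_id x).sub (P.sm.dx.hasDx ht x).arctan).congr_deriv ?_
    have h1 := (pw_pos ρ t x).ne'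
    have h2 := pw_sq ρ t x
    have h3 := (Real.exp_pos (ρ t x)).ne'
    unfold pk
    rw [← h2]
    field_simp
  rw [intervalIntegral.integral_eq_sub_of_hasDerivAt (fun x _ => hd x)]
  · have := P.per1 ht 0
    rw [zero_add] at this
    rw [this]; ring
  · exact ((P.sm.pk.mul (P.sm.exp.mul P.sm.pw)).continuous_slice ht).intervalIntegrable _ _

theorem Pol.area_const (P : Pol T ρ lam) {t t' : ℝ} (ht : t ∈ Set.Ioo 0 T) (ht' : t' ∈ Set.Ioo 0 T) :
    ∫ x in (0:ℝ)..(2 * π), Real.exp (ρ t x) ^ 2 = ∫ x in (0:ℝ)..(2 * π), Real.exp (ρ t' x) ^ 2 := by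
  have hder : ∀ s ∈ Set.Ioo 0 T, HasDerivAt (fun s => ∫ x in (0:ℝ)..(2 * π), Real.exp (ρ s x) ^ 2) 0 s := by
    intro s hs
    have h1 := (P.sm.exp.pow 2).hasDerivAt_integral hs 0 (2 * π)
    refine h1.congr_deriv ?_
    have h2 : ∀ x, Dt (fun t x => Real.exp (ρ t x) ^ 2) s x =
        2 * lam s * (Real.exp (ρ s x) * pw ρ s x) - 2 * (pk ρ s x * (Real.exp (ρ s x) * pw ρ s x)) := by
      intro x
      have h3 := ((hasDt_exp P.sm hs x).pow 2).deriv
      refine h3.trans ?_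
      rw [P.pde s hs x]
      have := (Real.exp_pos (ρ s x)).ne'
      field_simp
      push_cast
      ring
    simp_rw [h2]
    rw [intervalIntegral.integral_sub, intervalIntegral.integral_const_mul,
      intervalIntegral.integral_const_mul, P.int_k hs]
    · have h4 := P.lam_eq s hs
      have h5 := (P.plen_pos hs).ne'
      change 2 * lam s * plen ρ s - _ = 0
      rw [h4]; field_simp; ring
    · exact (((P.sm.exp.mul P.sm.pw).continuous_slice hs).intervalIntegrable _ _).const_mul _
    · exact (((P.sm.pk.mul (P.sm.exp.mul P.sm.pw)).continuous_slice hs).intervalIntegrable _ _).const_mul _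
  exact isOpen_Ioo.is_const_of_deriv_eq_zero isPreconnected_Ioo
    (fun s hs => (hder s hs).differentiableAt.differentiableWithinAt)
    (fun s hs => (hder s hs).deriv) ht ht'

theorem Pol.len_deriv (P : Pol T ρ lam) {t : ℝ} (ht : t ∈ Set.Ioo 0 T) :
    ∃ d, HasDerivAt (plen ρ) d t ∧ d ≤ 2 * π * lam t := by
  have h1 := (P.sm.exp.mul P.sm.pw).hasDerivAt_integral ht 0 (2 * π)
  refine ⟨_, h1, ?_⟩
  set B : ℝ → ℝ → ℝ := fun t x => Real.exp (ρ t x) * Dx ρ t x * Dt ρ t x / pw ρ t x with hB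
  have hBs : Sm T B := ((P.sm.exp.mul P.sm.dx).mul P.sm.dt).div P.sm.pw (fun t x => (pw_pos ρ t x).ne')
  have hBx : ∀ x, Dx B t x = Real.exp (ρ t x) * Dx ρ t x ^ 2 * Dt ρ t x / pw ρ t x
      + Real.exp (ρ t x) * Dx (Dx ρ) t x * Dt ρ t x / pw ρ t x
      + Real.exp (ρ t x) * Dx ρ t x * Dx (Dt ρ) t x / pw ρ t x
      - Real.exp (ρ t x) * Dx ρ t x ^ 2 * Dt ρ t x * Dx (Dx ρ) t x / pw ρ t x ^ 3 := by
    intro x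
    have := ((((hasDx_exp P.sm ht x).mul (P.sm.dx.hasDx ht x)).mul (P.sm.dt.hasDx ht x)).div
      (hasDx_pw P.sm ht x) (pw_pos ρ t x).ne').deriv
    refine this.trans ?_
    have h0 := (pw_pos ρ t x).ne'
    simp only [Pi.mul_apply]
    field_simp
  have key : ∀ x, Dt (fun t x => Real.exp (ρ t x) * pw ρ t x) t x =
      Dx B t x - pk ρ t x ^ 2 * (Real.exp (ρ t x) * pw ρ t x)
        + lam t * (pk ρ t x * (Real.exp (ρ t x) * pw ρ t x)) := by
    intro x
    have h3 := ((hasDt_exp P.sm ht x).mul (hasDt_pw P.sm ht x)).deriv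
    refine h3.trans ?_
    rw [hBx x, P.pde t ht x]
    have h0 := (pw_pos ρ t x).ne'
    have h2 := pw_sq ρ t x
    have h3 := (Real.exp_pos (ρ t x)).ne'
    unfold pk
    generalize Dx (Dt ρ) t x = pt
    generalize Dx (Dx ρ) t x = s at *
    generalize pw ρ t x = W at *
    generalize Real.exp (ρ t x) = e at *
    generalize Dx ρ t x = p at *
    have h5 : p ^ 2 = W ^ 2 - 1 := by linarith
    field_simp
    rw [h5]
    ring
  have i1 : IntervalIntegrable (fun x => Dx B t x) volume 0 (2 * π) :=
    (hBs.dx.continuous_slice ht).intervalIntegrable _ _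
  have i2 : IntervalIntegrable (fun x => pk ρ t x ^ 2 * (Real.exp (ρ t x) * pw ρ t x)) volume 0 (2 * π) :=
    (((P.sm.pk.pow 2).mul (P.sm.exp.mul P.sm.pw)).continuous_slice ht).intervalIntegrable _ _
  have i3 : IntervalIntegrable (fun x => lam t * (pk ρ t x * (Real.exp (ρ t x) * pw ρ t x))) volume 0 (2 * π) :=
    (((P.sm.pk.mul (P.sm.exp.mul P.sm.pw)).continuous_slice ht).intervalIntegrable _ _).const_mul _
  simp_rw [key]
  rw [intervalIntegral.integral_add (i1.sub i2) i3, intervalIntegral.integral_sub i1 i2,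
    intervalIntegral.integral_const_mul, P.int_k ht]
  have e1 : ∫ x in (0:ℝ)..(2 * π), Dx B t x = 0 := by
    rw [intervalIntegral.integral_eq_sub_of_hasDerivAt (fun x _ => hBs.hasDx ht x) i1]
    have a1 : Dt ρ t (2 * π) = Dt ρ t 0 := by
      rw [P.pde t ht, P.pde t ht, ← zero_add (2 * π), P.perk ht, P.perw ht, P.per t ht]
    have a2 := P.per1 ht 0
    have a3 := P.perw ht 0
    have a4 := P.per t ht 0
    rw [zero_add] at a2 a3 a4
    simp only [hB, a1, a2, a3, a4, sub_self]
  have e2 : 0 ≤ ∫ x in (0:ℝ)..(2 * π), pk ρ t x ^ 2 * (Real.exp (ρ t x) * pw ρ t x) := by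
    apply intervalIntegral.integral_nonneg (by positivity)
    intro x _
    have := pw_pos ρ t x
    positivity
  rw [e1]; linarith

end PolSec


/-! ### Elementary size bounds -/
section SizeSec
variable {T : ℝ} {ρ : ℝ → ℝ → ℝ} {lam : ℝ → ℝ}

theorem Pol.len_bound (P : Pol T ρ lam) (hT : 0 < T) :
    ∃ Lm > 0, ∀ t ∈ Set.Ico (T / 2) T, plen ρ t ≤ Lm := by
  have hsub : ∀ t ∈ Set.Ico (T / 2) T, t ∈ Set.Ioo 0 T := fun t ht => ⟨by linarith [ht.1], ht.2⟩
  have hant : AntitoneOn (fun t => plen ρ t ^ 2 - 8 * π ^ 2 * t) (Set.Ico (T / 2) T) := by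
    have hd : ∀ t ∈ Set.Ico (T / 2) T, ∃ d, HasDerivAt (fun t => plen ρ t ^ 2 - 8 * π ^ 2 * t) d t ∧ d ≤ 0 := by
      intro t ht
      obtain ⟨d, h1, h2⟩ := P.len_deriv (hsub t ht)
      refine ⟨_, (h1.pow 2).sub ((hasDerivAt_id t).const_mul (8 * π ^ 2)), ?_⟩
      have hL := P.plen_pos (hsub t ht)
      have h3 : lam t * plen ρ t = 2 * π := by
        rw [P.lam_eq t (hsub t ht)]; field_simp
      have h4 : d * plen ρ t ≤ 2 * π * lam t * plen ρ t := mul_le_mul_of_nonneg_right h2 hL.le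
      push_cast
      simp only [pow_one, Nat.add_one_sub_one]
      nlinarith [h4, h3, Real.pi_pos]
    apply antitoneOn_of_deriv_nonpos (convex_Ico _ _)
    · intro t ht
      obtain ⟨d, h1, _⟩ := hd t ht
      exact h1.continuousAt.continuousWithinAt
    · intro t ht
      obtain ⟨d, h1, _⟩ := hd t (interior_subset ht)
      exact h1.differentiableAt.differentiableWithinAt
    · intro t ht
      obtain ⟨d, h1, h2⟩ := hd t (interior_subset ht)
      rw [h1.deriv]; exact h2
  refine ⟨Real.sqrt (plen ρ (T / 2) ^ 2 + 8 * π ^ 2 * T) , Real.sqrt_pos.2 (by positivity), ?_⟩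
  intro t ht
  have := hant ⟨le_rfl, by linarith⟩ ht ht.1
  apply Real.le_sqrt_of_sq_le
  simp only at this
  have h2 : π ^ 2 * t ≤ π ^ 2 * T := mul_le_mul_of_nonneg_left ht.2.le (by positivity)
  have h3 : 0 ≤ π ^ 2 * (T / 2) := by positivity
  linarith

theorem Pol.exp_le_len (P : Pol T ρ lam) {t : ℝ} (ht : t ∈ Set.Ioo 0 T) (x : ℝ) :
    Real.exp (ρ t x) ≤ plen ρ t := by
  have hd : ∀ y, HasDerivAt (fun y => - (Real.exp (ρ t y) * Real.cos (y - x)))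
      (Real.exp (ρ t y) * (Real.sin (y - x) - Dx ρ t y * Real.cos (y - x))) y := by
    intro y
    have h1 : HasDerivAt (fun y => Real.cos (y - x)) (-Real.sin (y - x) * 1) y :=
      ((hasDerivAt_id y).sub_const x).cos
    refine ((hasDx_exp P.sm ht y).mul h1).neg.congr_deriv ?_
    ring
  have hcont : Continuous (fun y => Real.exp (ρ t y) * (Real.sin (y - x) - Dx ρ t y * Real.cos (y - x))) := by
    have h1 := P.sm.continuous_slice ht
    have h2 := P.sm.dx.continuous_slice ht
    fun_prop
  have hcw : Continuous (fun y => Real.exp (ρ t y) * pw ρ t y) := (P.sm.exp.mul P.sm.pw).continuous_slice ht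
  have h0 := intervalIntegral.integral_eq_sub_of_hasDerivAt (a := x) (b := x + π) (fun y _ => hd y)
    (hcont.intervalIntegrable _ _)
  have h1 : ∫ y in x..(x + π), Real.exp (ρ t y) * (Real.sin (y - x) - Dx ρ t y * Real.cos (y - x))
      ≤ ∫ y in x..(x + π), Real.exp (ρ t y) * pw ρ t y := by
    apply intervalIntegral.integral_mono (by linarith [Real.pi_pos]) (hcont.intervalIntegrable _ _)
      (hcw.intervalIntegrable _ _)
    intro y
    apply mul_le_mul_of_nonneg_left _ (Real.exp_pos _).le
    apply Real.le_sqrt_of_sq_le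
    nlinarith [Real.sin_sq_add_cos_sq (y - x), sq_nonneg (Dx ρ t y * Real.sin (y - x) + Real.cos (y - x)), sq_nonneg (Dx ρ t y)]
  have h2 : ∫ y in x..(x + 2 * π), Real.exp (ρ t y) * pw ρ t y = plen ρ t := by
    have hper : Function.Periodic (fun y => Real.exp (ρ t y) * pw ρ t y) (2 * π) := by
      intro y; simp only [P.per t ht, P.perw ht]
    have := hper.intervalIntegral_add_eq x 0
    rw [zero_add] at this
    exact this
  have h3 : ∫ y in x..(x + 2 * π), Real.exp (ρ t y) * pw ρ t y
      = (∫ y in x..(x + π), Real.exp (ρ t y) * pw ρ t y) +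
        ∫ y in (x + π)..(x + 2 * π), Real.exp (ρ t y) * pw ρ t y :=
    (intervalIntegral.integral_add_adjacent_intervals (hcw.intervalIntegrable _ _)
      (hcw.intervalIntegrable _ _)).symm
  have h4 : 0 ≤ ∫ y in (x + π)..(x + 2 * π), Real.exp (ρ t y) * pw ρ t y := by
    apply intervalIntegral.integral_nonneg (by linarith [Real.pi_pos])
    intro y _
    have := pw_pos ρ t y
    positivity
  have h5 := Real.exp_pos (ρ t (x + π))
  simp only [add_sub_cancel_left, Real.cos_pi, sub_self, Real.cos_zero] at h0
  linarith

/-- Collected bounds. -/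
theorem Pol.size (P : Pol T ρ lam) (hT : 0 < T) : ∃ R > 0, ∃ Λ > 0, ∃ l0 > 0, ∃ R1 > 0,
    ∀ t ∈ Set.Ico (T / 2) T, (∀ x, Real.exp (ρ t x) ≤ R) ∧ l0 ≤ lam t ∧ lam t ≤ Λ ∧
      ∃ xm, R1 ≤ Real.exp (ρ t xm) := by
  obtain ⟨Lm, hLm, hL⟩ := P.len_bound hT
  have hsub : ∀ t ∈ Set.Ico (T / 2) T, t ∈ Set.Ioo 0 T := fun t ht => ⟨by linarith [ht.1], ht.2⟩
  set A := ∫ x in (0:ℝ)..(2 * π), Real.exp (ρ (T / 2) x) ^ 2 with hA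
  have h2 : T / 2 ∈ Set.Ioo 0 T := ⟨by linarith, by linarith⟩
  have hApos : 0 < A := by
    apply intervalIntegral.intervalIntegral_pos_of_pos
    · exact ((P.sm.exp.pow 2).continuous_slice h2).intervalIntegrable _ _
    · intro x; positivity
    · positivity
  refine ⟨Lm, hLm, 2 * π / Real.sqrt A, by positivity, 2 * π / Lm, by positivity,
    Real.sqrt (A / (2 * π)), by positivity, ?_⟩
  intro t ht
  have htt := hsub t ht
  have hLp := P.plen_pos htt
  have hAt : ∫ x in (0:ℝ)..(2 * π), Real.exp (ρ t x) ^ 2 = A := P.area_const htt h2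
  have hc2 := (P.sm.exp.pow 2).continuous_slice htt
  have hcw : Continuous (fun y => Real.exp (ρ t y) * pw ρ t y) := (P.sm.exp.mul P.sm.pw).continuous_slice htt
  have hAL : A ≤ plen ρ t ^ 2 := by
    have : ∫ x in (0:ℝ)..(2 * π), Real.exp (ρ t x) ^ 2 ≤
        ∫ x in (0:ℝ)..(2 * π), plen ρ t * (Real.exp (ρ t x) * pw ρ t x) := by
      apply intervalIntegral.integral_mono (by positivity) (hc2.intervalIntegrable _ _)
        ((hcw.intervalIntegrable _ _).const_mul _)
      intro x
      have a1 := P.exp_le_len htt x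
      have a2 := one_le_pw ρ t x
      have a3 := Real.exp_pos (ρ t x)
      simp only
      rw [sq]
      exact mul_le_mul a1 (by nlinarith) a3.le hLp.le
    rw [hAt, intervalIntegral.integral_const_mul] at this
    rw [sq]; exact this
  refine ⟨fun x => (P.exp_le_len htt x).trans (hL t ht), ?_, ?_, ?_⟩
  · rw [P.lam_eq t htt]
    exact div_le_div_of_nonneg_left (by positivity) hLp (hL t ht)
  · rw [P.lam_eq t htt]
    exact div_le_div_of_nonneg_left (by positivity) (Real.sqrt_pos.2 hApos) (Real.sqrt_le_iff.2 ⟨hLp.le, hAL⟩)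
  · by_contra! hcon
    have hlt : ∀ x, Real.exp (ρ t x) ^ 2 < A / (2 * π) := by
      intro x
      have := hcon x
      exact (Real.lt_sqrt (Real.exp_pos _).le).1 this
    have : ∫ x in (0:ℝ)..(2 * π), Real.exp (ρ t x) ^ 2 < ∫ x in (0:ℝ)..(2 * π), A / (2 * π) := by
      apply intervalIntegral.integral_lt_integral_of_continuousOn_of_le_of_exists_lt (by positivity)
        hc2.continuousOn continuousOn_const (fun x _ => (hlt x).le) ⟨0, ⟨le_rfl, by positivity⟩, hlt 0⟩
    rw [hAt, intervalIntegral.integral_const] at this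
    simp only [sub_zero, smul_eq_mul] at this
    have h6 : 2 * π * (A / (2 * π)) = A := by field_simp
    linarith

end SizeSec


/-! ### Gradient bound -/

theorem periodic_bound {g : ℝ → ℝ} {c : ℝ} (hc : 0 < c) (hg : Continuous g) (hp : ∀ x, g (x + c) = g x) :
    ∃ C > 0, ∀ x, |g x| ≤ C := by
  obtain ⟨C, hC⟩ := (isCompact_Icc (a := (0:ℝ)) (b := c)).exists_bound_of_continuousOn hg.continuousOn
  refine ⟨|C| + 1, by positivity, fun x => ?_⟩
  have hper : Function.Periodic g c := hp
  obtain ⟨y, hy, hxy⟩ := hper.exists_mem_Ico₀ hc x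
  rw [hxy]
  have := hC y ⟨hy.1, hy.2.le⟩
  rw [Real.norm_eq_abs] at this
  linarith [le_abs_self C]

theorem periodic_mp {T t0 : ℝ} {f : ℝ → ℝ → ℝ} (hf : Sm T f) (h0 : 0 < t0)
    (hper : ∀ t ∈ Set.Ioo 0 T, ∀ x, f t (x + 2 * π) = f t x)
    (hstart : ∀ x, 0 < f t0 x)
    (hstep : ∀ t ∈ Set.Ioo t0 T, ∀ x, f t x = 0 → Dx f t x = 0 → 0 ≤ Dx (Dx f) t x → 0 < Dt f t x) :
    ∀ t ∈ Set.Ico t0 T, ∀ x, 0 < f t x := by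
  intro t1 ht1 x1
  have hsub : ∀ t ∈ Set.Icc t0 t1, t ∈ Set.Ioo 0 T := fun t ht => ⟨by linarith [ht.1], by linarith [ht.2, ht1.2]⟩
  have hper' : ∀ t ∈ Set.Ioo 0 T, Function.Periodic (f t) (2 * π) := hper
  have key := max_principle (f := f) (t0 := t0) (t1 := t1) (a := 0) (b := 2 * π)
    (hf.continuousOn.mono (Set.prod_mono hsub (Set.subset_univ _))) (fun x _ => hstart x) ?_
  · obtain ⟨y, hy, hxy⟩ := (hper' t1 ⟨by linarith [ht1.1], ht1.2⟩).exists_mem_Ico₀ (by positivity) x1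
    rw [hxy]
    exact key t1 ⟨ht1.1, le_rfl⟩ y ⟨hy.1, hy.2.le⟩
  · intro t ht x hx hz hnn
    have htt := hsub t ⟨ht.1.le, ht.2⟩
    have hnn' : ∀ y, 0 ≤ f t y := by
      intro y
      obtain ⟨z, hz, hyz⟩ := (hper' t htt).exists_mem_Ico₀ (by positivity) y
      rw [hyz]
      exact hnn z ⟨hz.1, hz.2.le⟩
    have hmin : IsLocalMin (f t) x := Eventually.of_forall fun y => by rw [hz]; exact hnn' y
    obtain ⟨a1, a2⟩ := second_deriv_test hmin (fun y => hf.hasDx htt y) (hf.dx.hasDx htt x)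
    exact ⟨_, hstep t ⟨ht.1, by linarith [ht.2, ht1.2]⟩ x hz a1 a2, hf.hasDt htt x⟩

section GradSec
variable {T : ℝ} {ρ : ℝ → ℝ → ℝ} {lam : ℝ → ℝ}

theorem Pol.pde2 (P : Pol T ρ lam) {t : ℝ} (ht : t ∈ Set.Ioo 0 T) (x : ℝ) :
    Dt ρ t x = (Dx (Dx ρ) t x / (1 + Dx ρ t x ^ 2) - 1) / Real.exp (ρ t x) ^ 2
      + lam t * pw ρ t x / Real.exp (ρ t x) := by
  rw [P.pde t ht x]
  unfold pk
  have h0 := (pw_pos ρ t x).ne'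
  have h2 := pw_sq ρ t x
  have h3 := (Real.exp_pos (ρ t x)).ne'
  rw [← h2]
  field_simp
  ring

theorem Pol.pde2x (P : Pol T ρ lam) {t : ℝ} (ht : t ∈ Set.Ioo 0 T) (x : ℝ) :
    Dx (Dt ρ) t x = (Dx (Dx (Dx ρ)) t x / pw ρ t x ^ 2
        - 2 * Dx ρ t x * Dx (Dx ρ) t x ^ 2 / pw ρ t x ^ 4
        - 2 * Dx ρ t x * (Dx (Dx ρ) t x / pw ρ t x ^ 2 - 1)) / Real.exp (ρ t x) ^ 2
      + lam t * (Dx ρ t x * Dx (Dx ρ) t x / pw ρ t x - pw ρ t x * Dx ρ t x) / Real.exp (ρ t x) := by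
  have hfun : Dt ρ t = fun x => (Dx (Dx ρ) t x / pw ρ t x ^ 2 - 1) / Real.exp (ρ t x) ^ 2
      + lam t * pw ρ t x / Real.exp (ρ t x) := by
    funext y
    rw [P.pde2 ht y, pw_sq]
  have h0 := (pw_pos ρ t x).ne'
  have h3 := (Real.exp_pos (ρ t x)).ne'
  have hs := P.sm.dx.dx.hasDx ht x
  have hw := hasDx_pw P.sm ht x
  have he := hasDx_exp P.sm ht x
  have hd := ((((hs.div (hw.pow 2) (pow_ne_zero 2 h0)).sub_const 1).div (he.pow 2) (pow_ne_zero 2 h3)).add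
    ((hw.const_mul (lam t)).div he h3)).deriv
  have : Dx (Dt ρ) t x = deriv (Dt ρ t) x := rfl
  rw [this, hfun]
  refine hd.trans ?_
  simp only [Pi.pow_apply, Pi.div_apply]
  field_simp
  push_cast
  ring

theorem Pol.grad (P : Pol T ρ lam) (hT : 0 < T) {R l0 : ℝ} (hR : 0 < R) (hl : 0 < l0)
    (hb : ∀ t ∈ Set.Ico (T / 2) T, (∀ x, Real.exp (ρ t x) ≤ R) ∧ l0 ≤ lam t) :
    ∃ M > 0, ∀ t ∈ Set.Ico (T / 2) T, ∀ x, Real.exp (ρ t x) * pw ρ t x ≤ M := by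
  have h2 : T / 2 ∈ Set.Ioo 0 T := ⟨by linarith, by linarith⟩
  obtain ⟨C, hC, hCb⟩ := periodic_bound (c := 2 * π) (by positivity) ((P.sm.exp.mul P.sm.pw).continuous_slice h2)
    (fun x => by simp only [P.per _ h2, P.perw h2])
  set M : ℝ := C + 2 * R + 2 / l0 + 1 with hM
  have hl' : 0 < 2 / l0 := by positivity
  have hMpos : 0 < M := by positivity
  set f : ℝ → ℝ → ℝ := fun t x => M ^ 2 - Real.exp (ρ t x) ^ 2 * (1 + Dx ρ t x ^ 2) with hf
  have hfs : Sm T f := (Sm.const T (M ^ 2)).sub ((P.sm.exp.pow 2).mul ((Sm.const T 1).add (P.sm.dx.pow 2)))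
  have key := periodic_mp (t0 := T / 2) hfs (by linarith) ?_ ?_ ?_
  · refine ⟨M, hMpos, fun t ht x => ?_⟩
    have h := key t ht x
    apply le_of_sq_le_sq _ hMpos.le
    rw [mul_pow, pw_sq]
    simp only [hf] at h
    linarith
  · intro t ht x
    simp only [hf, P.per t ht, P.per1 ht]
  · intro x
    have h := hCb x
    simp only [hf]
    rw [← pw_sq, ← mul_pow]
    have h5 := (abs_le.1 h).2
    have h6 : 0 < Real.exp (ρ (T / 2) x) * pw ρ (T / 2) x := mul_pos (Real.exp_pos _) (pw_pos _ _ _)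
    have h7 : Real.exp (ρ (T / 2) x) * pw ρ (T / 2) x < M := by linarith
    nlinarith
  · intro t ht x hz hz1 hz2
    have htt : t ∈ Set.Ioo 0 T := ⟨by linarith [ht.1], ht.2⟩
    have hbt := hb t ⟨ht.1.le, ht.2⟩
    have hd1 : ∀ y, HasDerivAt (f t) (- (2 * Dx ρ t y * Real.exp (ρ t y) ^ 2 * (1 + Dx ρ t y ^ 2 + Dx (Dx ρ) t y))) y := by
      intro y
      refine ((((hasDx_exp P.sm htt y).pow 2).mul (((P.sm.dx.hasDx htt y).pow 2).const_add 1)).const_sub (M ^ 2)).congr_deriv ?_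
      simp only [Pi.pow_apply]
      push_cast
      ring
    have e1 : Dx f t = fun y => - (2 * Dx ρ t y * Real.exp (ρ t y) ^ 2 * (1 + Dx ρ t y ^ 2 + Dx (Dx ρ) t y)) :=
      funext fun y => (hd1 y).deriv
    have hd2 := ((((P.sm.dx.hasDx htt x).const_mul 2).mul ((hasDx_exp P.sm htt x).pow 2)).mul
        ((((P.sm.dx.hasDx htt x).pow 2).const_add 1).add (P.sm.dx.dx.hasDx htt x))).neg.deriv
    have e2 : Dx (Dx f) t x = deriv (fun y => - (2 * Dx ρ t y * Real.exp (ρ t y) ^ 2 * (1 + Dx ρ t y ^ 2 + Dx (Dx ρ) t y))) x := by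
      rw [← e1]; rfl
    have hd3 : Dt f t x = _ := ((((hasDt_exp P.sm htt x).pow 2).mul
      (((P.sm.dx.hasDt htt x).pow 2).const_add 1)).const_sub (M ^ 2)).deriv
    rw [e2] at hz2
    replace hz2 := hz2.trans_eq hd2
    rw [hd3, P.sm.comm htt, P.pde2x htt, P.pde2 htt, ← pw_sq]
    rw [e1] at hz1
    beta_reduce at hz1
    simp only [hf] at hz
    simp only [Pi.pow_apply, Pi.mul_apply, Pi.add_apply] at hz2 ⊢
    have h0 := pw_pos ρ t x
    have h2 := pw_sq ρ t x
    have h3 := (Real.exp_pos (ρ t x))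
    have h4 := hbt.1 x
    have h5 := hbt.2
    generalize Dx (Dx (Dx ρ)) t x = q at *
    generalize Dx (Dx ρ) t x = s at *
    generalize Dx ρ t x = p at *
    generalize pw ρ t x = W at *
    generalize Real.exp (ρ t x) = e at *
    generalize lam t = l at *
    have hMR : (2 * R) ^ 2 < M ^ 2 := by
      apply pow_lt_pow_left₀ _ (by positivity) (by norm_num); linarith
    have hp : 1 < p ^ 2 := by
      by_contra! hle
      have : e ^ 2 * (1 + p ^ 2) ≤ R ^ 2 * 2 := by
        apply mul_le_mul (by gcongr) (by linarith) (by positivity) (by positivity)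
      nlinarith
    have hp0 : p ≠ 0 := by rintro rfl; norm_num at hp
    have hs : s = -W ^ 2 := by
      have : 1 + p ^ 2 + s = 0 := by
        have h6 : 2 * p * e ^ 2 ≠ 0 := by positivity
        have h7 : (2 * p * e ^ 2) * (1 + p ^ 2 + s) = 0 := by linarith
        exact (mul_eq_zero.1 h7).resolve_left h6
      linarith
    have hq : p * q ≤ 2 * p ^ 2 * W ^ 2 := by
      have h8 : 1 + p ^ 2 + s = 0 := by linarith
      rw [h8] at hz2
      push_cast at hz2
      have h9 : e ^ 2 * (2 * p * (2 * p * s + q)) ≤ 0 := by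
        simp only [mul_zero, zero_add, Nat.add_one_sub_one, pow_one] at hz2
        linarith
      have h10 : p * (2 * p * s + q) ≤ 0 := by
        by_contra! hh
        have : 0 < e ^ 2 * (2 * (p * (2 * p * s + q))) := by positivity
        linarith
      rw [hs] at h10
      linarith
    have heW : e * W = M := by
      have : (e * W) ^ 2 = M ^ 2 := by rw [mul_pow, h2]; linarith
      exact (sq_eq_sq₀ (by positivity) hMpos.le).1 this
    have hlM : 2 < l * (e * W) := by
      rw [heW]
      have : 2 / l0 < M := by linarith
      rw [div_lt_iff₀ hl] at this
      nlinarith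
    have hpW : p ^ 2 = W ^ 2 - 1 := by linarith
    have goal_eq : -(((2:ℕ):ℝ) * e ^ (2 - 1) * (e * ((s / W ^ 2 - 1) / e ^ 2 + l * W / e)) * W ^ 2 +
      e ^ 2 * (((2:ℕ):ℝ) * p ^ (2 - 1) * ((q / W ^ 2 - 2 * p * s ^ 2 / W ^ 4 - 2 * p * (s / W ^ 2 - 1)) / e ^ 2
        + l * (p * s / W - W * p) / e)))
       = 2 * ((p ^ 2 - 1) * (l * (e * W) - 2) + (2 * p ^ 2 * W ^ 2 - p * q) / W ^ 2) := by
      subst hs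
      push_cast
      field_simp
      ring_nf
      have h12 : p ^ 2 = W ^ 2 - 1 := hpW
      rw [h12]; ring
    rw [← h2, goal_eq]
    have : 0 ≤ (2 * p ^ 2 * W ^ 2 - p * q) / W ^ 2 := div_nonneg (by linarith) (by positivity)
    have : 0 < (p ^ 2 - 1) * (l * (e * W) - 2) := mul_pos (by linarith) (by linarith)
    linarith

end GradSec


/-! ### Barriers: lower bound for the radius -/
section BarSec
variable {T : ℝ} {ρ : ℝ → ℝ → ℝ} {lam : ℝ → ℝ}

set_option maxHeartbeats 1000000 in
theorem Pol.sector_aux (P : Pol T ρ lam) {R M c0 t1 xm K : ℝ} (hR : 0 < R) (hM : 0 < M) (hc0 : 0 < c0)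
    (ht1 : t1 ∈ Set.Ioo 0 T) (hxm : 2 * c0 ≤ Real.exp (ρ t1 xm) ^ 2)
    (hb : ∀ t ∈ Set.Ico t1 T, ∀ x, Real.exp (ρ t x) ≤ R ∧ Real.exp (ρ t x) * pw ρ t x ≤ M)
    (hK : K = 16 * R ^ 2 * M ^ 2 / c0 + c0)
    (hτ : (8 * K / c0 + 7) * (T - t1) ≤ c0 / 2) :
    ∀ t ∈ Set.Ico t1 T, ∀ y ∈ Set.Icc (xm - π) (xm + π),
      0 < Real.exp (ρ t y) ^ 2 - (c0 - K * (y - xm) ^ 2 - (8 * K / c0 + 7) * (t - t1)) := by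
  have hKpos : 0 < K := by rw [hK]; positivity
  have hKc : c0 ≤ K := by rw [hK]; linarith [show 0 ≤ 16 * R ^ 2 * M ^ 2 / c0 by positivity]
  set K' := 8 * K / c0 + 7 with hK'
  have hK'pos : 0 < K' := by positivity
  intro t2 ht2 y hy
  have hsub : ∀ t ∈ Set.Icc t1 t2, t ∈ Set.Ioo 0 T := fun t ht => ⟨by linarith [ht.1, ht1.1], by linarith [ht.2, ht2.2]⟩
  set f : ℝ → ℝ → ℝ := fun t y => Real.exp (ρ t y) ^ 2 - (c0 - K * (y - xm) ^ 2 - K' * (t - t1)) with hf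
  have hdh : ∀ t ∈ Set.Ioo 0 T, ∀ y, HasDerivAt (fun y => Real.exp (ρ t y) ^ 2) (2 * (Real.exp (ρ t y) ^ 2 * Dx ρ t y)) y := by
    intro t ht y
    refine ((hasDx_exp P.sm ht y).pow 2).congr_deriv ?_
    push_cast; ring
  refine max_principle (f := f) (t0 := t1) (t1 := t2) (a := xm - π) (b := xm + π) ?_ ?_ ?_ t2 ⟨ht2.1, le_rfl⟩ y hy
  · have h1 : ContinuousOn (fun q : ℝ × ℝ => Real.exp (ρ q.1 q.2) ^ 2) (Set.Icc t1 t2 ×ˢ Set.Icc (xm - π) (xm + π)) :=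
      (P.sm.exp.pow 2).continuousOn.mono (Set.prod_mono hsub (Set.subset_univ _))
    exact h1.sub (by fun_prop)
  · intro y _
    simp only [hf, sub_self, mul_zero, sub_zero]
    have hlip : |Real.exp (ρ t1 y) ^ 2 - Real.exp (ρ t1 xm) ^ 2| ≤ 2 * R * M * |y - xm| := by
      have := Convex.norm_image_sub_le_of_norm_hasDerivWithin_le (f := fun y => Real.exp (ρ t1 y) ^ 2)
        (s := Set.univ) (C := 2 * R * M) (x := xm) (y := y)
        (fun z _ => (hdh t1 ht1 z).hasDerivWithinAt) ?_ convex_univ (mem_univ _) (mem_univ _)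
      · simpa [Real.norm_eq_abs] using this
      · intro z _
        obtain ⟨b1, b2⟩ := hb t1 ⟨le_rfl, ht1.2⟩ z
        have b3 := abs_le_pw ρ t1 z
        have b4 := Real.exp_pos (ρ t1 z)
        rw [Real.norm_eq_abs, abs_mul, abs_mul, abs_of_pos (by positivity : (0:ℝ) < 2),
          abs_of_pos (by positivity : (0:ℝ) < Real.exp (ρ t1 z) ^ 2)]
        calc 2 * (Real.exp (ρ t1 z) ^ 2 * |Dx ρ t1 z|) = 2 * (Real.exp (ρ t1 z) * (Real.exp (ρ t1 z) * |Dx ρ t1 z|)) := by ring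
          _ ≤ 2 * (R * M) := by
            gcongr
            exact (mul_le_mul_of_nonneg_left b3 b4.le).trans b2
          _ = _ := by ring
    by_cases hy : 2 * R * M * |y - xm| ≤ c0 / 2
    · have := (abs_le.1 (hlip.trans hy)).1
      have : 0 ≤ K * (y - xm) ^ 2 := by positivity
      linarith
    · push Not at hy
      have h1 : (c0 / 2) ^ 2 < (2 * R * M * |y - xm|) ^ 2 := by
        apply pow_lt_pow_left₀ hy (by positivity) (by norm_num)
      rw [mul_pow, sq_abs] at h1
      have h2 : c0 < 16 * R ^ 2 * M ^ 2 / c0 * (y - xm) ^ 2 := by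
        rw [div_mul_eq_mul_div, lt_div_iff₀ hc0]; nlinarith
      have h3 : 16 * R ^ 2 * M ^ 2 / c0 * (y - xm) ^ 2 ≤ K * (y - xm) ^ 2 := by
        apply mul_le_mul_of_nonneg_right _ (sq_nonneg _); rw [hK]; linarith
      have := Real.exp_pos (ρ t1 y)
      nlinarith
  · intro t ht x hx hz hnn
    have htt := hsub t ⟨ht.1.le, ht.2⟩
    have hpos := Real.exp_pos (ρ t x)
    have hK't : 0 ≤ K' * (t - t1) := mul_nonneg hK'pos.le (by linarith [ht.1])
    have hK't2 : K' * (t - t1) ≤ c0 / 2 :=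
      (mul_le_mul_of_nonneg_left (by linarith [ht.2, ht2.2]) hK'pos.le).trans hτ
    have hπ : 1 < π := by linarith [Real.pi_gt_three]
    have hmemI : x ∈ Set.Ioo (xm - π) (xm + π) := by
      have hne : (x - xm) ^ 2 ≠ π ^ 2 := by
        intro h
        simp only [hf, h] at hz
        have hpp : 1 < π ^ 2 := by nlinarith
        have : c0 < K * π ^ 2 := lt_of_le_of_lt hKc (by linarith [mul_lt_mul_of_pos_left hpp hKpos])
        nlinarith
      refine ⟨lt_of_le_of_ne hx.1 ?_, lt_of_le_of_ne hx.2 ?_⟩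
      · rintro h; apply hne; rw [← h]; ring
      · rintro h; apply hne; rw [h]; ring
    have hmin : IsLocalMin (f t) x := by
      filter_upwards [isOpen_Ioo.mem_nhds hmemI] with z hzz
      rw [hz]; exact hnn z ⟨hzz.1.le, hzz.2.le⟩
    have hd1 : ∀ y, HasDerivAt (f t) (2 * (Real.exp (ρ t y) ^ 2 * Dx ρ t y) + 2 * K * (y - xm)) y := by
      intro y
      have h1 : HasDerivAt (fun y => c0 - K * (y - xm) ^ 2 - K' * (t - t1)) (-(K * (2 * (y - xm)))) y := by
        refine ((((((hasDerivAt_id y).sub_const xm).pow 2).const_mul K).const_sub c0).sub_const _).congr_deriv ?_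
        simp
      refine ((hdh t htt y).sub h1).congr_deriv ?_
      ring
    have hd2 : HasDerivAt (fun y => 2 * (Real.exp (ρ t y) ^ 2 * Dx ρ t y) + 2 * K * (y - xm))
        (2 * (2 * (Real.exp (ρ t x) ^ 2 * Dx ρ t x) * Dx ρ t x + Real.exp (ρ t x) ^ 2 * Dx (Dx ρ) t x) + 2 * K) x := by
      refine ((((hdh t htt x).mul (P.sm.dx.hasDx htt x)).const_mul 2).add
        (((hasDerivAt_id x).sub_const xm).const_mul (2 * K))).congr_deriv ?_
      simp
    obtain ⟨a1, a2⟩ := second_deriv_test hmin hd1 hd2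
    have hd3 : HasDerivAt (fun s => f s x) (2 * (Real.exp (ρ t x) ^ 2 * Dt ρ t x) + K') t := by
      have h1 : HasDerivAt (fun s => c0 - K * (x - xm) ^ 2 - K' * (s - t1)) (-K') t := by
        refine ((((hasDerivAt_id t).sub_const t1).const_mul K').const_sub _).congr_deriv ?_
        simp
      refine (((hasDt_exp P.sm htt x).pow 2).sub h1).congr_deriv ?_
      push_cast; ring
    refine ⟨_, ?_, hd3⟩
    rw [P.pde2 htt x]
    have hl := P.lam_pos htt
    have hw := pw_pos ρ t x
    simp only [hf] at hz
    generalize Dx (Dx ρ) t x = s at *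
    generalize Dx ρ t x = p at *
    generalize pw ρ t x = W at *
    generalize Real.exp (ρ t x) = e at *
    generalize lam t = l at *
    set z := x - xm with hzdef
    set h := e ^ 2 with hh
    have hhpos : 0 < h := by positivity
    have e1 : 2 * (h * ((s / (1 + p ^ 2) - 1) / h + l * W / e)) = 2 * (s / (1 + p ^ 2) - 1) + 2 * (h * (l * W / e)) := by
      field_simp
    rw [e1]
    have e2 : 0 < 2 * (h * (l * W / e)) := by positivity
    have hhp : h * p = - (K * z) := by linarith
    have hhz : h = c0 - K * z ^ 2 - K' * (t - t1) := by linarith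
    have hKz : 0 ≤ K * z ^ 2 := by positivity
    have hbig : c0 / 4 ≤ h * (1 + p ^ 2) := by
      by_cases h4 : c0 / 4 ≤ h
      · nlinarith [sq_nonneg p]
      · push Not at h4
        have h5 : c0 / 4 ≤ K * z ^ 2 := by linarith
        have h6 : h * (h * (1 + p ^ 2)) = h ^ 2 + K * (K * z ^ 2) := by
          have : h * (h * (1 + p ^ 2)) = h ^ 2 + (h * p) ^ 2 := by ring
          rw [this, hhp]; ring
        have h7 : h * (c0 / 4) ≤ K * (K * z ^ 2) := by
          apply mul_le_mul (by linarith) h5 (by positivity) hKpos.le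
        have h8 : h * (c0 / 4) ≤ h * (h * (1 + p ^ 2)) := by rw [h6]; nlinarith
        exact le_of_mul_le_mul_left h8 hhpos
    have hs : -(4 * K / c0) - 2 ≤ s / (1 + p ^ 2) := by
      rw [le_div_iff₀ (by positivity)]
      have h9 : -K - 2 * h * p ^ 2 ≤ h * s := by linarith
      have h10 : K ≤ (4 * K / c0) * (h * (1 + p ^ 2)) := by
        have : K = (4 * K / c0) * (c0 / 4) := by field_simp
        calc K = (4 * K / c0) * (c0 / 4) := this
          _ ≤ _ := mul_le_mul_of_nonneg_left hbig (by positivity)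
      have h11 : h * ((-(4 * K / c0) - 2) * (1 + p ^ 2)) ≤ h * s := by
        have h12 : h * ((-(4 * K / c0) - 2) * (1 + p ^ 2)) = -((4 * K / c0) * (h * (1 + p ^ 2))) - 2 * h * p ^ 2 - 2 * h := by ring
        linarith
      exact le_of_mul_le_mul_left h11 hhpos
    have : K' = 2 * (4 * K / c0) + 7 := by rw [hK']; ring
    linarith

theorem Pol.sector (P : Pol T ρ lam) (hT : 0 < T) {R M R1 : ℝ} (hR : 0 < R) (hM : 0 < M) (hR1 : 0 < R1)
    (hb : ∀ t ∈ Set.Ico (T / 2) T, ∀ x, Real.exp (ρ t x) ≤ R ∧ Real.exp (ρ t x) * pw ρ t x ≤ M)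
    (hxm : ∀ t ∈ Set.Ico (T / 2) T, ∃ xm, R1 ≤ Real.exp (ρ t xm)) :
    ∃ t1 ∈ Set.Ico (T / 2) T, ∃ xm x1 r0 : ℝ, 0 < x1 ∧ x1 < 1 ∧ 0 < r0 ∧
      ∀ t ∈ Set.Ico t1 T, ∀ y, |y - xm| ≤ x1 → r0 ≤ Real.exp (ρ t y) := by
  set c0 := R1 ^ 2 / 2 with hc
  have hc0 : 0 < c0 := by positivity
  set K := 16 * R ^ 2 * M ^ 2 / c0 + c0 with hK
  have hKpos : 0 < K := by positivity
  have hKc : c0 ≤ K := by rw [hK]; linarith [show 0 ≤ 16 * R ^ 2 * M ^ 2 / c0 by positivity]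
  set τ := c0 / 2 / (8 * K / c0 + 7) with hτ
  have hτpos : 0 < τ := by positivity
  set t1 := max (T / 2) (T - τ) with ht1
  have h1 : t1 ∈ Set.Ico (T / 2) T := ⟨le_max_left _ _, max_lt (by linarith) (by linarith)⟩
  obtain ⟨xm, hxm⟩ := hxm t1 h1
  have hττ : (8 * K / c0 + 7) * (T - t1) ≤ c0 / 2 := by
    have : T - t1 ≤ τ := by linarith [le_max_right (T / 2) (T - τ)]
    calc (8 * K / c0 + 7) * (T - t1) ≤ (8 * K / c0 + 7) * τ := mul_le_mul_of_nonneg_left this (by positivity)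
      _ = c0 / 2 := by rw [hτ]; field_simp
  have key := P.sector_aux (xm := xm) hR hM hc0 ⟨by linarith [h1.1], h1.2⟩
    (by have := pow_le_pow_left₀ hR1.le hxm 2; rw [hc]; linarith)
    (fun t ht x => hb t ⟨h1.1.trans ht.1, ht.2⟩ x) hK hττ
  have hx1 : c0 / (4 * K) < 1 := by rw [div_lt_one (by positivity)]; linarith
  refine ⟨t1, h1, xm, Real.sqrt (c0 / (4 * K)), Real.sqrt (c0 / 4), by positivity, ?_, by positivity, ?_⟩
  · rw [Real.sqrt_lt' one_pos]; simpa using hx1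
  · intro t ht y hy
    have hy1 : |y - xm| ≤ 1 := by
      refine hy.trans ?_
      rw [Real.sqrt_le_iff]; exact ⟨by norm_num, by linarith⟩
    have hy2 : K * (y - xm) ^ 2 ≤ c0 / 4 := by
      have h := pow_le_pow_left₀ (abs_nonneg _) hy 2
      rw [sq_abs, Real.sq_sqrt (by positivity)] at h
      calc K * (y - xm) ^ 2 ≤ K * (c0 / (4 * K)) := mul_le_mul_of_nonneg_left h hKpos.le
        _ = c0 / 4 := by field_simp
    have hπ := Real.pi_gt_three
    have hk := key t ht y ⟨by linarith [(abs_le.1 hy1).1], by linarith [(abs_le.1 hy1).2]⟩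
    have h5 : (8 * K / c0 + 7) * (t - t1) ≤ c0 / 2 :=
      (mul_le_mul_of_nonneg_left (by linarith [ht.2]) (by positivity)).trans hττ
    rw [Real.sqrt_le_iff]
    exact ⟨(Real.exp_pos _).le, by linarith⟩

theorem Pol.lower (P : Pol T ρ lam) {t1 xm x1 r0 : ℝ} (h1 : t1 ∈ Set.Ioo 0 T)
    (hper : ∀ t ∈ Set.Ioo 0 T, ∀ x, ρ t (x + π) = ρ t x)
    (hx1 : 0 < x1) (hx1' : x1 < 1) (hr0 : 0 < r0)
    (hs : ∀ t ∈ Set.Ico t1 T, ∀ y, |y - xm| ≤ x1 → r0 ≤ Real.exp (ρ t y)) :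
    ∃ c > 0, ∀ t ∈ Set.Ico t1 T, ∀ x, c ≤ Real.exp (ρ t x) := by
  have hπ := Real.pi_gt_three
  have hsinpos : ∀ y ∈ Set.Icc (xm + x1) (xm + π - x1), 0 < Real.sin (y - xm) := fun y hy =>
    Real.sin_pos_of_pos_of_lt_pi (by linarith [hy.1]) (by linarith [hy.2])
  have hsx1 : 0 < Real.sin x1 := Real.sin_pos_of_pos_of_lt_pi hx1 (by linarith)
  have hcont : ContinuousOn (fun y => Real.exp (ρ t1 y) * Real.sin (y - xm)) (Set.Icc (xm + x1) (xm + π - x1)) := by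
    have := P.sm.continuous_slice h1
    fun_prop
  obtain ⟨y0, hy0, hmin0⟩ := isCompact_Icc.exists_isMinOn (Set.nonempty_Icc.2 (by linarith)) hcont
  set m := Real.exp (ρ t1 y0) * Real.sin (y0 - xm) with hm
  have hmpos : 0 < m := mul_pos (Real.exp_pos _) (hsinpos y0 hy0)
  set a := min m (r0 * Real.sin x1) / 2 with ha
  have hmin : 0 < min m (r0 * Real.sin x1) := lt_min hmpos (mul_pos hr0 hsx1)
  have hapos : 0 < a := by positivity
  have ham : a < m := by linarith [min_le_left m (r0 * Real.sin x1)]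
  have har : a < r0 * Real.sin x1 := by linarith [min_le_right m (r0 * Real.sin x1)]
  have key : ∀ t ∈ Set.Ico t1 T, ∀ y ∈ Set.Icc (xm + x1) (xm + π - x1), a ≤ Real.exp (ρ t y) := by
    intro t2 ht2 y hy
    have hsub : ∀ t ∈ Set.Icc t1 t2, t ∈ Set.Ioo 0 T := fun t ht => ⟨by linarith [ht.1, h1.1], by linarith [ht.2, ht2.2]⟩
    set f : ℝ → ℝ → ℝ := fun t y => Real.exp (ρ t y) * Real.sin (y - xm) - a with hf
    have hmain := max_principle (f := f) (t0 := t1) (t1 := t2) (a := xm + x1) (b := xm + π - x1) ?_ ?_ ?_ t2 ⟨ht2.1, le_rfl⟩ y hy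
    · simp only [hf] at hmain
      have := Real.exp_pos (ρ t2 y)
      nlinarith [Real.sin_le_one (y - xm)]
    · have h1 : ContinuousOn (fun q : ℝ × ℝ => Real.exp (ρ q.1 q.2)) (Set.Icc t1 t2 ×ˢ Set.Icc (xm + x1) (xm + π - x1)) :=
        P.sm.exp.continuousOn.mono (Set.prod_mono hsub (Set.subset_univ _))
      exact (h1.mul (by fun_prop)).sub continuousOn_const
    · intro z hz
      have : m ≤ Real.exp (ρ t1 z) * Real.sin (z - xm) := hmin0 hz
      simp only [hf]; linarith
    · intro t ht x hx hz hnn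
      have htt := hsub t ⟨ht.1.le, ht.2⟩
      have htI : t ∈ Set.Ico t1 T := ⟨ht.1.le, htt.2⟩
      have hpos := Real.exp_pos (ρ t x)
      have hmemI : x ∈ Set.Ioo (xm + x1) (xm + π - x1) := by
        refine ⟨lt_of_le_of_ne hx.1 ?_, lt_of_le_of_ne hx.2 ?_⟩
        · intro h
          have h2 := hs t htI x (by rw [← h, add_sub_cancel_left, abs_of_pos hx1])
          simp only [hf, ← h, add_sub_cancel_left] at hz h2
          nlinarith
        · intro h
          have h2 := hs t htI (xm - x1) (by rw [sub_sub_cancel_left, abs_neg, abs_of_pos hx1])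
          have h3 : ρ t x = ρ t (xm - x1) := by rw [← hper t htt (xm - x1), h]; ring_nf
          have h4 : Real.sin (x - xm) = Real.sin x1 := by
            rw [h, ← Real.sin_pi_sub]; ring_nf
          simp only [hf, h3, h4] at hz h2
          nlinarith
      have hmin : IsLocalMin (f t) x := by
        filter_upwards [isOpen_Ioo.mem_nhds hmemI] with z hzz
        rw [hz]; exact hnn z ⟨hzz.1.le, hzz.2.le⟩
      have hsn : ∀ y, HasDerivAt (fun y => Real.sin (y - xm)) (Real.cos (y - xm)) y := fun y => by
        simpa using ((hasDerivAt_id y).sub_const xm).sin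
      have hcs : ∀ y, HasDerivAt (fun y => Real.cos (y - xm)) (-Real.sin (y - xm)) y := fun y => by
        simpa using ((hasDerivAt_id y).sub_const xm).cos
      have hd1 : ∀ y, HasDerivAt (f t) (Real.exp (ρ t y) * Dx ρ t y * Real.sin (y - xm) + Real.exp (ρ t y) * Real.cos (y - xm)) y :=
        fun y => ((hasDx_exp P.sm htt y).mul (hsn y)).sub_const a
      have hd2 := ((((hasDx_exp P.sm htt x).mul (P.sm.dx.hasDx htt x)).mul (hsn x)).add
        ((hasDx_exp P.sm htt x).mul (hcs x)))
      obtain ⟨a1, a2⟩ := second_deriv_test hmin hd1 hd2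
      refine ⟨_, ?_, ((hasDt_exp P.sm htt x).mul_const (Real.sin (x - xm))).sub_const a⟩
      have hs := hsinpos x hx
      have hl := P.lam_pos htt
      have hw := pw_pos ρ t x
      rw [P.pde2 htt x]
      simp only [Pi.mul_apply] at a2
      generalize Dx (Dx ρ) t x = s at *
      generalize Dx ρ t x = p at *
      generalize pw ρ t x = W at *
      generalize Real.exp (ρ t x) = e at *
      generalize lam t = l at *
      generalize Real.sin (x - xm) = S at *
      generalize Real.cos (x - xm) = C at *
      have hC : C = - (p * S) := by
        have : e * (p * S + C) = 0 := by linarith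
        have := (mul_eq_zero.1 this).resolve_left hpos.ne'
        linarith
      rw [hC] at a2
      have hss : 1 + p ^ 2 ≤ s := by
        have : 0 ≤ (e * S) * (s - (1 + p ^ 2)) := by nlinarith
        have := nonneg_of_mul_nonneg_right this (by positivity)
        linarith
      have : 0 ≤ (s / (1 + p ^ 2) - 1) / e ^ 2 := by
        apply div_nonneg _ (by positivity)
        rw [sub_nonneg, le_div_iff₀ (by positivity)]; linarith
      have : 0 < l * W / e := by positivity
      positivity
  refine ⟨min a r0, lt_min hapos hr0, fun t ht x => ?_⟩
  have htt : t ∈ Set.Ioo 0 T := ⟨by linarith [ht.1, h1.1], ht.2⟩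
  have hp : Function.Periodic (ρ t) π := hper t htt
  obtain ⟨y, hy, hxy⟩ := hp.exists_mem_Ico (by positivity) x (xm - x1)
  rw [hxy]
  by_cases h : y ≤ xm + x1
  · exact (min_le_right _ _).trans (hs t ht y (abs_le.2 ⟨by linarith [hy.1], by linarith⟩))
  · push Not at h
    exact (min_le_left _ _).trans (key t ht y ⟨h.le, by linarith [hy.2]⟩)

end BarSec


/-! ### Evolution of the support function and of the curvature -/

/-- Support function `det(X,T)` in polar coordinates. -/
def pu (ρ : ℝ → ℝ → ℝ) : ℝ → ℝ → ℝ := fun t x => Real.exp (ρ t x) / pw ρ t x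

theorem pu_pos (ρ : ℝ → ℝ → ℝ) (t x : ℝ) : 0 < pu ρ t x := div_pos (Real.exp_pos _) (pw_pos _ _ _)

theorem Sm.pu {T : ℝ} {ρ : ℝ → ℝ → ℝ} (h : Sm T ρ) : Sm T (pu ρ) :=
  h.exp.div h.pw (fun t x => (pw_pos ρ t x).ne')

section CurvSec
variable {T : ℝ} {ρ : ℝ → ℝ → ℝ} {lam : ℝ → ℝ}

theorem pk_s (ρ : ℝ → ℝ → ℝ) (t x : ℝ) :
    Dx (Dx ρ) t x = pw ρ t x ^ 2 - Real.exp (ρ t x) * pw ρ t x ^ 3 * pk ρ t x := by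
  unfold pk
  rw [← pw_sq]
  have := (pw_pos ρ t x).ne'
  field_simp
  ring

theorem hasDx_pu (h : Sm T ρ) {t : ℝ} (ht : t ∈ Set.Ioo 0 T) (x : ℝ) :
    HasDerivAt (pu ρ t) (Real.exp (ρ t x) ^ 2 * Dx ρ t x * pk ρ t x) x := by
  have h0 := (pw_pos ρ t x).ne'
  refine ((hasDx_exp h ht x).div (hasDx_pw h ht x) h0).congr_deriv ?_
  rw [pk_s]
  field_simp
  ring

theorem Dxx_pu (h : Sm T ρ) {t : ℝ} (ht : t ∈ Set.Ioo 0 T) (x : ℝ) :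
    Dx (Dx (pu ρ)) t x = 2 * Real.exp (ρ t x) ^ 2 * Dx ρ t x ^ 2 * pk ρ t x
      + Real.exp (ρ t x) ^ 2 * Dx (Dx ρ) t x * pk ρ t x
      + Real.exp (ρ t x) ^ 2 * Dx ρ t x * Dx (pk ρ) t x := by
  have e1 : Dx (pu ρ) t = fun x => Real.exp (ρ t x) ^ 2 * Dx ρ t x * pk ρ t x :=
    funext fun y => (hasDx_pu h ht y).deriv
  have e2 : Dx (Dx (pu ρ)) t x = deriv (fun x => Real.exp (ρ t x) ^ 2 * Dx ρ t x * pk ρ t x) x := by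
    rw [← e1]; rfl
  rw [e2]
  have hd := ((((hasDx_exp h ht x).pow 2).mul (h.dx.hasDx ht x)).mul (h.pk.hasDx ht x)).deriv
  refine hd.trans ?_
  simp only [Pi.mul_apply, Pi.pow_apply]
  push_cast
  ring

theorem Pol.V (P : Pol T ρ lam) {t : ℝ} (ht : t ∈ Set.Ioo 0 T) (x : ℝ) :
    Dt ρ t x = -(pk ρ t x - lam t) / pu ρ t x := by
  rw [P.pde t ht x]; unfold pu
  have := (pw_pos ρ t x).ne'
  field_simp

theorem Pol.Vx (P : Pol T ρ lam) {t : ℝ} (ht : t ∈ Set.Ioo 0 T) (x : ℝ) :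
    Dx (Dt ρ) t x = -Dx (pk ρ) t x / pu ρ t x + (pk ρ t x - lam t) * Dx (pu ρ) t x / pu ρ t x ^ 2 := by
  have e1 : Dt ρ t = fun x => -(pk ρ t x - lam t) / pu ρ t x := funext fun y => P.V ht y
  have e2 : Dx (Dt ρ) t x = deriv (fun x => -(pk ρ t x - lam t) / pu ρ t x) x := by rw [← e1]; rfl
  have h0 := (pu_pos ρ t x).ne'
  rw [e2]
  refine ((((P.sm.pk.hasDx ht x).sub_const (lam t)).neg).div (P.sm.pu.hasDx ht x) h0).deriv.trans ?_
  simp only [Pi.neg_apply]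
  field_simp
  ring

theorem Pol.Vxx (P : Pol T ρ lam) {t : ℝ} (ht : t ∈ Set.Ioo 0 T) (x : ℝ) :
    Dx (Dx (Dt ρ)) t x = -Dx (Dx (pk ρ)) t x / pu ρ t x + 2 * Dx (pk ρ) t x * Dx (pu ρ) t x / pu ρ t x ^ 2
      + (pk ρ t x - lam t) * Dx (Dx (pu ρ)) t x / pu ρ t x ^ 2
      - 2 * (pk ρ t x - lam t) * Dx (pu ρ) t x ^ 2 / pu ρ t x ^ 3 := by
  have e1 : Dx (Dt ρ) t = fun x => -Dx (pk ρ) t x / pu ρ t x + (pk ρ t x - lam t) * Dx (pu ρ) t x / pu ρ t x ^ 2 :=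
    funext fun y => P.Vx ht y
  have e2 : Dx (Dx (Dt ρ)) t x = deriv (fun x => -Dx (pk ρ) t x / pu ρ t x + (pk ρ t x - lam t) * Dx (pu ρ) t x / pu ρ t x ^ 2) x := by
    rw [← e1]; rfl
  have h0 := (pu_pos ρ t x).ne'
  rw [e2]
  have hu := P.sm.pu.hasDx ht x
  refine ((((P.sm.pk.dx.hasDx ht x).neg).div hu h0).add
    ((((P.sm.pk.hasDx ht x).sub_const (lam t)).mul (P.sm.pu.dx.hasDx ht x)).div (hu.pow 2) (pow_ne_zero 2 h0))).deriv.trans ?_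
  simp only [Pi.neg_apply, Pi.mul_apply, Pi.pow_apply]
  push_cast
  field_simp
  ring

theorem hasDt_pk (h : Sm T ρ) {t : ℝ} (ht : t ∈ Set.Ioo 0 T) (x : ℝ) :
    Dt (pk ρ) t x = -pk ρ t x * Dt ρ t x +
      (2 * Dx ρ t x / (Real.exp (ρ t x) * pw ρ t x ^ 3) - 3 * Dx ρ t x * pk ρ t x / pw ρ t x ^ 2) * Dx (Dt ρ) t x
      - Dx (Dx (Dt ρ)) t x / (Real.exp (ρ t x) * pw ρ t x ^ 3) := by
  have e1 : Dt (Dx ρ) t = Dx (Dt ρ) t := funext fun y => h.comm ht y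
  have e2 : Dt (Dx (Dx ρ)) t x = Dx (Dx (Dt ρ)) t x := by
    rw [h.dx.comm ht x]
    change deriv (Dt (Dx ρ) t) x = deriv (Dx (Dt ρ) t) x
    rw [e1]
  have h0 := pw_pos ρ t x
  have h1 := Real.exp_pos (ρ t x)
  have hd := ((((h.dx.hasDt ht x).pow 2).const_add 1).sub (h.dx.dx.hasDt ht x)).div
    ((hasDt_exp h ht x).mul ((hasDt_pw h ht x).pow 3)) (by simp only [Pi.mul_apply, Pi.pow_apply]; positivity)
  refine hd.deriv.trans ?_
  rw [e2, e1]
  simp only [Pi.mul_apply, Pi.pow_apply, Pi.sub_apply]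
  rw [pk_s ρ, ← pw_sq]
  push_cast
  field_simp
  ring

theorem hasDt_pu (h : Sm T ρ) {t : ℝ} (ht : t ∈ Set.Ioo 0 T) (x : ℝ) :
    Dt (pu ρ) t x = pu ρ t x * Dt ρ t x - Real.exp (ρ t x) * Dx ρ t x * Dx (Dt ρ) t x / pw ρ t x ^ 3 := by
  have h0 := (pw_pos ρ t x).ne'
  refine ((hasDt_exp h ht x).div (hasDt_pw h ht x) h0).deriv.trans ?_
  unfold pu
  field_simp

/-- The transport coefficient. -/
def pb (ρ : ℝ → ℝ → ℝ) (lam : ℝ → ℝ) (t x : ℝ) : ℝ :=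
  -2 * Dx ρ t x / (Real.exp (ρ t x) * pw ρ t x) ^ 2 + lam t * Dx ρ t x / (Real.exp (ρ t x) * pw ρ t x)

theorem Pol.evol_u (P : Pol T ρ lam) {t : ℝ} (ht : t ∈ Set.Ioo 0 T) (x : ℝ) :
    Dt (pu ρ) t x = Dx (Dx (pu ρ)) t x / (Real.exp (ρ t x) * pw ρ t x) ^ 2 + pb ρ lam t x * Dx (pu ρ) t x
      + pk ρ t x ^ 2 * pu ρ t x - 2 * pk ρ t x + lam t := by
  rw [hasDt_pu P.sm ht, P.Vx ht, P.V ht, Dxx_pu P.sm ht]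
  have e1 : Dx (pu ρ) t x = Real.exp (ρ t x) ^ 2 * Dx ρ t x * pk ρ t x := (hasDx_pu P.sm ht x).deriv
  rw [e1, pk_s ρ]
  unfold pb pu
  have h0 := pw_pos ρ t x
  have h2 := pw_sq ρ t x
  have h3 := Real.exp_pos (ρ t x)
  generalize Dx (pk ρ) t x = k1 at *
  generalize pk ρ t x = k at *
  generalize Dx ρ t x = p at *
  generalize pw ρ t x = W at *
  generalize Real.exp (ρ t x) = e at *
  generalize lam t = l at *
  have hpW : p ^ 2 = W ^ 2 - 1 := by linarith
  field_simp
  ring_nf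
  simp only [hpW]
  ring

theorem Pol.evol_k (P : Pol T ρ lam) {t : ℝ} (ht : t ∈ Set.Ioo 0 T) (x : ℝ) :
    Dt (pk ρ) t x = Dx (Dx (pk ρ)) t x / (Real.exp (ρ t x) * pw ρ t x) ^ 2 + pb ρ lam t x * Dx (pk ρ) t x
      + pk ρ t x ^ 2 * (pk ρ t x - lam t) := by
  rw [hasDt_pk P.sm ht, P.Vxx ht, P.Vx ht, P.V ht, Dxx_pu P.sm ht]
  have e1 : Dx (pu ρ) t x = Real.exp (ρ t x) ^ 2 * Dx ρ t x * pk ρ t x := (hasDx_pu P.sm ht x).deriv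
  rw [e1, pk_s ρ]
  unfold pb pu
  have h0 := pw_pos ρ t x
  have h2 := pw_sq ρ t x
  have h3 := Real.exp_pos (ρ t x)
  generalize Dx (Dx (pk ρ)) t x = k2 at *
  generalize Dx (pk ρ) t x = k1 at *
  generalize pk ρ t x = k at *
  generalize Dx ρ t x = p at *
  generalize pw ρ t x = W at *
  generalize Real.exp (ρ t x) = e at *
  generalize lam t = l at *
  have hpW : p ^ 2 = W ^ 2 - 1 := by linarith
  field_simp
  ring_nf
  simp only [hpW]
  ring

theorem Pol.peru (P : Pol T ρ lam) {t : ℝ} (ht : t ∈ Set.Ioo 0 T) (x : ℝ) :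
    pu ρ t (x + 2 * π) = pu ρ t x := by
  unfold pu; rw [P.perw ht, P.per t ht]

theorem Pol.curv_bound (P : Pol T ρ lam) {t1 δ Λ : ℝ} (h1 : t1 ∈ Set.Ioo 0 T) (hδ : 0 < δ) (hΛ : 0 < Λ)
    (hu : ∀ t ∈ Set.Ico t1 T, ∀ x, 2 * δ ≤ pu ρ t x) (hl : ∀ t ∈ Set.Ico t1 T, lam t ≤ Λ)
    (huM : ∃ U, ∀ t ∈ Set.Ico t1 T, ∀ x, pu ρ t x ≤ U) :
    ∃ C, ∀ t ∈ Set.Ico t1 T, ∀ x, |pk ρ t x| ≤ C := by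
  obtain ⟨C0, hC0, hC0b⟩ := periodic_bound (c := 2 * π) (by positivity) (P.sm.pk.continuous_slice h1)
    (fun x => P.perk h1 x)
  obtain ⟨U, hU⟩ := huM
  set C := (C0 + Λ + 1) / δ + 3 / δ ^ 2 with hC
  have hCpos : 0 < C := by positivity
  have hCδ : C0 + Λ + 1 ≤ C * δ := by
    have : C * δ = (C0 + Λ + 1) + 3 / δ := by rw [hC]; field_simp
    rw [this]; linarith [show 0 < 3 / δ by positivity]
  have hCδ2 : 2 < C * δ ^ 2 := by
    have : C * δ ^ 2 = (C0 + Λ + 1) * δ + 3 := by rw [hC]; field_simp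
    rw [this]; linarith [show 0 < (C0 + Λ + 1) * δ by positivity]
  have hsub : ∀ t ∈ Set.Ioo t1 T, t ∈ Set.Ioo 0 T := fun t ht => ⟨h1.1.trans ht.1, ht.2⟩
  have main : ∀ σ : ℝ, (σ = 1 ∨ σ = -1) → ∀ t ∈ Set.Ico t1 T, ∀ x, 0 < C * (pu ρ t x - δ) - σ * pk ρ t x := by
    intro σ hσ
    set f : ℝ → ℝ → ℝ := fun t x => C * (pu ρ t x - δ) - σ * pk ρ t x with hf
    have hfs : Sm T f := ((Sm.const T C).mul (P.sm.pu.sub (Sm.const T δ))).sub ((Sm.const T σ).mul P.sm.pk)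
    refine periodic_mp hfs h1.1 ?_ ?_ ?_
    · intro t ht x; simp only [P.peru ht, P.perk ht]
    · intro x
      have a1 := hu t1 ⟨le_rfl, h1.2⟩ x
      have a2 := abs_le.1 (hC0b x)
      have a3 : C * δ ≤ C * (pu ρ t1 x - δ) := mul_le_mul_of_nonneg_left (by linarith) hCpos.le
      change 0 < C * (pu ρ t1 x - δ) - σ * pk ρ t1 x
      rcases hσ with rfl | rfl <;> linarith
    · intro t ht x hz hz1 hz2
      have htt := hsub t ht
      have hd1 : ∀ y, Dx f t y = C * Dx (pu ρ) t y - σ * Dx (pk ρ) t y := fun y =>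
        ((((P.sm.pu.hasDx htt y).sub_const δ).const_mul C).sub ((P.sm.pk.hasDx htt y).const_mul σ)).deriv
      have hd2 : Dx (Dx f) t x = C * Dx (Dx (pu ρ)) t x - σ * Dx (Dx (pk ρ)) t x := by
        change deriv (Dx f t) x = _
        rw [funext hd1]
        exact (((P.sm.pu.dx.hasDx htt x).const_mul C).sub ((P.sm.pk.dx.hasDx htt x).const_mul σ)).deriv
      have hd3 : Dt f t x = C * Dt (pu ρ) t x - σ * Dt (pk ρ) t x :=
        ((((P.sm.pu.hasDt htt x).sub_const δ).const_mul C).sub ((P.sm.pk.hasDt htt x).const_mul σ)).deriv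
      have huu := hu t ⟨ht.1.le, ht.2⟩ x
      have hll := hl t ⟨ht.1.le, ht.2⟩
      have hlp := P.lam_pos htt
      have hew : 0 < (Real.exp (ρ t x) * pw ρ t x) ^ 2 := by have := pw_pos ρ t x; positivity
      rw [hd3, P.evol_u htt, P.evol_k htt]
      rw [hd1] at hz1
      rw [hd2] at hz2
      change C * (pu ρ t x - δ) - σ * pk ρ t x = 0 at hz
      have hdiv := div_nonneg hz2 hew.le
      rw [sub_div] at hdiv
      generalize (Real.exp (ρ t x) * pw ρ t x) ^ 2 = E at *
      generalize pb ρ lam t x = b at *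
      generalize Dx (Dx (pu ρ)) t x = u2 at *
      generalize Dx (Dx (pk ρ)) t x = k2 at *
      generalize Dx (pu ρ) t x = u1 at *
      generalize Dx (pk ρ) t x = k1 at *
      generalize pu ρ t x = u at *
      generalize pk ρ t x = k at *
      generalize lam t = l at *
      have hred : C * (u2 / E + b * u1 + k ^ 2 * u - 2 * k + l) - σ * (k2 / E + b * k1 + k ^ 2 * (k - l))
          = (C * u2 / E - σ * k2 / E) + b * (C * u1 - σ * k1) + k ^ 2 * (C * (u - δ) - σ * k)
            + (C * δ * k ^ 2 - 2 * C * k + C * l + σ * l * k ^ 2) := by ring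
      rw [hred, hz1, hz, mul_zero, mul_zero]
      have hfin : 0 < C * δ * k ^ 2 - 2 * C * k + C * l + σ * l * k ^ 2 := by
        have hCl : 0 < C * l := by positivity
        rcases hσ with rfl | rfl
        · have hk : C * δ ≤ k := by
            have : C * δ ≤ C * (u - δ) := mul_le_mul_of_nonneg_left (by linarith) hCpos.le
            linarith
          have hk0 : 0 < k := lt_of_lt_of_le (by positivity) hk
          have : 2 < δ * k := by nlinarith
          have : 0 < C * k * (δ * k - 2) := by
            apply mul_pos (by positivity); linarith
          have : 0 < l * k ^ 2 := by positivity
          nlinarith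
        · have hk : k ≤ 0 := by
            have : 0 ≤ C * (u - δ) := mul_nonneg hCpos.le (by linarith)
            linarith
          have : 0 ≤ (C * δ - l) * k ^ 2 := mul_nonneg (by linarith) (sq_nonneg _)
          have : 0 ≤ C * (-k) := mul_nonneg hCpos.le (by linarith)
          linarith
      linarith
  refine ⟨C * (U - δ), fun t ht x => ?_⟩
  have m1 := main 1 (Or.inl rfl) t ht x
  have m2 := main (-1) (Or.inr rfl) t ht x
  have m3 : C * (pu ρ t x - δ) ≤ C * (U - δ) := mul_le_mul_of_nonneg_left (by linarith [hU t ht x]) hCpos.le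
  rw [abs_le]; constructor <;> linarith

/-- Main a priori estimate. -/
theorem Pol.apriori (P : Pol T ρ lam) (hT : 0 < T) (hper : ∀ t ∈ Set.Ioo 0 T, ∀ x, ρ t (x + π) = ρ t x) :
    ∃ t1 ∈ Set.Ioo 0 T, ∃ c > 0, ∃ C, ∀ t ∈ Set.Ico t1 T, ∀ x, c ≤ pu ρ t x ∧ |pk ρ t x| ≤ C := by
  obtain ⟨R, hR, Λ, hΛ, l0, hl0, R1, hR1, hsize⟩ := P.size hT
  obtain ⟨M, hM, hgrad⟩ := P.grad hT hR hl0 (fun t ht => ⟨(hsize t ht).1, (hsize t ht).2.1⟩)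
  obtain ⟨t1, ht1, xm, x1, r0, hx1, hx1', hr0, hsec⟩ := P.sector hT hR hM hR1
    (fun t ht x => ⟨(hsize t ht).1 x, hgrad t ht x⟩) (fun t ht => (hsize t ht).2.2.2)
  have h1 : t1 ∈ Set.Ioo 0 T := ⟨by linarith [ht1.1], ht1.2⟩
  have hsub : ∀ t ∈ Set.Ico t1 T, t ∈ Set.Ico (T / 2) T := fun t ht => ⟨ht1.1.trans ht.1, ht.2⟩
  obtain ⟨c, hc, hlow⟩ := P.lower h1 hper hx1 hx1' hr0 hsec
  have hu : ∀ t ∈ Set.Ico t1 T, ∀ x, 2 * (c ^ 2 / M / 2) ≤ pu ρ t x := by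
    intro t ht x
    have a1 := hlow t ht x
    have a2 := hgrad t (hsub t ht) x
    have a3 := pw_pos ρ t x
    unfold pu
    rw [mul_div_cancel₀ _ (by norm_num : (2:ℝ) ≠ 0), div_le_div_iff₀ hM a3]
    have a4 := pow_le_pow_left₀ hc.le a1 2
    have a5 := Real.exp_pos (ρ t x)
    calc c ^ 2 * pw ρ t x ≤ Real.exp (ρ t x) ^ 2 * pw ρ t x := mul_le_mul_of_nonneg_right a4 a3.le
      _ = Real.exp (ρ t x) * (Real.exp (ρ t x) * pw ρ t x) := by ring
      _ ≤ _ := mul_le_mul_of_nonneg_left a2 a5.le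
  obtain ⟨C, hC⟩ := P.curv_bound h1 (δ := c ^ 2 / M / 2) (by positivity) hΛ hu
    (fun t ht => (hsize t (hsub t ht)).2.2.1)
    ⟨R, fun t ht x => (div_le_self (Real.exp_pos _).le (one_le_pw ρ t x)).trans ((hsize t (hsub t ht)).1 x)⟩
  exact ⟨t1, h1, 2 * (c ^ 2 / M / 2), by positivity, C, fun t ht x => ⟨hu t ht x, hC t ht x⟩⟩

end CurvSec


/-! ### Preservation of the central symmetry -/

theorem Sm.mono {T T' : ℝ} {f : ℝ → ℝ → ℝ} (h : Sm T f) (hT : T' ≤ T) : Sm T' f :=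
  ContDiffOn.mono h (Set.prod_mono (Set.Ioo_subset_Ioo_right hT) (Set.Subset.refl _))

theorem Sm.shift {T : ℝ} {f : ℝ → ℝ → ℝ} (h : Sm T f) (c : ℝ) : Sm T (fun t x => f t (x + c)) := by
  have h1 : ContDiff ℝ (⊤ : ℕ∞) (fun q : ℝ × ℝ => (q.1, q.2 + c)) := by fun_prop
  exact ContDiffOn.comp h h1.contDiffOn (fun q hq => ⟨hq.1, mem_univ _⟩)

theorem Dx_shift (f : ℝ → ℝ → ℝ) (c t x : ℝ) : Dx (fun t x => f t (x + c)) t x = Dx f t (x + c) := by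
  unfold Dx
  exact deriv_comp_add_const _ _ _

theorem Pol.symm_le {T : ℝ} {ρ : ℝ → ℝ → ℝ} {lam : ℝ → ℝ} (P : Pol T ρ lam)
    (hK : ∀ t1 ∈ Set.Ioo 0 T, ∃ K0, ∀ t ∈ Set.Ioo 0 t1, ∀ x, |pk ρ t x / pu ρ t x| ≤ K0)
    (hi : ∀ ε > 0, ∃ s1 > 0, ∀ s ∈ Set.Ioo 0 T, s < s1 → ∀ x, ρ s (x + π) - ρ s x < ε)
    {t : ℝ} (ht : t ∈ Set.Ioo 0 T) (x : ℝ) : ρ t (x + π) ≤ ρ t x := by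
  have ht1 : (t + T) / 2 ∈ Set.Ioo 0 T := ⟨by linarith [ht.1, ht.2], by linarith [ht.2]⟩
  set t1 := (t + T) / 2 with ht1d
  have htt1 : t < t1 := by linarith [ht.2]
  obtain ⟨K0, hK0⟩ := hK t1 ht1
  have hK0n : 0 ≤ K0 := (abs_nonneg _).trans (hK0 t ⟨ht.1, htt1⟩ 0)
  set K := 2 * K0 + 1 with hKd
  have hKpos : 0 < K := by positivity
  have main : ∀ ε > 0, ρ t (x + π) - ρ t x < ε * Real.exp (K * t) := by
    intro ε hε
    obtain ⟨s1, hs1, hs⟩ := hi ε hε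
    set s0 := min s1 t / 2 with hs0
    have hm : 0 < min s1 t := lt_min hs1 ht.1
    have hs0p : 0 < s0 := by positivity
    have hs0s : s0 < s1 := by linarith [min_le_left s1 t]
    have hs0t : s0 < t := by linarith [min_le_right s1 t]
    set w : ℝ → ℝ → ℝ := fun t x => ρ t (x + π) - ρ t x with hw
    have hws : Sm T w := (P.sm.shift π).sub P.sm
    set f : ℝ → ℝ → ℝ := fun t x => ε * Real.exp (K * t) - w t x with hf
    have hfs : Sm T f := by
      have : Sm T (fun t _ => ε * Real.exp (K * t)) := by
        have : ContDiff ℝ (⊤ : ℕ∞) (fun q : ℝ × ℝ => ε * Real.exp (K * q.1)) := by fun_prop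
        exact this.contDiffOn
      exact this.sub hws
    have hres := periodic_mp (T := t1) (t0 := s0) (hfs.mono ht1.2.le) hs0p ?_ ?_ ?_ t ⟨hs0t.le, htt1⟩ x
    · simp only [hf, hw] at hres; linarith
    · intro r hr y
      have hrT : r ∈ Set.Ioo 0 T := ⟨hr.1, hr.2.trans ht1.2⟩
      simp only [hf, hw, P.per r hrT]
      rw [show y + 2 * π + π = (y + π) + 2 * π by ring, P.per r hrT]
    · intro y
      have a1 := hs s0 ⟨hs0p, by linarith [ht.2]⟩ hs0s y
      have a2 : 1 ≤ Real.exp (K * s0) := Real.one_le_exp (by positivity)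
      simp only [hf, hw]
      nlinarith
    · intro r hr y hz hz1 hz2
      have hrT : r ∈ Set.Ioo 0 T := ⟨hs0p.trans hr.1, hr.2.trans ht1.2⟩
      have hd1 : ∀ z, Dx f r z = - (Dx ρ r (z + π) - Dx ρ r z) := by
        intro z
        have h1 := (P.sm.shift π).hasDx hrT z
        rw [Dx_shift] at h1
        exact ((h1.sub (P.sm.hasDx hrT z)).const_sub _).deriv
      have hd2 : Dx (Dx f) r y = - (Dx (Dx ρ) r (y + π) - Dx (Dx ρ) r y) := by
        change deriv (Dx f r) y = _
        rw [funext hd1]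
        have h1 := (P.sm.dx.shift π).hasDx hrT y
        rw [Dx_shift] at h1
        exact (h1.sub (P.sm.dx.hasDx hrT y)).neg.deriv
      have hd3 : Dt f r y = ε * (Real.exp (K * r) * K) - (Dt ρ r (y + π) - Dt ρ r y) := by
        have h1 : HasDerivAt (fun s => ε * Real.exp (K * s)) (ε * (Real.exp (K * r) * K)) r := by
          have := ((hasDerivAt_id r).const_mul K).exp.const_mul ε
          simpa using this
        exact (h1.sub ((P.sm.hasDt hrT (y + π)).sub (P.sm.hasDt hrT y))).deriv
      rw [hd1] at hz1
      rw [hd2] at hz2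
      rw [hd3, P.pde2 hrT, P.pde2 hrT]
      have hp : Dx ρ r (y + π) = Dx ρ r y := by linarith
      have hW : pw ρ r (y + π) = pw ρ r y := by unfold pw; rw [hp]
      rw [hp, hW]
      have hk := hK0 r ⟨hrT.1, hr.2⟩ y
      have hkeq : pk ρ r y / pu ρ r y = - ((Dx (Dx ρ) r y / (1 + Dx ρ r y ^ 2) - 1) / Real.exp (ρ r y) ^ 2) := by
        rw [pk_s ρ, ← pw_sq]
        unfold pu
        have := (pw_pos ρ r y).ne'
        field_simp
        ring
      rw [hkeq] at hk
      have hwpos : w r y = ε * Real.exp (K * r) := by simp only [hf] at hz; linarith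
      have hwp : 0 < w r y := by rw [hwpos]; positivity
      have he : Real.exp (ρ r (y + π)) = Real.exp (ρ r y) * Real.exp (w r y) := by
        rw [← Real.exp_add]; simp only [hw]; ring_nf
      have hgoal : ε * (Real.exp (K * r) * K) = K * w r y := by rw [hwpos]; ring
      rw [hgoal, he]
      have hew : 1 < Real.exp (w r y) := Real.one_lt_exp_iff.2 hwp
      have hew2 : 1 - 2 * w r y ≤ 1 / Real.exp (w r y) ^ 2 := by
        have := Real.add_one_le_exp (-(2 * w r y))
        have h2 : Real.exp (-(2 * w r y)) = 1 / Real.exp (w r y) ^ 2 := by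
          rw [Real.exp_neg, two_mul, Real.exp_add, one_div, sq]
        rw [← h2]; linarith
      have hl := P.lam_pos hrT
      have hWp := pw_pos ρ r y
      have hss : Dx (Dx ρ) r (y + π) ≤ Dx (Dx ρ) r y := by linarith
      have hep := Real.exp_pos (ρ r y)
      have hEp := Real.exp_pos (w r y)
      have hE2 : 1 / Real.exp (w r y) ^ 2 ≤ 1 := by
        rw [div_le_one (by positivity)]; exact one_le_pow₀ hew.le
      generalize Dx (Dx ρ) r (y + π) = s2 at *
      generalize Dx (Dx ρ) r y = s at *
      generalize Dx ρ r y = p at *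
      generalize pw ρ r y = W at *
      generalize Real.exp (ρ r y) = e at *
      generalize Real.exp (w r y) = E at *
      generalize w r y = v at *
      generalize lam r = l at *
      have b1 : l * W / (e * E) ≤ l * W / e := by
        apply div_le_div_of_nonneg_left (by positivity) hep
        nlinarith
      have b2 : (s2 / (1 + p ^ 2) - 1) / (e * E) ^ 2 ≤ (s / (1 + p ^ 2) - 1) / (e * E) ^ 2 := by
        gcongr
      have b3 : (s / (1 + p ^ 2) - 1) / (e * E) ^ 2 = ((s / (1 + p ^ 2) - 1) / e ^ 2) * (1 / E ^ 2) := by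
        field_simp
      generalize (s / (1 + p ^ 2) - 1) / e ^ 2 = N at *
      have b4 : N * (1 / E ^ 2) - N ≤ 2 * K0 * v := by
        rw [abs_neg] at hk
        have c1 : N * (1 / E ^ 2) - N = (-N) * (1 - 1 / E ^ 2) := by ring
        have c2 : -N ≤ K0 := by linarith [(abs_le.1 hk).1]
        rw [c1]
        calc (-N) * (1 - 1 / E ^ 2) ≤ K0 * (1 - 1 / E ^ 2) := mul_le_mul_of_nonneg_right c2 (by linarith)
          _ ≤ K0 * (2 * v) := mul_le_mul_of_nonneg_left (by linarith) hK0n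
          _ = _ := by ring
      have b5 : K * v = 2 * K0 * v + v := by rw [hKd]; ring
      linarith
  by_contra! hcon
  have h3 : 0 < Real.exp (K * t) := Real.exp_pos _
  have := main ((ρ t (x + π) - ρ t x) / Real.exp (K * t)) (div_pos (by linarith) h3)
  rw [div_mul_cancel₀ _ h3.ne'] at this
  exact lt_irrefl _ this

theorem Pol.symm {T : ℝ} {ρ : ℝ → ℝ → ℝ} {lam : ℝ → ℝ} (P : Pol T ρ lam)
    (hK : ∀ t1 ∈ Set.Ioo 0 T, ∃ K0, ∀ t ∈ Set.Ioo 0 t1, ∀ x, |pk ρ t x / pu ρ t x| ≤ K0)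
    (hi : ∀ ε > 0, ∃ s1 > 0, ∀ s ∈ Set.Ioo 0 T, s < s1 → ∀ x, ρ s (x + π) - ρ s x < ε) :
    ∀ t ∈ Set.Ioo 0 T, ∀ x, ρ t (x + π) = ρ t x := by
  intro t ht x
  apply le_antisymm (P.symm_le hK hi ht x)
  have := P.symm_le hK hi ht (x + π)
  rwa [show x + π + π = x + 2 * π by ring, P.per t ht] at this


/-! ### Angle function of a star-shaped closed curve -/

/-- angular velocity of a curve about the origin -/
def angv (Y : ℝ → ℝ × ℝ) (φ : ℝ) : ℝ := vdet (Y φ) (deriv Y φ) / ((Y φ).1 ^ 2 + (Y φ).2 ^ 2)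

theorem nsq_pos_of_det {a b : ℝ × ℝ} (h : vdet a b ≠ 0) : 0 < a.1 ^ 2 + a.2 ^ 2 := by
  by_contra! hcon
  have h1 : a.1 = 0 := by nlinarith [sq_nonneg a.1, sq_nonneg a.2]
  have h2 : a.2 = 0 := by nlinarith [sq_nonneg a.1, sq_nonneg a.2]
  apply h; unfold vdet; rw [h1, h2]; ring

theorem exists_polar (a b : ℝ) (h : 0 < a ^ 2 + b ^ 2) :
    ∃ θ, a = Real.sqrt (a ^ 2 + b ^ 2) * Real.cos θ ∧ b = Real.sqrt (a ^ 2 + b ^ 2) * Real.sin θ := by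
  refine ⟨Complex.arg ⟨a, b⟩, ?_, ?_⟩
  · have := Complex.norm_mul_cos_arg ⟨a, b⟩
    rw [Complex.norm_eq_sqrt_sq_add_sq] at this
    exact this.symm
  · have := Complex.norm_mul_sin_arg ⟨a, b⟩
    rw [Complex.norm_eq_sqrt_sq_add_sq] at this
    exact this.symm

section AngleSec
variable {Y : ℝ → ℝ × ℝ}

theorem IsSmoothClosedCurve.hasDeriv (hY : IsSmoothClosedCurve Y) (φ : ℝ) : HasDerivAt Y (deriv Y φ) φ :=
  ((hY.smooth.differentiable (by simp)) φ).hasDerivAt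

theorem IsSmoothClosedCurve.hasDeriv1 (hY : IsSmoothClosedCurve Y) (φ : ℝ) :
    HasDerivAt (fun φ => (Y φ).1) (deriv Y φ).1 φ := by
  have := (hY.hasDeriv φ).hasFDerivAt.fst.hasDerivAt
  simpa using this

theorem IsSmoothClosedCurve.hasDeriv2 (hY : IsSmoothClosedCurve Y) (φ : ℝ) :
    HasDerivAt (fun φ => (Y φ).2) (deriv Y φ).2 φ := by
  have := (hY.hasDeriv φ).hasFDerivAt.snd.hasDerivAt
  simpa using this

theorem IsSmoothClosedCurve.contDeriv (hY : IsSmoothClosedCurve Y) : Continuous (deriv Y) :=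
  hY.smooth.continuous_deriv (by simp)

theorem angv_cont (hY : IsSmoothClosedCurve Y) (hdet : ∀ φ, 0 < vdet (Y φ) (deriv Y φ)) :
    Continuous (angv Y) := by
  have h1 := hY.smooth.continuous
  have h2 := hY.contDeriv
  unfold angv vdet
  refine Continuous.div (by fun_prop) (by fun_prop) (fun φ => (nsq_pos_of_det (hdet φ).ne').ne')

theorem angv_pos (hdet : ∀ φ, 0 < vdet (Y φ) (deriv Y φ)) (φ : ℝ) : 0 < angv Y φ :=
  div_pos (hdet φ) (nsq_pos_of_det (hdet φ).ne')

theorem exists_angle (hY : IsSmoothClosedCurve Y) (hdet : ∀ φ, 0 < vdet (Y φ) (deriv Y φ)) :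
    ∃ Θ : ℝ → ℝ, (∀ φ, HasDerivAt Θ (angv Y φ) φ) ∧
      ∀ φ, ∃ R > 0, Y φ = (R * Real.cos (Θ φ), R * Real.sin (Θ φ)) := by
  have hn : ∀ φ, 0 < (Y φ).1 ^ 2 + (Y φ).2 ^ 2 := fun φ => nsq_pos_of_det (hdet φ).ne'
  obtain ⟨θ0, h01, h02⟩ := exists_polar _ _ (hn 0)
  set Θ : ℝ → ℝ := fun φ => θ0 + ∫ s in (0:ℝ)..φ, angv Y s with hΘ
  have hc := angv_cont hY hdet
  have hΘd : ∀ φ, HasDerivAt Θ (angv Y φ) φ := fun φ =>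
    (intervalIntegral.integral_hasDerivAt_right (hc.intervalIntegrable _ _)
      (hc.stronglyMeasurableAtFilter _ _) hc.continuousAt).const_add θ0
  refine ⟨Θ, hΘd, ?_⟩
  set N : ℝ → ℝ := fun φ => Real.sqrt ((Y φ).1 ^ 2 + (Y φ).2 ^ 2) with hN
  have hNpos : ∀ φ, 0 < N φ := fun φ => Real.sqrt_pos.2 (hn φ)
  have hNsq : ∀ φ, N φ ^ 2 = (Y φ).1 ^ 2 + (Y φ).2 ^ 2 := fun φ => Real.sq_sqrt (hn φ).le
  have hNd : ∀ φ, HasDerivAt N (((Y φ).1 * (deriv Y φ).1 + (Y φ).2 * (deriv Y φ).2) / N φ) φ := by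
    intro φ
    refine ((((hY.hasDeriv1 φ).pow 2).add ((hY.hasDeriv2 φ).pow 2)).sqrt (hn φ).ne').congr_deriv ?_
    change _ / (2 * N φ) = _
    have := (hNpos φ).ne'
    push_cast
    field_simp
  have hcd : ∀ φ, HasDerivAt (fun φ => Real.cos (Θ φ)) (-Real.sin (Θ φ) * angv Y φ) φ := fun φ => (hΘd φ).cos
  have hsd : ∀ φ, HasDerivAt (fun φ => Real.sin (Θ φ)) (Real.cos (Θ φ) * angv Y φ) φ := fun φ => (hΘd φ).sin
  have hA : ∀ φ, HasDerivAt (fun φ => ((Y φ).1 * Real.cos (Θ φ) + (Y φ).2 * Real.sin (Θ φ)) / N φ) 0 φ := by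
    intro φ
    refine ((((hY.hasDeriv1 φ).mul (hcd φ)).add ((hY.hasDeriv2 φ).mul (hsd φ))).div (hNd φ) (hNpos φ).ne').congr_deriv ?_
    have h0 := (hNpos φ).ne'
    have hs := hNsq φ
    simp only [Pi.add_apply, Pi.mul_apply]
    unfold angv vdet
    rw [← hs]
    field_simp
    rw [hs]
    ring
  have hB : ∀ φ, HasDerivAt (fun φ => ((Y φ).2 * Real.cos (Θ φ) - (Y φ).1 * Real.sin (Θ φ)) / N φ) 0 φ := by
    intro φ
    refine ((((hY.hasDeriv2 φ).mul (hcd φ)).sub ((hY.hasDeriv1 φ).mul (hsd φ))).div (hNd φ) (hNpos φ).ne').congr_deriv ?_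
    have h0 := (hNpos φ).ne'
    have hs := hNsq φ
    simp only [Pi.sub_apply, Pi.mul_apply]
    unfold angv vdet
    rw [← hs]
    field_simp
    rw [hs]
    ring
  have hΘ0 : Θ 0 = θ0 := by simp [hΘ]
  have hA1 : ∀ φ, ((Y φ).1 * Real.cos (Θ φ) + (Y φ).2 * Real.sin (Θ φ)) / N φ = 1 := by
    intro φ
    have h := is_const_of_deriv_eq_zero (fun x => (hA x).differentiableAt) (fun x => (hA x).deriv) φ 0
    rw [h, hΘ0, div_eq_one_iff_eq (hNpos 0).ne']
    change (Y 0).1 = N 0 * _ at h01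
    change (Y 0).2 = N 0 * _ at h02
    rw [h01, h02]
    linear_combination N 0 * Real.cos_sq_add_sin_sq θ0
  have hB1 : ∀ φ, ((Y φ).2 * Real.cos (Θ φ) - (Y φ).1 * Real.sin (Θ φ)) / N φ = 0 := by
    intro φ
    have h := is_const_of_deriv_eq_zero (fun x => (hB x).differentiableAt) (fun x => (hB x).deriv) φ 0
    rw [h, hΘ0]
    change (Y 0).1 = N 0 * _ at h01
    change (Y 0).2 = N 0 * _ at h02
    rw [h01, h02]
    ring
  intro φ
  refine ⟨N φ, hNpos φ, ?_⟩
  have a1 := hA1 φ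
  have b1 := hB1 φ
  rw [div_eq_one_iff_eq (hNpos φ).ne'] at a1
  rw [div_eq_zero_iff] at b1
  replace b1 := b1.resolve_right (hNpos φ).ne'
  have cs := Real.cos_sq_add_sin_sq (Θ φ)
  ext
  · simp only
    rw [← a1]
    linear_combination (-(Y φ).1) * cs - Real.sin (Θ φ) * b1
  · simp only
    rw [← a1]
    linear_combination (-(Y φ).2) * cs + Real.cos (Θ φ) * b1

/-- The total angle. -/
def totang (Y : ℝ → ℝ × ℝ) : ℝ := ∫ φ in (0:ℝ)..(2 * π), angv Y φ

theorem angv_periodic (hY : IsSmoothClosedCurve Y) : Function.Periodic (angv Y) (2 * π) := by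
  intro φ
  have h1 : deriv Y (φ + 2 * π) = deriv Y φ := by
    have : (fun y => Y (y + 2 * π)) = Y := funext hY.periodic
    rw [← deriv_comp_add_const, this]
  unfold angv
  rw [h1, hY.periodic φ]

theorem angle_shift (hY : IsSmoothClosedCurve Y) (hdet : ∀ φ, 0 < vdet (Y φ) (deriv Y φ)) {Θ : ℝ → ℝ}
    (hΘ : ∀ φ, HasDerivAt Θ (angv Y φ) φ) (φ : ℝ) : Θ (φ + 2 * π) = Θ φ + totang Y := by
  have hc := angv_cont hY hdet
  have h1 := intervalIntegral.integral_eq_sub_of_hasDerivAt (a := φ) (b := φ + 2 * π) (fun x _ => hΘ x)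
    (hc.intervalIntegrable _ _)
  have h2 := (angv_periodic hY).intervalIntegral_add_eq φ 0
  rw [zero_add] at h2
  unfold totang
  linarith

theorem ray_angle {R R' θ θ' : ℝ} (hR : 0 < R) (hR' : 0 < R')
    (h : ((R * Real.cos θ, R * Real.sin θ) : ℝ × ℝ) = (R' * Real.cos θ', R' * Real.sin θ')) :
    R = R' ∧ ∃ k : ℤ, θ - θ' = 2 * π * k := by
  have h1 : R * Real.cos θ = R' * Real.cos θ' := congrArg Prod.fst h
  have h2 : R * Real.sin θ = R' * Real.sin θ' := congrArg Prod.snd h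
  have hRR : R = R' := by
    have : R ^ 2 = R' ^ 2 := by
      have e1 := Real.cos_sq_add_sin_sq θ
      have e2 := Real.cos_sq_add_sin_sq θ'
      calc R ^ 2 = (R * Real.cos θ) ^ 2 + (R * Real.sin θ) ^ 2 := by linear_combination (-R ^ 2) * e1
        _ = (R' * Real.cos θ') ^ 2 + (R' * Real.sin θ') ^ 2 := by rw [h1, h2]
        _ = R' ^ 2 := by linear_combination (R' ^ 2) * e2
    exact (sq_eq_sq₀ hR.le hR'.le).1 this
  refine ⟨hRR, ?_⟩
  subst hRR
  exact Real.Angle.angle_eq_iff_two_pi_dvd_sub.1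
    (Real.Angle.cos_sin_inj (mul_left_cancel₀ hR.ne' h1) (mul_left_cancel₀ hR.ne' h2))

theorem totang_int (hY : IsSmoothClosedCurve Y) (hdet : ∀ φ, 0 < vdet (Y φ) (deriv Y φ)) :
    ∃ k : ℤ, totang Y = 2 * π * k := by
  obtain ⟨Θ, hΘ, hR⟩ := exists_angle hY hdet
  obtain ⟨R, hRp, h1⟩ := hR 0
  obtain ⟨R', hRp', h2⟩ := hR (0 + 2 * π)
  rw [hY.periodic, h1] at h2
  obtain ⟨-, k, hk⟩ := ray_angle hRp' hRp h2.symm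
  rw [angle_shift hY hdet hΘ] at hk
  exact ⟨k, by linarith⟩

theorem totang_pos (hY : IsSmoothClosedCurve Y) (hdet : ∀ φ, 0 < vdet (Y φ) (deriv Y φ)) : 0 < totang Y :=
  intervalIntegral.intervalIntegral_pos_of_pos ((angv_cont hY hdet).intervalIntegrable _ _)
    (fun φ => angv_pos hdet φ) (by positivity)

theorem angle_strictMono (hdet : ∀ φ, 0 < vdet (Y φ) (deriv Y φ)) {Θ : ℝ → ℝ}
    (hΘ : ∀ φ, HasDerivAt Θ (angv Y φ) φ) : StrictMono Θ :=
  strictMono_of_deriv_pos fun φ => by rw [(hΘ φ).deriv]; exact angv_pos hdet φ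

theorem angle_shift_int (hY : IsSmoothClosedCurve Y) (hdet : ∀ φ, 0 < vdet (Y φ) (deriv Y φ)) {Θ : ℝ → ℝ}
    (hΘ : ∀ φ, HasDerivAt Θ (angv Y φ) φ) (φ : ℝ) (k : ℤ) : Θ (φ + k * (2 * π)) = Θ φ + k * totang Y := by
  have h1 : ∀ (n : ℕ) (φ : ℝ), Θ (φ + n * (2 * π)) = Θ φ + n * totang Y := by
    intro n
    induction n with
    | zero => intro φ; simp
    | succ n ih =>
      intro φ
      push_cast
      rw [show φ + (n + 1) * (2 * π) = (φ + n * (2 * π)) + 2 * π by ring, angle_shift hY hdet hΘ, ih]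
      ring
  obtain ⟨n, rfl | rfl⟩ := k.eq_nat_or_neg
  · exact_mod_cast h1 n φ
  · have := h1 n (φ + ((-(n:ℤ) : ℤ) : ℝ) * (2 * π))
    push_cast at this ⊢
    rw [show φ + -(n:ℝ) * (2 * π) + n * (2 * π) = φ by ring] at this
    linarith

theorem angle_surj (hY : IsSmoothClosedCurve Y) (hdet : ∀ φ, 0 < vdet (Y φ) (deriv Y φ)) {Θ : ℝ → ℝ}
    (hΘ : ∀ φ, HasDerivAt Θ (angv Y φ) φ) : Function.Surjective Θ := by
  have hc : Continuous Θ := continuous_iff_continuousAt.2 fun φ => (hΘ φ).continuousAt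
  have hm := (angle_strictMono hdet hΘ).monotone
  have hJ := totang_pos hY hdet
  apply hc.surjective
  · apply tendsto_atTop_atTop_of_monotone hm
    intro b
    obtain ⟨n, hn⟩ := exists_nat_gt ((b - Θ 0) / totang Y)
    refine ⟨0 + (n : ℤ) * (2 * π), ?_⟩
    rw [angle_shift_int hY hdet hΘ]
    rw [div_lt_iff₀ hJ] at hn
    push_cast; linarith
  · apply tendsto_atBot_atBot_of_monotone hm
    intro b
    obtain ⟨n, hn⟩ := exists_nat_gt ((Θ 0 - b) / totang Y)
    refine ⟨0 + ((-n : ℤ) : ℝ) * (2 * π), ?_⟩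
    rw [angle_shift_int hY hdet hΘ]
    rw [div_lt_iff₀ hJ] at hn
    push_cast; linarith

/-- On an embedded curve the total angle is `2π`. -/
theorem totang_embedded (hY : IsSmoothClosedCurve Y) (hdet : ∀ φ, 0 < vdet (Y φ) (deriv Y φ))
    (hemb : IsEmbeddedCurve Y) : totang Y = 2 * π := by
  obtain ⟨Θ, hΘ, hR⟩ := exists_angle hY hdet
  obtain ⟨k, hk⟩ := totang_int hY hdet
  have hJ := totang_pos hY hdet
  have hkpos : 0 < k := by
    by_contra! hle
    have : (k : ℝ) ≤ 0 := by exact_mod_cast hle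
    nlinarith [Real.pi_pos]
  by_contra hne
  have hk2 : 2 ≤ k := by
    by_contra! hlt
    have : k = 1 := by omega
    apply hne; rw [hk, this]; push_cast; ring
  have hJ2 : 2 * π < totang Y := by
    have : (2 : ℝ) ≤ k := by exact_mod_cast hk2
    rw [hk]; nlinarith [Real.pi_pos]
  have hmono := angle_strictMono hdet hΘ
  set Φ : ℝ ≃o ℝ := hmono.orderIsoOfSurjective Θ (angle_surj hY hdet hΘ) with hΦ
  have hΦΘ : ∀ θ, Θ (Φ.symm θ) = θ := fun θ => Φ.apply_symm_apply θ
  have hΦΘ' : ∀ φ, Φ.symm (Θ φ) = φ := fun θ => Φ.symm_apply_apply θ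
  have hΦc : Continuous Φ.symm := Φ.symm.continuous
  set r : ℝ → ℝ := fun φ => (Y φ).1 ^ 2 + (Y φ).2 ^ 2 with hr
  have hYc := hY.smooth.continuous
  have hrc : Continuous r := by fun_prop
  obtain ⟨φm, -, hφm⟩ := (isCompact_Icc (a := (0:ℝ)) (b := 2 * π)).exists_isMaxOn
    (Set.nonempty_Icc.2 (by positivity)) hrc.continuousOn
  have hrmax : ∀ φ, r φ ≤ r φm := by
    intro φ
    obtain ⟨y, hy, hxy⟩ := hY.periodic.exists_mem_Ico₀ (by positivity) φ
    have : r φ = r y := by simp only [hr, hxy]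
    rw [this]; exact hφm ⟨hy.1, hy.2.le⟩
  set h : ℝ → ℝ := fun θ => r (Φ.symm (θ + 2 * π)) - r (Φ.symm θ) with hh
  have hhc : Continuous h := by fun_prop
  obtain ⟨θ, hθ⟩ : ∃ θ, h θ = 0 := by
    have a1 : h (Θ φm) ≤ 0 := by
      simp only [hh, hΦΘ']; linarith [hrmax (Φ.symm (Θ φm + 2 * π))]
    have a2 : 0 ≤ h (Θ φm - 2 * π) := by
      simp only [hh, sub_add_cancel, hΦΘ']; linarith [hrmax (Φ.symm (Θ φm - 2 * π))]
    exact mem_range_of_exists_le_of_exists_ge hhc ⟨_, a1⟩ ⟨_, a2⟩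
  set φ := Φ.symm θ with hφ
  set φ' := Φ.symm (θ + 2 * π) with hφ'
  have hYY : Y φ' = Y φ := by
    obtain ⟨R, hRp, h1⟩ := hR φ
    obtain ⟨R', hRp', h2⟩ := hR φ'
    rw [hφ, hΦΘ, ← hφ] at h1
    rw [hφ', hΦΘ, ← hφ', Real.cos_add_two_pi, Real.sin_add_two_pi] at h2
    have h3 : r φ' = r φ := by simp only [hh] at hθ; linarith
    have e1 := Real.cos_sq_add_sin_sq θ
    have h4 : r φ = R ^ 2 := by simp only [hr, h1]; linear_combination R ^ 2 * e1
    have h5 : r φ' = R' ^ 2 := by simp only [hr, h2]; linear_combination R' ^ 2 * e1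
    have : R' = R := (sq_eq_sq₀ hRp'.le hRp.le).1 (by rw [← h5, ← h4, h3])
    rw [h1, h2, this]
  have hlt : φ < φ' := Φ.symm.strictMono (by linarith [Real.pi_pos])
  have hlt' : φ' < φ + 2 * π := by
    rw [← hmono.lt_iff_lt, angle_shift hY hdet hΘ, hφ', hΦΘ, hφ, hΦΘ]; linarith
  have hp2 : (0:ℝ) < 2 * π := by positivity
  have m1 := toIcoMod_mem_Ico hp2 0 φ
  have m2 := toIcoMod_mem_Ico hp2 0 φ'
  rw [zero_add] at m1 m2
  have y1 : Y (toIcoMod hp2 0 φ) = Y φ := by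
    rw [toIcoMod]; exact hY.periodic.sub_zsmul_eq _
  have y2 : Y (toIcoMod hp2 0 φ') = Y φ' := by
    rw [toIcoMod]; exact hY.periodic.sub_zsmul_eq _
  have heq := hemb m1 m2 (by rw [y1, y2, hYY])
  rw [toIcoMod, toIcoMod] at heq
  have hz : φ' - φ = ((toIcoDiv hp2 0 φ' - toIcoDiv hp2 0 φ : ℤ) : ℝ) * (2 * π) := by
    simp only [zsmul_eq_mul] at heq
    push_cast; linarith
  generalize (toIcoDiv hp2 0 φ' - toIcoDiv hp2 0 φ : ℤ) = m at hz
  have hm1 : (0 : ℝ) < m := by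
    by_contra! hle
    nlinarith
  have hm2 : (m : ℝ) < 1 := by
    by_contra! hle
    nlinarith
  have hm1' : 0 < m := by exact_mod_cast hm1
  have hm2' : m < 1 := by exact_mod_cast hm2
  omega

/-- Existence and uniqueness on rays. -/
theorem ray_exists (hY : IsSmoothClosedCurve Y) (hdet : ∀ φ, 0 < vdet (Y φ) (deriv Y φ)) (θ : ℝ) :
    ∃ φ, ∃ R > 0, Y φ = (R * Real.cos θ, R * Real.sin θ) := by
  obtain ⟨Θ, hΘ, hR⟩ := exists_angle hY hdet
  obtain ⟨φ, rfl⟩ := angle_surj hY hdet hΘ θ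
  exact ⟨φ, hR φ⟩

theorem ray_unique (hY : IsSmoothClosedCurve Y) (hdet : ∀ φ, 0 < vdet (Y φ) (deriv Y φ))
    (hJ : totang Y = 2 * π) {θ φ φ' R R' : ℝ} (hR : 0 < R) (hR' : 0 < R')
    (h : Y φ = (R * Real.cos θ, R * Real.sin θ)) (h' : Y φ' = (R' * Real.cos θ, R' * Real.sin θ)) : R = R' := by
  obtain ⟨Θ, hΘ, hRR⟩ := exists_angle hY hdet
  obtain ⟨S, hS, h1⟩ := hRR φ
  obtain ⟨S', hS', h2⟩ := hRR φ'
  obtain ⟨e1, k, hk⟩ := ray_angle hR hS (h.symm.trans h1)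
  obtain ⟨e2, k', hk'⟩ := ray_angle hR' hS' (h'.symm.trans h2)
  have : Θ φ' = Θ (φ + ((k - k' : ℤ) : ℝ) * (2 * π)) := by
    rw [angle_shift_int hY hdet hΘ, hJ]; push_cast; linarith
  have hφ := (angle_strictMono hdet hΘ).injective this
  have hYY : Y φ' = Y φ := by
    rw [hφ]
    have := hY.periodic.int_mul (k - k') φ
    exact_mod_cast this
  rw [h, h'] at hYY
  exact (ray_angle hR' hR hYY).1.symm

end AngleSec


/-! ### Joint regularity of the flow and constancy of the total angle -/

theorem joint_hasDeriv {G : ℝ → ℝ → ℝ × ℝ} {T : ℝ}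
    (hG : ContDiffOn ℝ (⊤ : ℕ∞) (fun p : ℝ × ℝ => G p.1 p.2) (Ico 0 T ×ˢ univ)) {p : ℝ × ℝ}
    (hp : p ∈ Ico 0 T ×ˢ (univ : Set ℝ)) :
    HasDerivAt (G p.1) (fderivWithin ℝ (fun p : ℝ × ℝ => G p.1 p.2) (Ico 0 T ×ˢ univ) p (0, 1)) p.2 := by
  have h1 := ((hG.differentiableOn (by simp)) p hp).hasFDerivWithinAt
  have h2 : HasDerivWithinAt (fun x : ℝ => (p.1, x)) ((0 : ℝ), (1 : ℝ)) univ p.2 :=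
    ((hasDerivAt_const p.2 p.1).prodMk (hasDerivAt_id p.2)).hasDerivWithinAt
  have h3 := HasFDerivWithinAt.comp_hasDerivWithinAt (x := p.2) (f := fun x : ℝ => (p.1, x))
    (t := Ico 0 T ×ˢ (univ : Set ℝ)) (l := fun p : ℝ × ℝ => G p.1 p.2)  h1 h2
    (fun x _ => ⟨hp.1, mem_univ _⟩)
  exact (hasDerivWithinAt_univ.1 h3)

theorem joint_dx {G : ℝ → ℝ → ℝ × ℝ} {T : ℝ}
    (hG : ContDiffOn ℝ (⊤ : ℕ∞) (fun p : ℝ × ℝ => G p.1 p.2) (Ico 0 T ×ˢ univ)) :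
    ContDiffOn ℝ (⊤ : ℕ∞) (fun p : ℝ × ℝ => deriv (G p.1) p.2) (Ico 0 T ×ˢ univ) := by
  have hu : UniqueDiffOn ℝ (Ico 0 T ×ˢ (univ : Set ℝ)) := (uniqueDiffOn_Ico 0 T).prod uniqueDiffOn_univ
  have h1 := hG.fderivWithin (m := (⊤ : ℕ∞)) hu (by simp)
  have h2 : ContDiffOn ℝ (⊤ : ℕ∞) (fun p : ℝ × ℝ =>
      fderivWithin ℝ (fun p : ℝ × ℝ => G p.1 p.2) (Ico 0 T ×ˢ univ) p (0, 1)) (Ico 0 T ×ˢ univ) :=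
    h1.clm_apply contDiffOn_const
  exact h2.congr fun p hp => (joint_hasDeriv hG hp).deriv

section FlowReg
variable {X : ℝ → ℝ → ℝ × ℝ} {X₀ : ℝ → ℝ × ℝ} {Ts : ℝ}

/-- star-shapedness up to time `T1` -/
def Good (X : ℝ → ℝ → ℝ × ℝ) (T1 : ℝ) : Prop :=
  ∀ t ∈ Ico 0 T1, ∀ φ, 0 < vdet (X t φ) (deriv (X t) φ)

theorem IsGAPFSolutionOn.sm0 (h : IsGAPFSolutionOn X X₀ (Ico 0 Ts)) :
    ContinuousOn (fun p : ℝ × ℝ => X p.1 p.2) (Ico 0 Ts ×ˢ univ) := h.smooth.continuousOn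
theorem IsGAPFSolutionOn.sm1 (h : IsGAPFSolutionOn X X₀ (Ico 0 Ts)) :
    ContinuousOn (fun p : ℝ × ℝ => deriv (X p.1) p.2) (Ico 0 Ts ×ˢ univ) := (joint_dx h.smooth).continuousOn
theorem IsGAPFSolutionOn.sm2 (h : IsGAPFSolutionOn X X₀ (Ico 0 Ts)) :
    ContinuousOn (fun p : ℝ × ℝ => deriv (deriv (X p.1)) p.2) (Ico 0 Ts ×ˢ univ) :=
  (joint_dx (G := fun t => deriv (X t)) (joint_dx h.smooth)).continuousOn

theorem vdet_continuousOn {S : Set (ℝ × ℝ)} {f g : ℝ × ℝ → ℝ × ℝ} (hf : ContinuousOn f S)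
    (hg : ContinuousOn g S) : ContinuousOn (fun p => vdet (f p) (g p)) S := by
  unfold vdet; fun_prop

theorem vnorm_pos {a : ℝ × ℝ} (h : a ≠ 0) : 0 < vnorm a := by
  apply Real.sqrt_pos.2
  by_contra! hcon
  apply h
  have h1 : a.1 = 0 := by nlinarith [sq_nonneg a.1, sq_nonneg a.2]
  have h2 : a.2 = 0 := by nlinarith [sq_nonneg a.1, sq_nonneg a.2]
  exact Prod.ext h1 h2

theorem IsGAPFSolutionOn.cont_det (h : IsGAPFSolutionOn X X₀ (Ico 0 Ts)) :
    ContinuousOn (fun p : ℝ × ℝ => vdet (X p.1 p.2) (deriv (X p.1) p.2)) (Ico 0 Ts ×ˢ univ) :=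
  vdet_continuousOn h.sm0 h.sm1

theorem IsGAPFSolutionOn.cont_v (h : IsGAPFSolutionOn X X₀ (Ico 0 Ts)) :
    ContinuousOn (fun p : ℝ × ℝ => vnorm (deriv (X p.1) p.2)) (Ico 0 Ts ×ˢ univ) := by
  have := h.sm1
  unfold vnorm; fun_prop

theorem IsGAPFSolutionOn.cont_curv (h : IsGAPFSolutionOn X X₀ (Ico 0 Ts)) :
    ContinuousOn (fun p : ℝ × ℝ => curv (X p.1) p.2) (Ico 0 Ts ×ˢ univ) :=
  (vdet_continuousOn h.sm1 h.sm2).div (h.cont_v.pow 3)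
    fun p hp => (pow_pos (vnorm_pos ((h.curve p.1 hp.1).regular p.2)) 3).ne'

theorem IsGAPFSolutionOn.cont_angv (h : IsGAPFSolutionOn X X₀ (Ico 0 Ts)) {T1 : ℝ} (h1 : T1 ≤ Ts)
    (hg : Good X T1) :
    ContinuousOn (fun p : ℝ × ℝ => angv (X p.1) p.2) (Ico 0 T1 ×ˢ univ) := by
  have hs : Ico 0 T1 ×ˢ (univ : Set ℝ) ⊆ Ico 0 Ts ×ˢ univ := prod_mono (Ico_subset_Ico_right h1) subset_rfl
  have a := h.sm0.mono hs
  refine (h.cont_det.mono hs).div (by fun_prop) fun p hp => (nsq_pos_of_det (hg p.1 hp.1 p.2).ne').ne'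

theorem curve_deriv_periodic {Y : ℝ → ℝ × ℝ} (hY : Function.Periodic Y (2 * π)) :
    Function.Periodic (deriv Y) (2 * π) := by
  intro φ
  have : (fun y => Y (y + 2 * π)) = Y := funext hY
  rw [← deriv_comp_add_const, this]

theorem curv_periodic {Y : ℝ → ℝ × ℝ} (hY : Function.Periodic Y (2 * π)) :
    Function.Periodic (curv Y) (2 * π) := by
  intro φ
  unfold curv
  rw [curve_deriv_periodic hY, curve_deriv_periodic (curve_deriv_periodic hY)]

theorem totang_const (h : IsGAPFSolutionOn X X₀ (Ico 0 Ts)) {T1 : ℝ} (h1 : T1 ≤ Ts)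
    (hg : Good X T1) (hemb : IsEmbeddedCurve X₀) {t : ℝ} (ht : t ∈ Ico 0 T1) : totang (X t) = 2 * π := by
  set c : ℝ → ℝ := fun s => max 0 (min s t) with hc
  have hcc : Continuous c := by fun_prop
  have hcm : ∀ s, c s ∈ Ico 0 T1 := fun s =>
    ⟨le_max_left _ _, max_lt (ht.1.trans_lt ht.2) ((min_le_right _ _).trans_lt ht.2)⟩
  have hcur : ∀ s, IsSmoothClosedCurve (X (c s)) := fun s =>
    h.curve _ ⟨(hcm s).1, (hcm s).2.trans_le h1⟩
  choose k hk using fun s => totang_int (hcur s) (hg _ (hcm s))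
  have hcont : Continuous fun s => totang (X (c s)) := by
    unfold totang
    apply intervalIntegral.continuous_parametric_intervalIntegral_of_continuous'
    change Continuous fun p : ℝ × ℝ => angv (X (c p.1)) p.2
    exact (h.cont_angv h1 hg).comp_continuous (f := fun p : ℝ × ℝ => (c p.1, p.2)) (by fun_prop)
      (fun p => ⟨hcm p.1, mem_univ _⟩)
  have hkc : Continuous k := by
    rw [Int.isClosedEmbedding_coe_real.isEmbedding.continuous_iff]
    have : ((↑) : ℤ → ℝ) ∘ k = fun s => totang (X (c s)) / (2 * π) := by
      funext s; simp only [Function.comp]; rw [hk]; field_simp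
    rw [this]; fun_prop
  have heq : k t = k 0 := PreconnectedSpace.constant inferInstance hkc
  have c0 : c 0 = 0 := by simp [hc, ht.1]
  have ct : c t = t := by simp [hc, ht.1]
  have e1 := hk t
  have e0 := hk 0
  have hX0 : X 0 = X₀ := funext h.1
  rw [ct] at e1; rw [c0] at e0
  rw [e1, heq, ← e0]
  have m0 : (0:ℝ) ∈ Ico 0 T1 := ⟨le_rfl, ht.1.trans_lt ht.2⟩
  exact totang_embedded (by have := hcur 0; rwa [c0] at this) (hg 0 m0) (by rwa [hX0])

end FlowReg


/-! ### Passage to polar coordinates -/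

section PolarSec
variable {X : ℝ → ℝ → ℝ × ℝ} {X₀ : ℝ → ℝ × ℝ} {Ts T1 : ℝ} {ρ : ℝ → ℝ → ℝ}

/-- `ρ` is the logarithm of the radial function of the evolving curve. -/
structure PRep (X : ℝ → ℝ → ℝ × ℝ) (T1 : ℝ) (ρ : ℝ → ℝ → ℝ) : Prop where
  ex : ∀ t ∈ Ico 0 T1, ∀ θ, ∃ φ, X t φ = (Real.exp (ρ t θ) * Real.cos θ, Real.exp (ρ t θ) * Real.sin θ)
  un : ∀ t ∈ Ico 0 T1, ∀ θ φ R, 0 < R → X t φ = (R * Real.cos θ, R * Real.sin θ) → R = Real.exp (ρ t θ)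

theorem exists_rep (h : IsGAPFSolutionOn X X₀ (Ico 0 Ts)) (h1 : T1 ≤ Ts)
    (hg : Good X T1) (hemb : IsEmbeddedCurve X₀) : ∃ ρ, PRep X T1 ρ := by
  have key : ∀ t θ, ∃ r : ℝ, t ∈ Ico 0 T1 →
      ∃ φ, X t φ = (Real.exp r * Real.cos θ, Real.exp r * Real.sin θ) := by
    intro t θ
    by_cases ht : t ∈ Ico 0 T1
    · obtain ⟨φ, R, hR, h2⟩ := ray_exists (h.curve t ⟨ht.1, ht.2.trans_le h1⟩) (hg t ht) θ
      exact ⟨Real.log R, fun _ => ⟨φ, by rw [Real.exp_log hR]; exact h2⟩⟩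
    · exact ⟨0, fun h => absurd h ht⟩
  choose ρ hρ using key
  refine ⟨ρ, fun t ht θ => hρ t θ ht, fun t ht θ φ R hR h2 => ?_⟩
  obtain ⟨φ', h3⟩ := hρ t θ ht
  exact ray_unique (h.curve t ⟨ht.1, ht.2.trans_le h1⟩) (hg t ht) (totang_const h h1 hg hemb ht) hR
    (Real.exp_pos _) h2 h3

theorem PRep.per (r : PRep X T1 ρ) {t : ℝ} (ht : t ∈ Ico 0 T1) (x : ℝ) : ρ t (x + 2 * π) = ρ t x := by
  obtain ⟨φ, hφ⟩ := r.ex t ht (x + 2 * π)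
  rw [Real.cos_add_two_pi, Real.sin_add_two_pi] at hφ
  exact Real.exp_injective (r.un t ht x φ _ (Real.exp_pos _) hφ)

theorem cd_at (h : IsGAPFSolutionOn X X₀ (Ico 0 Ts)) {t : ℝ} (ht : t ∈ Ioo 0 Ts) (φ : ℝ) :
    ContDiffAt ℝ (⊤ : ℕ∞) (fun p : ℝ × ℝ => X p.1 p.2) (t, φ) :=
  (h.smooth.mono (prod_mono Ioo_subset_Ico_self subset_rfl)).contDiffAt
    ((strip_open Ts).mem_nhds ⟨ht, mem_univ _⟩)

theorem local_inv (h : IsGAPFSolutionOn X X₀ (Ico 0 Ts)) {t0 θ0 φ0 R0 : ℝ}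
    (ht : t0 ∈ Ioo 0 Ts) (hg : 0 < vdet (X t0 φ0) (deriv (X t0) φ0)) (hR0 : 0 < R0)
    (h0 : X t0 φ0 = (R0 * Real.cos θ0, R0 * Real.sin θ0)) :
    ∃ χ : ℝ × ℝ → ℝ, ContDiffAt ℝ (⊤ : ℕ∞) χ (t0, θ0) ∧ χ (t0, θ0) = φ0 ∧
      ∀ᶠ q in 𝓝 (t0, θ0), ∃ R > 0, R = (X q.1 (χ q)).1 * Real.cos q.2 + (X q.1 (χ q)).2 * Real.sin q.2 ∧
        X q.1 (χ q) = (R * Real.cos q.2, R * Real.sin q.2) := by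
  set u : (ℝ × ℝ) × ℝ := ((t0, θ0), φ0) with hu
  set f : (ℝ × ℝ) × ℝ → ℝ := fun w =>
    Real.cos w.1.2 * (X w.1.1 w.2).2 - Real.sin w.1.2 * (X w.1.1 w.2).1 with hf
  have hXc : ContDiffAt ℝ (⊤ : ℕ∞) (fun w : (ℝ × ℝ) × ℝ => X w.1.1 w.2) u :=
    ContDiffAt.comp (g := fun p : ℝ × ℝ => X p.1 p.2) (f := fun w : (ℝ × ℝ) × ℝ => (w.1.1, w.2)) u
      (cd_at h ht φ0) (by fun_prop)
  have cdf : ContDiffAt ℝ (⊤ : ℕ∞) f u := by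
    have a := hXc.fst
    have b := hXc.snd
    refine ContDiffAt.sub (ContDiffAt.mul ?_ b) (ContDiffAt.mul ?_ a)
    · exact ContDiffAt.cos (by fun_prop)
    · exact ContDiffAt.sin (by fun_prop)
  have hY := h.curve t0 ⟨ht.1.le, ht.2⟩
  have hd1 : HasDerivAt (fun x => f ((t0, θ0), x))
      (Real.cos θ0 * (deriv (X t0) φ0).2 - Real.sin θ0 * (deriv (X t0) φ0).1) φ0 :=
    ((hY.hasDeriv2 φ0).const_mul (Real.cos θ0)).sub ((hY.hasDeriv1 φ0).const_mul (Real.sin θ0))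
  have hd2 : HasDerivAt (fun x => f ((t0, θ0), x)) (fderiv ℝ f u ((0 : ℝ × ℝ), (1 : ℝ))) φ0 := by
    have h1 : HasDerivAt (fun y : ℝ => ((t0, θ0), y)) ((0 : ℝ × ℝ), (1 : ℝ)) φ0 :=
      (hasDerivAt_const φ0 (t0, θ0)).prodMk (hasDerivAt_id φ0)
    exact (cdf.differentiableAt (by simp)).hasFDerivAt.comp_hasDerivAt φ0 h1
  have hval := hd2.unique hd1
  have hne : fderiv ℝ f u ((0 : ℝ × ℝ), (1 : ℝ)) ≠ 0 := by
    rw [hval]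
    intro h3
    rw [h0] at hg
    unfold vdet at hg
    simp only at hg
    have : R0 * (Real.cos θ0 * (deriv (X t0) φ0).2 - Real.sin θ0 * (deriv (X t0) φ0).1) = 0 := by
      rw [h3, mul_zero]
    linarith
  have if₂ : (fderiv ℝ f u ∘L .inr ℝ (ℝ × ℝ) ℝ).IsInvertible := by
    refine ⟨ContinuousLinearEquiv.unitsEquivAut ℝ (Units.mk0 _ hne), ?_⟩
    ext
    simp
  have pn : ((⊤ : ℕ∞) : WithTop ℕ∞) ≠ 0 := by simp
  have e1 := cdf.eventually_apply_implicitFunction pn if₂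
  have e2 := cdf.contDiffAt_implicitFunction pn if₂
  have e3 := cdf.implicitFunction_apply_self pn if₂
  set χ := cdf.implicitFunction pn if₂ with hχ
  refine ⟨χ, e2, e3, ?_⟩
  have hfu : f u = 0 := by simp only [hf, hu, h0]; ring
  have hcont : ContinuousAt (fun q : ℝ × ℝ => (X q.1 (χ q)).1 * Real.cos q.2 + (X q.1 (χ q)).2 * Real.sin q.2)
      (t0, θ0) := by
    have a : ContinuousAt (fun q : ℝ × ℝ => X q.1 (χ q)) (t0, θ0) := by
      refine ContinuousAt.comp (g := fun p : ℝ × ℝ => X p.1 p.2) (f := fun q : ℝ × ℝ => (q.1, χ q)) ?_ ?_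
      · change ContinuousAt _ (t0, χ (t0, θ0))
        exact (cd_at h ht _).continuousAt
      · have := e2.continuousAt
        exact continuousAt_fst.prodMk this
    have a1 := a.fst
    have a2 := a.snd
    refine ContinuousAt.add (a1.mul ?_) (a2.mul ?_) <;> fun_prop
  have hpos : 0 < (fun q : ℝ × ℝ => (X q.1 (χ q)).1 * Real.cos q.2 + (X q.1 (χ q)).2 * Real.sin q.2)
      (t0, θ0) := by
    change 0 < (X t0 (χ (t0, θ0))).1 * Real.cos θ0 + (X t0 (χ (t0, θ0))).2 * Real.sin θ0
    have : χ (t0, θ0) = φ0 := e3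
    rw [this, h0]
    have := Real.cos_sq_add_sin_sq θ0
    simp only
    have : R0 * Real.cos θ0 * Real.cos θ0 + R0 * Real.sin θ0 * Real.sin θ0 = R0 := by
      linear_combination R0 * this
    rw [this]; exact hR0
  filter_upwards [e1, hcont.eventually (lt_mem_nhds hpos)] with q hq1 hq2
  refine ⟨_, hq2, rfl, ?_⟩
  rw [hfu] at hq1
  simp only [hf] at hq1
  have cs := Real.cos_sq_add_sin_sq q.2
  ext
  · simp only
    linear_combination (-(X q.1 (χ q)).1) * cs - Real.sin q.2 * hq1
  · simp only
    linear_combination (-(X q.1 (χ q)).2) * cs + Real.cos q.2 * hq1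

theorem PRep.sm (r : PRep X T1 ρ) (h : IsGAPFSolutionOn X X₀ (Ico 0 Ts)) (h1 : T1 ≤ Ts)
    (hg : Good X T1) : Sm T1 ρ := by
  rintro ⟨t, θ⟩ ⟨ht, -⟩
  apply ContDiffAt.contDiffWithinAt
  change t ∈ Ioo 0 T1 at ht
  obtain ⟨φ, hφ⟩ := r.ex t ⟨ht.1.le, ht.2⟩ θ
  obtain ⟨χ, c1, c2, c3⟩ := local_inv h ⟨ht.1, ht.2.trans_le h1⟩ (hg t ⟨ht.1.le, ht.2⟩ φ) (Real.exp_pos _) hφ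
  have hXc : ContDiffAt ℝ (⊤ : ℕ∞) (fun q : ℝ × ℝ => X q.1 (χ q)) (t, θ) := by
    refine ContDiffAt.comp (g := fun p : ℝ × ℝ => X p.1 p.2) (f := fun q : ℝ × ℝ => (q.1, χ q)) (t, θ) ?_ ?_
    · exact cd_at h ⟨ht.1, ht.2.trans_le h1⟩ _
    · exact contDiffAt_fst.prodMk c1
  have a1 := hXc.fst
  have a2 := hXc.snd
  have hR : ContDiffAt ℝ (⊤ : ℕ∞) (fun q : ℝ × ℝ =>
      (X q.1 (χ q)).1 * Real.cos q.2 + (X q.1 (χ q)).2 * Real.sin q.2) (t, θ) := by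
    refine ContDiffAt.add (a1.mul ?_) (a2.mul ?_)
    · exact ContDiffAt.cos (by fun_prop)
    · exact ContDiffAt.sin (by fun_prop)
  obtain ⟨R, hR0, hR1, -⟩ := c3.self_of_nhds
  refine (hR.log (by rw [← hR1]; exact hR0.ne')).congr_of_eventuallyEq ?_
  have hn : ∀ᶠ q : ℝ × ℝ in 𝓝 (t, θ), q.1 ∈ Ioo 0 T1 :=
    continuousAt_fst.eventually (isOpen_Ioo.mem_nhds ht)
  filter_upwards [c3, hn] with q hq hqt
  obtain ⟨R, hR0, hR1, hR2⟩ := hq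
  rw [← hR1, r.un q.1 ⟨hqt.1.le, hqt.2⟩ q.2 _ R hR0 hR2, Real.log_exp]

end PolarSec


/-! ### Geometric quantities in polar coordinates -/

section PolarId
variable {X : ℝ → ℝ → ℝ × ℝ} {X₀ : ℝ → ℝ × ℝ} {Ts T1 : ℝ} {ρ : ℝ → ℝ → ℝ}

theorem PRep.exists_angle (r : PRep X T1 ρ) (h : IsGAPFSolutionOn X X₀ (Ico 0 Ts)) (h1 : T1 ≤ Ts)
    (hg : Good X T1) {t : ℝ} (ht : t ∈ Ico 0 T1) :
    ∃ Θ : ℝ → ℝ, (∀ φ, HasDerivAt Θ (angv (X t) φ) φ) ∧ ∀ φ, X t φ =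
      (Real.exp (ρ t (Θ φ)) * Real.cos (Θ φ), Real.exp (ρ t (Θ φ)) * Real.sin (Θ φ)) := by
  obtain ⟨Θ, hΘ, hR⟩ := _root_.exists_angle (h.curve t ⟨ht.1, ht.2.trans_le h1⟩) (hg t ht)
  refine ⟨Θ, hΘ, fun φ => ?_⟩
  obtain ⟨R, hR0, hR1⟩ := hR φ
  rw [← r.un t ht _ _ R hR0 hR1]; exact hR1

theorem angv_diff {Y : ℝ → ℝ × ℝ} (hY : IsSmoothClosedCurve Y) (hdet : ∀ φ, 0 < vdet (Y φ) (deriv Y φ)) (φ : ℝ) :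
    DifferentiableAt ℝ (angv Y) φ := by
  have h0 := hY.smooth.differentiable (by simp) φ
  have h2 : DifferentiableAt ℝ (deriv Y) φ :=
    (contDiff_infty_iff_deriv.1 hY.smooth).2.differentiable (by simp) φ
  unfold angv vdet
  exact DifferentiableAt.div (by fun_prop) (by fun_prop) (nsq_pos_of_det (hdet φ).ne').ne'

theorem hasDerivAt_pair_unique {Y : ℝ → ℝ × ℝ} {a b φ : ℝ} (h1 : HasDerivAt (fun x => (Y x).1) a φ)
    (h2 : HasDerivAt (fun x => (Y x).2) b φ) : deriv Y φ = (a, b) :=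
  (h1.prodMk h2).deriv

theorem Sm.hasD_polar (hs : Sm T1 ρ) {t : ℝ} (ht : t ∈ Ioo 0 T1) {Θ : ℝ → ℝ} {a φ : ℝ} (hΘ : HasDerivAt Θ a φ) :
    HasDerivAt (fun φ => Real.exp (ρ t (Θ φ))) (Real.exp (ρ t (Θ φ)) * (Dx ρ t (Θ φ) * a)) φ :=
  ((hs.hasDx ht (Θ φ)).comp φ hΘ).exp

theorem space_deriv (hs : Sm T1 ρ) {t : ℝ} (ht : t ∈ Ioo 0 T1) {Θ : ℝ → ℝ}
    (hΘ : ∀ φ, HasDerivAt Θ (angv (X t) φ) φ)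
    (hX : ∀ φ, X t φ = (Real.exp (ρ t (Θ φ)) * Real.cos (Θ φ), Real.exp (ρ t (Θ φ)) * Real.sin (Θ φ))) (φ : ℝ) :
    deriv (X t) φ =
      (angv (X t) φ * (Real.exp (ρ t (Θ φ)) * (Dx ρ t (Θ φ) * Real.cos (Θ φ) - Real.sin (Θ φ))),
       angv (X t) φ * (Real.exp (ρ t (Θ φ)) * (Dx ρ t (Θ φ) * Real.sin (Θ φ) + Real.cos (Θ φ)))) := by
  have e := hs.hasD_polar ht (hΘ φ)
  have hXf : X t = fun φ => (Real.exp (ρ t (Θ φ)) * Real.cos (Θ φ), Real.exp (ρ t (Θ φ)) * Real.sin (Θ φ)) :=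
    funext hX
  have h1 := e.mul (hΘ φ).cos
  have h2 := e.mul (hΘ φ).sin
  have h3 := (h1.prodMk h2).deriv
  have h4 : deriv (X t) φ = _ := Eq.trans (congrArg (fun f => deriv f φ) hXf) h3
  rw [h4]
  ext
  · simp only; ring
  · simp only; ring

theorem space_deriv2 (hs : Sm T1 ρ) {t : ℝ} (ht : t ∈ Ioo 0 T1) {Θ : ℝ → ℝ}
    (hΘ : ∀ φ, HasDerivAt Θ (angv (X t) φ) φ)
    (hX : ∀ φ, X t φ = (Real.exp (ρ t (Θ φ)) * Real.cos (Θ φ), Real.exp (ρ t (Θ φ)) * Real.sin (Θ φ))) (φ : ℝ)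
    (hd : DifferentiableAt ℝ (angv (X t)) φ) :
    ∃ b, deriv (deriv (X t)) φ =
      (b * (Dx ρ t (Θ φ) * Real.cos (Θ φ) - Real.sin (Θ φ)) + angv (X t) φ ^ 2 * Real.exp (ρ t (Θ φ)) *
        (Dx (Dx ρ) t (Θ φ) * Real.cos (Θ φ) - Dx ρ t (Θ φ) * Real.sin (Θ φ) - Real.cos (Θ φ)),
      b * (Dx ρ t (Θ φ) * Real.sin (Θ φ) + Real.cos (Θ φ)) + angv (X t) φ ^ 2 * Real.exp (ρ t (Θ φ)) *
        (Dx (Dx ρ) t (Θ φ) * Real.sin (Θ φ) + Dx ρ t (Θ φ) * Real.cos (Θ φ) - Real.sin (Θ φ))) := by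
  have e := hs.hasD_polar ht (hΘ φ)
  have hXf := funext (space_deriv hs ht hΘ hX)
  have p := (hs.dx.hasDx ht (Θ φ)).comp φ (hΘ φ)
  have h1 := hd.hasDerivAt.mul (e.mul ((p.mul (hΘ φ).cos).sub (hΘ φ).sin))
  have h2 := hd.hasDerivAt.mul (e.mul ((p.mul (hΘ φ).sin).add (hΘ φ).cos))
  have h3 := (h1.prodMk h2).deriv
  have h4 : deriv (deriv (X t)) φ = _ := Eq.trans (congrArg (fun f => deriv f φ) hXf) h3
  refine ⟨deriv (angv (X t)) φ * Real.exp (ρ t (Θ φ)) +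
    angv (X t) φ * (Real.exp (ρ t (Θ φ)) * (Dx ρ t (Θ φ) * angv (X t) φ)), ?_⟩
  rw [h4]
  ext
  · simp only [Pi.mul_apply, Pi.sub_apply, Pi.add_apply, Function.comp]; ring
  · simp only [Pi.mul_apply, Pi.sub_apply, Pi.add_apply, Function.comp]; ring

theorem polar_v (hs : Sm T1 ρ) {t : ℝ} (ht : t ∈ Ioo 0 T1) {Θ : ℝ → ℝ}
    (hΘ : ∀ φ, HasDerivAt Θ (angv (X t) φ) φ)
    (hX : ∀ φ, X t φ = (Real.exp (ρ t (Θ φ)) * Real.cos (Θ φ), Real.exp (ρ t (Θ φ)) * Real.sin (Θ φ)))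
    (φ : ℝ) (ha : 0 < angv (X t) φ) :
    vnorm (deriv (X t) φ) = Real.exp (ρ t (Θ φ)) * pw ρ t (Θ φ) * angv (X t) φ := by
  unfold vnorm
  rw [space_deriv hs ht hΘ hX φ]
  have hw := pw_pos ρ t (Θ φ)
  have hw2 := pw_sq ρ t (Θ φ)
  rw [Real.sqrt_eq_iff_mul_self_eq (by positivity) (by positivity)]
  have cs := Real.cos_sq_add_sin_sq (Θ φ)
  simp only
  linear_combination -(angv (X t) φ * Real.exp (ρ t (Θ φ))) ^ 2 * hw2 +
    (angv (X t) φ * Real.exp (ρ t (Θ φ))) ^ 2 * (1 + Dx ρ t (Θ φ) ^ 2) * cs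

theorem polar_det (hs : Sm T1 ρ) {t : ℝ} (ht : t ∈ Ioo 0 T1) {Θ : ℝ → ℝ}
    (hΘ : ∀ φ, HasDerivAt Θ (angv (X t) φ) φ)
    (hX : ∀ φ, X t φ = (Real.exp (ρ t (Θ φ)) * Real.cos (Θ φ), Real.exp (ρ t (Θ φ)) * Real.sin (Θ φ)))
    (φ : ℝ) :
    vdet (X t φ) (deriv (X t) φ) = Real.exp (ρ t (Θ φ)) ^ 2 * angv (X t) φ := by
  rw [space_deriv hs ht hΘ hX φ, hX φ]
  unfold vdet
  have cs := Real.cos_sq_add_sin_sq (Θ φ)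
  simp only
  linear_combination angv (X t) φ * Real.exp (ρ t (Θ φ)) ^ 2 * cs

theorem polar_curv (hs : Sm T1 ρ) {t : ℝ} (ht : t ∈ Ioo 0 T1) {Θ : ℝ → ℝ}
    (hΘ : ∀ φ, HasDerivAt Θ (angv (X t) φ) φ)
    (hX : ∀ φ, X t φ = (Real.exp (ρ t (Θ φ)) * Real.cos (Θ φ), Real.exp (ρ t (Θ φ)) * Real.sin (Θ φ)))
    (φ : ℝ) (ha : 0 < angv (X t) φ) (hd : DifferentiableAt ℝ (angv (X t)) φ) :
    curv (X t) φ = pk ρ t (Θ φ) := by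
  unfold curv
  rw [polar_v hs ht hΘ hX φ ha]
  obtain ⟨b, hb⟩ := space_deriv2 hs ht hΘ hX φ hd
  rw [hb, space_deriv hs ht hΘ hX φ]
  have hw := pw_pos ρ t (Θ φ)
  have cs := Real.cos_sq_add_sin_sq (Θ φ)
  have he := Real.exp_pos (ρ t (Θ φ))
  unfold pk vdet
  simp only
  rw [div_eq_div_iff (by positivity) (by positivity)]
  linear_combination (angv (X t) φ ^ 3 * Real.exp (ρ t (Θ φ)) ^ 2 *
    (Dx ρ t (Θ φ) ^ 2 + 1 - Dx (Dx ρ) t (Θ φ)) * (Real.exp (ρ t (Θ φ)) * pw ρ t (Θ φ) ^ 3)) * cs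

theorem polar_u (hs : Sm T1 ρ) {t : ℝ} (ht : t ∈ Ioo 0 T1) {Θ : ℝ → ℝ}
    (hΘ : ∀ φ, HasDerivAt Θ (angv (X t) φ) φ)
    (hX : ∀ φ, X t φ = (Real.exp (ρ t (Θ φ)) * Real.cos (Θ φ), Real.exp (ρ t (Θ φ)) * Real.sin (Θ φ)))
    (φ : ℝ) (ha : 0 < angv (X t) φ) :
    vdet (X t φ) (deriv (X t) φ) / vnorm (deriv (X t) φ) = pu ρ t (Θ φ) := by
  rw [polar_det hs ht hΘ hX, polar_v hs ht hΘ hX φ ha]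
  have hw := pw_pos ρ t (Θ φ)
  have he := Real.exp_pos (ρ t (Θ φ))
  unfold pu
  field_simp

theorem polar_len (hs : Sm T1 ρ) (hY : IsSmoothClosedCurve (X t))
    (hdet : ∀ φ, 0 < vdet (X t φ) (deriv (X t) φ)) (hJ : totang (X t) = 2 * π)
    (hper : ∀ x, ρ t (x + 2 * π) = ρ t x) (ht : t ∈ Ioo 0 T1) {Θ : ℝ → ℝ}
    (hΘ : ∀ φ, HasDerivAt Θ (angv (X t) φ) φ)
    (hX : ∀ φ, X t φ = (Real.exp (ρ t (Θ φ)) * Real.cos (Θ φ), Real.exp (ρ t (Θ φ)) * Real.sin (Θ φ))) :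
    clen (X t) = plen ρ t := by
  unfold clen plen
  have hgc : Continuous fun x => Real.exp (ρ t x) * pw ρ t x :=
    (hs.exp.continuous_slice ht).mul (hs.pw.continuous_slice ht)
  have e : (fun φ => vnorm (deriv (X t) φ)) =
      fun φ => ((fun x => Real.exp (ρ t x) * pw ρ t x) ∘ Θ) φ * angv (X t) φ := by
    funext φ; exact polar_v hs ht hΘ hX φ (angv_pos hdet φ)
  rw [e, intervalIntegral.integral_comp_mul_deriv (fun x _ => hΘ x) (angv_cont hY hdet).continuousOn hgc]
  have e2 := angle_shift hY hdet hΘ 0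
  rw [zero_add, hJ] at e2
  rw [e2]
  have hp : Function.Periodic (fun x => Real.exp (ρ t x) * pw ρ t x) (2 * π) := by
    intro x
    simp only [pw, hper, Dx_periodic hper]
  have := hp.intervalIntegral_add_eq (Θ 0) 0
  rwa [zero_add] at this

/-- The evolution of the radial function. -/
theorem PRep.pde (r : PRep X T1 ρ) (h : IsGAPFSolutionOn X X₀ (Ico 0 Ts)) (h1 : T1 ≤ Ts)
    (hg : Good X T1) {t : ℝ} (ht : t ∈ Ioo 0 T1) (φ θ : ℝ)
    (hφ : X t φ = (Real.exp (ρ t θ) * Real.cos θ, Real.exp (ρ t θ) * Real.sin θ)) :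
    Dt ρ t θ * vdet (X t φ) (deriv (X t) φ) =
      -(curv (X t) φ - 2 * π / clen (X t)) * vnorm (deriv (X t) φ) := by
  have hs := r.sm h h1 hg
  have ht' : t ∈ Ioo 0 Ts := ⟨ht.1, ht.2.trans_le h1⟩
  obtain ⟨χ, c1, c2, c3⟩ := local_inv h ht' (hg t ⟨ht.1.le, ht.2⟩ φ) (Real.exp_pos _) hφ
  obtain ⟨α, hα⟩ := h.flow
  have hflow := (hα t ⟨ht'.1.le, ht'.2⟩ φ).hasDerivAt (Ico_mem_nhds ht'.1 ht'.2)
  have hL := ((cd_at h ht' φ).differentiableAt (by simp)).hasFDerivAt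
  set L := fderiv ℝ (fun p : ℝ × ℝ => X p.1 p.2) (t, φ) with hLdef
  have hL1 : L (1, 0) = α t φ • unitTangent (X t) φ +
      (curv (X t) φ - 2 * π / clen (X t)) • innerNormal (X t) φ := by
    have a : HasDerivAt (fun y : ℝ => (y, φ)) ((1 : ℝ), (0 : ℝ)) t :=
      (hasDerivAt_id t).prodMk (hasDerivAt_const t φ)
    have c : HasDerivAt (fun s => X s φ) (L (1, 0)) t :=
      HasFDerivAt.comp_hasDerivAt (l := fun p : ℝ × ℝ => X p.1 p.2) (f := fun y : ℝ => (y, φ)) t hL a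
    exact c.unique hflow
  have hL2 : L (0, 1) = deriv (X t) φ := by
    have a : HasDerivAt (fun y : ℝ => (t, y)) ((0 : ℝ), (1 : ℝ)) φ :=
      (hasDerivAt_const φ t).prodMk (hasDerivAt_id φ)
    exact (hL.comp_hasDerivAt φ a).deriv.symm
  have hχ : HasDerivAt (fun s => χ (s, θ)) (fderiv ℝ χ (t, θ) (1, 0)) t := by
    have a : HasDerivAt (fun y : ℝ => (y, θ)) ((1 : ℝ), (0 : ℝ)) t :=
      (hasDerivAt_id t).prodMk (hasDerivAt_const t θ)
    exact (c1.differentiableAt (by simp)).hasFDerivAt.comp_hasDerivAt t a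
  set b := fderiv ℝ χ (t, θ) (1, 0) with hb
  have hc : HasDerivAt (fun s => X s (χ (s, θ))) (L (1, b)) t := by
    have a : HasDerivAt (fun s : ℝ => (s, χ (s, θ))) ((1 : ℝ), b) t := (hasDerivAt_id t).prodMk hχ
    have hL' : HasFDerivAt (fun p : ℝ × ℝ => X p.1 p.2) L ((fun s : ℝ => (s, χ (s, θ))) t) := by
      simp only [c2]; exact hL
    exact hL'.comp_hasDerivAt t a
  have hcE : (fun s => X s (χ (s, θ))) =ᶠ[𝓝 t]
      fun s => (Real.exp (ρ s θ) * Real.cos θ, Real.exp (ρ s θ) * Real.sin θ) := by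
    have hn : ∀ᶠ s in 𝓝 t, s ∈ Ioo 0 T1 := isOpen_Ioo.mem_nhds ht
    have hcc : ContinuousAt (fun s : ℝ => (s, θ)) t := by fun_prop
    filter_upwards [hn, hcc.eventually c3] with s hs1 hs2
    obtain ⟨R, hR, -, hR2⟩ := hs2
    rw [← r.un s ⟨hs1.1.le, hs1.2⟩ θ _ R hR hR2]; exact hR2
  have hE := hasDt_exp hs ht θ
  have hd2 := (hE.mul_const (Real.cos θ)).prodMk (hE.mul_const (Real.sin θ))
  have key := (hc.congr_of_eventuallyEq hcE.symm).unique hd2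
  have hsplit : L (1, b) = L (1, 0) + b • L (0, 1) := by
    rw [← map_smul, ← map_add]; simp
  rw [hsplit, hL1, hL2] at key
  have hv := vnorm_pos ((h.curve t ⟨ht'.1.le, ht'.2⟩).regular φ)
  have hv2 : vnorm (deriv (X t) φ) ^ 2 = (deriv (X t) φ).1 ^ 2 + (deriv (X t) φ).2 ^ 2 :=
    Real.sq_sqrt (by positivity)
  have k1 := congrArg Prod.fst key
  have k2 := congrArg Prod.snd key
  unfold innerNormal unitTangent at k1 k2
  simp only [Prod.fst_add, Prod.snd_add, Prod.smul_fst, Prod.smul_snd, smul_eq_mul] at k1 k2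
  rw [hφ]
  unfold vdet
  simp only
  generalize curv (X t) φ - 2 * π / clen (X t) = K at *
  generalize vnorm (deriv (X t) φ) = v at *
  generalize (deriv (X t) φ).1 = x1 at *
  generalize (deriv (X t) φ).2 = y1 at *
  have hvi : v⁻¹ * v = 1 := inv_mul_cancel₀ hv.ne'
  linear_combination (-y1) * k1 + x1 * k2 + K * v⁻¹ * hv2 - K * v * hvi

theorem PRep.pol (r : PRep X T1 ρ) (h : IsGAPFSolutionOn X X₀ (Ico 0 Ts)) (h1 : T1 ≤ Ts)
    (hg : Good X T1) (hemb : IsEmbeddedCurve X₀) : Pol T1 ρ (fun t => 2 * π / clen (X t)) := by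
  have hs := r.sm h h1 hg
  refine ⟨hs, fun t ht x => r.per ⟨ht.1.le, ht.2⟩ x, ?_, ?_⟩
  · intro t ht θ
    have ht' : t ∈ Ico 0 T1 := ⟨ht.1.le, ht.2⟩
    have hY := h.curve t ⟨ht.1.le, ht.2.trans_le h1⟩
    obtain ⟨Θ, hΘ, hX⟩ := r.exists_angle h h1 hg ht'
    obtain ⟨φ, rfl⟩ := angle_surj hY (hg t ht') hΘ θ
    have e := r.pde h h1 hg ht φ _ (hX φ)
    have ha := angv_pos (hg t ht') φ
    rw [polar_det hs ht hΘ hX, polar_curv hs ht hΘ hX φ ha (angv_diff hY (hg t ht') φ),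
      polar_v hs ht hΘ hX φ ha] at e
    have hw := pw_pos ρ t (Θ φ)
    have he := Real.exp_pos (ρ t (Θ φ))
    rw [eq_div_iff he.ne']
    have hne : Real.exp (ρ t (Θ φ)) * angv (X t) φ ≠ 0 := by positivity
    apply mul_right_cancel₀ hne
    linear_combination e
  · intro t ht
    have ht' : t ∈ Ico 0 T1 := ⟨ht.1.le, ht.2⟩
    have hY := h.curve t ⟨ht.1.le, ht.2.trans_le h1⟩
    obtain ⟨Θ, hΘ, hX⟩ := r.exists_angle h h1 hg ht'
    rw [polar_len hs hY (hg t ht') (totang_const h h1 hg hemb ht') (fun x => r.per ht' x) ht hΘ hX]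

end PolarId


/-! ### Conclusion -/

section Concl
variable {X : ℝ → ℝ → ℝ × ℝ} {X₀ : ℝ → ℝ × ℝ} {Ts T1 : ℝ} {ρ : ℝ → ℝ → ℝ}

theorem bound_strip {q : ℝ → ℝ → ℝ} {T t1 : ℝ}
    (hc : ContinuousOn (fun p : ℝ × ℝ => q p.1 p.2) (Ico 0 T ×ˢ univ))
    (hper : ∀ t ∈ Ico 0 T, Function.Periodic (q t) (2 * π)) (h1 : t1 < T) :
    ∃ K, ∀ t ∈ Icc 0 t1, ∀ φ, |q t φ| ≤ K := by
  have hcomp : IsCompact (Icc (0:ℝ) t1 ×ˢ Icc (0:ℝ) (2 * π)) := isCompact_Icc.prod isCompact_Icc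
  obtain ⟨K, hK⟩ := hcomp.exists_bound_of_continuousOn (hc.mono
    (prod_mono (fun t ht => ⟨ht.1, ht.2.trans_lt h1⟩) (subset_univ _)))
  refine ⟨K, fun t ht φ => ?_⟩
  obtain ⟨y, hy, hxy⟩ := (hper t ⟨ht.1, ht.2.trans_lt h1⟩).exists_mem_Ico₀ (by positivity) φ
  rw [hxy]
  exact hK (t, y) ⟨ht, hy.1, hy.2.le⟩

theorem PRep.hK (r : PRep X T1 ρ) (h : IsGAPFSolutionOn X X₀ (Ico 0 Ts)) (h1 : T1 ≤ Ts)
    (hg : Good X T1) {t1 : ℝ} (ht1 : t1 ∈ Ioo 0 T1) :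
    ∃ K0, ∀ t ∈ Ioo 0 t1, ∀ x, |pk ρ t x / pu ρ t x| ≤ K0 := by
  have hs := r.sm h h1 hg
  have hss : Ico 0 T1 ×ˢ (univ : Set ℝ) ⊆ Ico 0 Ts ×ˢ univ := prod_mono (Ico_subset_Ico_right h1) subset_rfl
  have hvp : ∀ t ∈ Ico 0 T1, ∀ φ, 0 < vnorm (deriv (X t) φ) := fun t ht φ =>
    vnorm_pos ((h.curve t ⟨ht.1, ht.2.trans_le h1⟩).regular φ)
  obtain ⟨K, hK⟩ := bound_strip (q := fun t φ =>
      curv (X t) φ / (vdet (X t φ) (deriv (X t) φ) / vnorm (deriv (X t) φ))) (T := T1)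
    ((h.cont_curv.mono hss).div ((h.cont_det.mono hss).div (h.cont_v.mono hss)
      (fun p hp => (hvp p.1 hp.1 p.2).ne'))
      (fun p hp => (div_pos (hg p.1 hp.1 p.2) (hvp p.1 hp.1 p.2)).ne'))
    (fun t ht φ => by
      have hp := (h.curve t ⟨ht.1, ht.2.trans_le h1⟩).periodic
      simp only
      rw [curv_periodic hp, curve_deriv_periodic hp, hp]) ht1.2
  refine ⟨K, fun t ht x => ?_⟩
  have ht' : t ∈ Ioo 0 T1 := ⟨ht.1, ht.2.trans ht1.2⟩
  have ht'' : t ∈ Ico 0 T1 := ⟨ht.1.le, ht.2.trans ht1.2⟩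
  have hY := h.curve t ⟨ht''.1, ht''.2.trans_le h1⟩
  obtain ⟨Θ, hΘ, hX⟩ := r.exists_angle h h1 hg ht''
  obtain ⟨φ, rfl⟩ := angle_surj hY (hg t ht'') hΘ x
  have ha := angv_pos (hg t ht'') φ
  rw [← polar_curv hs ht' hΘ hX φ ha (angv_diff hY (hg t ht'') φ), ← polar_u hs ht' hΘ hX φ ha]
  exact hK t ⟨ht.1.le, ht.2.le⟩ φ

theorem sym_start (hY : IsSmoothClosedCurve X₀) (hdet : ∀ φ, 0 < vdet (X₀ φ) (deriv X₀ φ))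
    (hemb : IsEmbeddedCurve X₀) (hsym : CentroSymmetricWrt X₀ 0) {φ0 φ1 : ℝ}
    (h1 : vdet (X₀ φ0) (X₀ φ1) = 0) (h2 : (X₀ φ0).1 * (X₀ φ1).1 + (X₀ φ0).2 * (X₀ φ1).2 ≤ 0) :
    (X₀ φ0).1 ^ 2 + (X₀ φ0).2 ^ 2 = (X₀ φ1).1 ^ 2 + (X₀ φ1).2 ^ 2 := by
  have hm : (fun Z => (2 : ℝ) • (0 : ℝ × ℝ) - Z) (X₀ φ1) ∈ Set.range X₀ := by
    rw [← hsym]; exact mem_image_of_mem _ (mem_range_self _)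
  obtain ⟨φ2, hφ2⟩ := hm
  have n0 := nsq_pos_of_det (hdet φ0).ne'
  have n1 := nsq_pos_of_det (hdet φ1).ne'
  obtain ⟨θ, a1, a2⟩ := exists_polar _ _ n0
  have hR := Real.sqrt_pos.2 n0
  have hRsq := Real.sq_sqrt n0.le
  set R := Real.sqrt ((X₀ φ0).1 ^ 2 + (X₀ φ0).2 ^ 2) with hRdef
  clear_value R
  have cs := Real.cos_sq_add_sin_sq θ
  have e1 : (X₀ φ2).1 = -(X₀ φ1).1 := by rw [hφ2]; simp
  have e2 : (X₀ φ2).2 = -(X₀ φ1).2 := by rw [hφ2]; simp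
  unfold vdet at h1
  rw [a1, a2] at h1 h2
  have d1 : Real.cos θ * (X₀ φ1).2 - Real.sin θ * (X₀ φ1).1 = 0 := by
    have : R * (Real.cos θ * (X₀ φ1).2 - Real.sin θ * (X₀ φ1).1) = 0 := by linarith
    exact (mul_eq_zero.1 this).resolve_left hR.ne'
  have d2 : 0 ≤ -(Real.cos θ * (X₀ φ1).1 + Real.sin θ * (X₀ φ1).2) := by
    by_contra! hlt
    nlinarith
  set m := -(Real.cos θ * (X₀ φ1).1 + Real.sin θ * (X₀ φ1).2) with hm
  have hmsq : m ^ 2 = (X₀ φ1).1 ^ 2 + (X₀ φ1).2 ^ 2 := by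
    rw [hm]
    linear_combination ((X₀ φ1).1 ^ 2 + (X₀ φ1).2 ^ 2) * cs -
      (Real.cos θ * (X₀ φ1).2 - Real.sin θ * (X₀ φ1).1) * d1
  have hm0 : 0 < m := by
    rcases d2.lt_or_eq with hlt | heq
    · exact hlt
    · rw [← heq] at hmsq; nlinarith
  have hRm : R = m := by
    refine ray_unique hY hdet (totang_embedded hY hdet hemb) (θ := θ) (φ := φ0) (φ' := φ2) hR hm0 ?_ ?_
    · exact Prod.ext a1 a2
    · ext
      · rw [e1, hm]; simp only
        linear_combination Real.sin θ * d1 + (X₀ φ1).1 * cs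
      · rw [e2, hm]; simp only
        linear_combination (-Real.cos θ) * d1 + (X₀ φ1).2 * cs
  rw [← hRsq, ← hmsq, hRm]

theorem PRep.hi (r : PRep X T1 ρ) (h : IsGAPFSolutionOn X X₀ (Ico 0 Ts)) (h1 : T1 ≤ Ts) (hT1 : 0 < T1)
    (hg : Good X T1) (hemb : IsEmbeddedCurve X₀) (hsym : CentroSymmetricWrt X₀ 0) {ε : ℝ} (hε : 0 < ε) :
    ∃ s1 > 0, ∀ s ∈ Ioo 0 T1, s < s1 → ∀ x, ρ s (x + π) - ρ s x < ε := by
  have hX0 : X 0 = X₀ := funext h.1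
  have m0 : (0:ℝ) ∈ Ico 0 T1 := ⟨le_rfl, hT1⟩
  set B : Set (ℝ × ℝ × ℝ) := Icc 0 (T1 / 2) ×ˢ (Icc 0 (2 * π) ×ˢ Icc 0 (2 * π)) with hB
  have hBc : IsCompact B := isCompact_Icc.prod (isCompact_Icc.prod isCompact_Icc)
  have c0 : ContinuousOn (fun p : ℝ × ℝ × ℝ => X p.1 p.2.1) B :=
    h.sm0.comp (f := fun p : ℝ × ℝ × ℝ => (p.1, p.2.1)) (by fun_prop)
      (fun p hp => ⟨⟨hp.1.1, by have := hp.1.2; linarith⟩, mem_univ _⟩)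
  have c1 : ContinuousOn (fun p : ℝ × ℝ × ℝ => X p.1 p.2.2) B :=
    h.sm0.comp (f := fun p : ℝ × ℝ × ℝ => (p.1, p.2.2)) (by fun_prop)
      (fun p hp => ⟨⟨hp.1.1, by have := hp.1.2; linarith⟩, mem_univ _⟩)
  set F : ℝ × ℝ × ℝ → ℝ × ℝ × ℝ := fun p =>
    (vdet (X p.1 p.2.1) (X p.1 p.2.2),
     (X p.1 p.2.1).1 * (X p.1 p.2.2).1 + (X p.1 p.2.1).2 * (X p.1 p.2.2).2,
     Real.exp ε ^ 2 * ((X p.1 p.2.2).1 ^ 2 + (X p.1 p.2.2).2 ^ 2) -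
      ((X p.1 p.2.1).1 ^ 2 + (X p.1 p.2.1).2 ^ 2)) with hF
  have hFc : ContinuousOn F B := by
    have a1 := c0.fst
    have a2 := c0.snd
    have b1 := c1.fst
    have b2 := c1.snd
    exact ((a1.mul b2).sub (a2.mul b1)).prodMk (((a1.mul b1).add (a2.mul b2)).prodMk
      ((continuousOn_const.mul ((b1.pow 2).add (b2.pow 2))).sub ((a1.pow 2).add (a2.pow 2))))
  set K := B ∩ F ⁻¹' ({0} ×ˢ (Iic 0 ×ˢ Iic 0)) with hK
  have hKc : IsCompact K := hBc.of_isClosed_subset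
    (hFc.preimage_isClosed_of_isClosed hBc.isClosed
      (isClosed_singleton.prod (isClosed_Iic.prod isClosed_Iic))) inter_subset_left
  have hI := (hKc.image continuous_fst).isClosed
  have h0 : (0:ℝ) ∉ Prod.fst '' K := by
    rintro ⟨⟨t, φ0, φ1⟩, ⟨-, hp⟩, rfl⟩
    obtain ⟨p1, p2, p3⟩ := hp
    simp only [hF, mem_singleton_iff, mem_Iic, hX0] at p1 p2 p3
    have hdet := hg 0 m0
    rw [hX0] at hdet
    have hY := h.curve 0 ⟨le_rfl, hT1.trans_le h1⟩
    rw [hX0] at hY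
    have e := sym_start hY hdet hemb hsym p1 p2
    have n1 := nsq_pos_of_det (hdet φ1).ne'
    have h5 : 1 < Real.exp ε := Real.one_lt_exp_iff.2 hε
    have h6 : 1 < Real.exp ε ^ 2 := by nlinarith
    rw [e] at p3
    nlinarith
  obtain ⟨δ, hδ, hδ2⟩ := Metric.mem_nhds_iff.1 (hI.isOpen_compl.mem_nhds h0)
  refine ⟨min δ (T1 / 2), lt_min hδ (by linarith), fun s hs hs1 x => ?_⟩
  by_contra! hcon
  have hs' : s ∈ Ico 0 T1 := ⟨hs.1.le, hs.2⟩
  have hper := (h.curve s ⟨hs.1.le, hs.2.trans_le h1⟩).periodic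
  obtain ⟨φ0', g0⟩ := r.ex s hs' (x + π)
  obtain ⟨φ1', g1⟩ := r.ex s hs' x
  obtain ⟨φ0, m0, q0⟩ := hper.exists_mem_Ico₀ (by positivity) φ0'
  obtain ⟨φ1, m1, q1⟩ := hper.exists_mem_Ico₀ (by positivity) φ1'
  rw [q0, Real.cos_add_pi, Real.sin_add_pi] at g0
  rw [q1] at g1
  have hmem : (s, φ0, φ1) ∈ K := by
    refine ⟨⟨⟨hs.1.le, (hs1.trans_le (min_le_right _ _)).le⟩, ⟨m0.1, m0.2.le⟩, m1.1, m1.2.le⟩, ?_⟩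
    have cs := Real.cos_sq_add_sin_sq x
    have pe := mul_pos (Real.exp_pos (ρ s (x + π))) (Real.exp_pos (ρ s x))
    refine ⟨?_, ?_, ?_⟩
    · simp only [hF, mem_singleton_iff, g0, g1, vdet]; ring
    · simp only [hF, mem_Iic, g0, g1]
      have : Real.exp (ρ s (x + π)) * -Real.cos x * (Real.exp (ρ s x) * Real.cos x) +
        Real.exp (ρ s (x + π)) * -Real.sin x * (Real.exp (ρ s x) * Real.sin x) =
        -(Real.exp (ρ s (x + π)) * Real.exp (ρ s x)) := by
        linear_combination (-(Real.exp (ρ s (x + π)) * Real.exp (ρ s x))) * cs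
      rw [this]; linarith
    · simp only [hF, mem_Iic, g0, g1]
      have hexp : Real.exp ε * Real.exp (ρ s x) ≤ Real.exp (ρ s (x + π)) := by
        rw [← Real.exp_add]; exact Real.exp_le_exp.2 (by linarith)
      have hsq := pow_le_pow_left₀ (by positivity) hexp 2
      have i1 : (Real.exp (ρ s x) * Real.cos x) ^ 2 + (Real.exp (ρ s x) * Real.sin x) ^ 2 =
        Real.exp (ρ s x) ^ 2 := by linear_combination Real.exp (ρ s x) ^ 2 * cs
      have i2 : (Real.exp (ρ s (x + π)) * -Real.cos x) ^ 2 + (Real.exp (ρ s (x + π)) * -Real.sin x) ^ 2 =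
        Real.exp (ρ s (x + π)) ^ 2 := by linear_combination Real.exp (ρ s (x + π)) ^ 2 * cs
      rw [i1, i2, ← mul_pow]; linarith
  have hball : s ∈ Metric.ball (0:ℝ) δ := by
    rw [Metric.mem_ball, Real.dist_eq, sub_zero, abs_of_pos hs.1]
    exact hs1.trans_le (min_le_left _ _)
  exact hδ2 hball ⟨_, hmem, rfl⟩

theorem main_good (h : IsGAPFSolutionOn X X₀ (Ico 0 Ts)) (h1 : T1 ≤ Ts) (hT1 : 0 < T1)
    (hg : Good X T1) (hemb : IsEmbeddedCurve X₀) (hsym : CentroSymmetricWrt X₀ 0) :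
    ∃ t0 ∈ Ioo 0 T1, ∃ c > 0, ∃ C, ∀ t ∈ Ico t0 T1, ∀ φ,
      c ≤ vdet (X t φ) (deriv (X t) φ) / vnorm (deriv (X t) φ) ∧ |curv (X t) φ| ≤ C := by
  obtain ⟨ρ, r⟩ := exists_rep h h1 hg hemb
  have hs := r.sm h h1 hg
  have P := r.pol h h1 hg hemb
  have hper := P.symm (fun t1 ht1 => r.hK h h1 hg ht1) (fun ε hε => r.hi h h1 hT1 hg hemb hsym hε)
  obtain ⟨t1, ht1, c, hc, C, hC⟩ := P.apriori hT1 hper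
  refine ⟨t1, ht1, c, hc, C, fun t ht φ => ?_⟩
  have ht' : t ∈ Ioo 0 T1 := ⟨ht1.1.trans_le ht.1, ht.2⟩
  have ht'' : t ∈ Ico 0 T1 := ⟨ht'.1.le, ht.2⟩
  have hY := h.curve t ⟨ht''.1, ht''.2.trans_le h1⟩
  obtain ⟨Θ, hΘ, hX⟩ := r.exists_angle h h1 hg ht''
  have ha := angv_pos (hg t ht'') φ
  rw [polar_curv hs ht' hΘ hX φ ha (angv_diff hY (hg t ht'') φ), polar_u hs ht' hΘ hX φ ha]
  exact hC t ht (Θ φ)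

theorem good_open (h : IsGAPFSolutionOn X X₀ (Ico 0 Ts)) (h0 : 0 ≤ T1) (h1 : T1 < Ts) (hg : Good X T1)
    (hd : ∀ φ, 0 < vdet (X T1 φ) (deriv (X T1) φ)) : ∃ τ, T1 < τ ∧ τ ≤ Ts ∧ Good X τ := by
  set B : Set (ℝ × ℝ) := Icc 0 ((T1 + Ts) / 2) ×ˢ Icc 0 (2 * π) with hB
  have hBc : IsCompact B := isCompact_Icc.prod isCompact_Icc
  have hFc := h.cont_det.mono (show B ⊆ _ from
    prod_mono (fun t ht => ⟨ht.1, by have := ht.2; linarith⟩) (subset_univ _))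
  set K := B ∩ (fun p : ℝ × ℝ => vdet (X p.1 p.2) (deriv (X p.1) p.2)) ⁻¹' (Iic 0) with hK
  have hKc : IsCompact K := hBc.of_isClosed_subset
    (hFc.preimage_isClosed_of_isClosed hBc.isClosed isClosed_Iic) inter_subset_left
  have hI := (hKc.image continuous_fst).isClosed
  have hn : T1 ∉ Prod.fst '' K := by
    rintro ⟨⟨t, φ⟩, ⟨-, hp⟩, rfl⟩
    exact absurd (hd φ) (not_lt.2 hp)
  obtain ⟨δ, hδ, hδ2⟩ := Metric.mem_nhds_iff.1 (hI.isOpen_compl.mem_nhds hn)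
  refine ⟨min (T1 + δ) ((T1 + Ts) / 2), lt_min (by linarith) (by linarith),
    (min_le_right _ _).trans (by linarith), fun t ht φ => ?_⟩
  rcases lt_or_ge t T1 with hlt | hge
  · exact hg t ⟨ht.1, hlt⟩ φ
  · have a1 := ht.2.trans_le (min_le_left _ _)
    have a2 := ht.2.trans_le (min_le_right _ _)
    have hball : t ∈ Metric.ball T1 δ := by
      rw [Metric.mem_ball, Real.dist_eq, abs_of_nonneg (by linarith)]; linarith
    have hp := (h.curve t ⟨ht.1, by linarith⟩).periodic
    have hp2 : Function.Periodic (fun φ => vdet (X t φ) (deriv (X t) φ)) (2 * π) := by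
      intro x; simp only; rw [curve_deriv_periodic hp, hp]
    obtain ⟨y, hy, hxy⟩ := hp2.exists_mem_Ico₀ (by positivity) φ
    rw [hxy]
    by_contra! hcon
    exact hδ2 hball ⟨(t, y), ⟨⟨⟨ht.1, a2.le⟩, hy.1, hy.2.le⟩, hcon⟩, rfl⟩

theorem good_all (h : IsGAPFSolutionOn X X₀ (Ico 0 Ts)) (hTs : 0 < Ts) (hemb : IsEmbeddedCurve X₀)
    (hsym : CentroSymmetricWrt X₀ 0) (hdet : ∀ φ, 0 < vdet (X₀ φ) (deriv X₀ φ)) : Good X Ts := by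
  set S : Set ℝ := {τ | τ ∈ Icc 0 Ts ∧ Good X τ} with hS
  have h0S : (0:ℝ) ∈ S := ⟨⟨le_rfl, hTs.le⟩, fun t ht => absurd ht.2 (not_lt.2 ht.1)⟩
  have hbd : BddAbove S := ⟨Ts, fun τ hτ => hτ.1.2⟩
  set T1 := sSup S with hT1
  have h0 : 0 ≤ T1 := le_csSup hbd h0S
  have h1 : T1 ≤ Ts := csSup_le ⟨0, h0S⟩ fun τ hτ => hτ.1.2
  have hg : Good X T1 := by
    intro t ht φ
    obtain ⟨τ, hτ, hlt⟩ := exists_lt_of_lt_csSup ⟨0, h0S⟩ ht.2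
    exact hτ.2 t ⟨ht.1, hlt⟩ φ
  rcases h1.lt_or_eq with hlt | heq
  swap
  · rwa [heq] at hg
  exfalso
  have hd : ∀ φ, 0 < vdet (X T1 φ) (deriv (X T1) φ) := by
    rcases h0.lt_or_eq with hpos | hz
    swap
    · rw [← hz, show X 0 = X₀ from funext h.1]; exact hdet
    intro φ
    obtain ⟨t0, ht0, c, hc, C, hC⟩ := main_good h h1 hpos hg hemb hsym
    have hvp : ∀ p ∈ Ico 0 Ts ×ˢ (univ : Set ℝ), 0 < vnorm (deriv (X p.1) p.2) := fun p hp =>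
      vnorm_pos ((h.curve p.1 hp.1).regular p.2)
    have hcont := h.cont_det.div h.cont_v (fun p hp => (hvp p hp).ne')
    have hmT : (T1, φ) ∈ Ico 0 Ts ×ˢ (univ : Set ℝ) := ⟨⟨h0, hlt⟩, mem_univ _⟩
    have hline : Tendsto (fun t : ℝ => (t, φ)) (𝓝[<] T1) (𝓝[Ico 0 Ts ×ˢ (univ : Set ℝ)] (T1, φ)) := by
      apply tendsto_nhdsWithin_of_tendsto_nhds_of_eventually_within
      · exact tendsto_nhdsWithin_of_tendsto_nhds (Continuous.tendsto (by fun_prop) T1)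
      · filter_upwards [Ioo_mem_nhdsLT hpos] with t ht
        exact ⟨⟨ht.1.le, ht.2.trans hlt⟩, mem_univ _⟩
    have hlim := (hcont (T1, φ) hmT).tendsto.comp hline
    have hge : c ≤ vdet (X T1 φ) (deriv (X T1) φ) / vnorm (deriv (X T1) φ) := by
      refine ge_of_tendsto hlim ?_
      filter_upwards [Ioo_mem_nhdsLT ht0.2] with t ht
      exact (hC t ⟨ht.1.le, ht.2⟩ φ).1
    have hq := hc.trans_le hge
    exact (div_pos_iff_of_pos_right (hvp _ hmT)).1 hq
  obtain ⟨τ, t1, t2, t3⟩ := good_open h h0 hlt hg hd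
  have := le_csSup hbd (show τ ∈ S from ⟨⟨h0.trans t1.le, t2⟩, t3⟩)
  linarith

end Concl


/-- The curvature of the evolving curve of Gage's area-preserving flow with a
star-shaped centrosymmetric initial curve is uniformly bounded on any finite
time interval of existence. -/
theorem gapf_curvature_uniformly_bounded
    (X : ℝ → ℝ → ℝ × ℝ) (X₀ : ℝ → ℝ × ℝ) (Tstar : ℝ) (hT : 0 < Tstar)
    (hX₀ : IsSmoothClosedCurve X₀) (hemb : IsEmbeddedCurve X₀)
    (hstar₀ : StarShapedWrt X₀ 0) (hsym₀ : CentroSymmetricWrt X₀ 0)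
    (hsol : IsGAPFSolutionOn X X₀ (Set.Ico 0 Tstar)) :
    ∃ C : ℝ, ∀ t ∈ Set.Ico (0:ℝ) Tstar, ∀ φ, |curv (X t) φ| ≤ C := by
  have hX0 : X 0 = X₀ := funext hsol.1
  have hdet : ∀ φ, 0 < vdet (X₀ φ) (deriv X₀ φ) := by
    intro φ
    have h1 := hstar₀ φ
    have hv := vnorm_pos (hX₀.regular φ)
    have h2 : vdet (X₀ φ - 0) (unitTangent X₀ φ) =
        (vnorm (deriv X₀ φ))⁻¹ * vdet (X₀ φ) (deriv X₀ φ) := by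
      unfold unitTangent vdet
      simp only [sub_zero, Prod.smul_fst, Prod.smul_snd, smul_eq_mul]
      ring
    rw [h2] at h1
    exact (pos_iff_pos_of_mul_pos h1).1 (inv_pos.2 hv)
  have hg := good_all hsol hT hemb hsym₀ hdet
  obtain ⟨t0, ht0, c, hc, C, hC⟩ := main_good hsol le_rfl hT hg hemb hsym₀
  obtain ⟨K, hK⟩ := bound_strip (q := fun t φ => curv (X t) φ) hsol.cont_curv
    (fun t ht => curv_periodic (hsol.curve t ht).periodic) ht0.2
  refine ⟨max K C, fun t ht φ => ?_⟩
  rcases le_or_gt t t0 with hle | hlt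
  · exact (hK t ⟨ht.1, hle⟩ φ).trans (le_max_left _ _)
  · exact (hC t ⟨hlt.le, ht.2⟩ φ).2.trans (le_max_right _ _)
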